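/- arXiv:2108.04421 — 3 statements merged into one kernel-verified Lean document; each statement's English description precedes it below -/
import Mathlib

section
/- For every integer N ≥ 1, every planar link pattern β ∈ LP_N, and every point x ∈ 𝔛_{2N}, the Coulomb gas integral F_β(x) is a strictly positive real number; that is, Im F_β(x) = 0 and Re F_β(x) > 0. -/
open MeasureTheory

/-- A planar link pattern of size `N`: a noncrossing perfect matching of `{1,…,2N}`,
with the links `{a r, b r}` satisfying `a r < b r` and `a` strictly increasing. -/
structure LinkPattern (N : ℕ) where
  a : Fin N → ℕ
  b : Fin N → ℕ
  a_lt_b : ∀ r, a r < b r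
  a_mono : StrictMono a
  inj : Function.Injective (fun p : Fin N × Bool => if p.2 then b p.1 else a p.1)
  cover : ∀ k : ℕ, (∃ p : Fin N × Bool, (if p.2 then b p.1 else a p.1) = k) ↔ (1 ≤ k ∧ k ≤ 2 * N)
  noncross : ∀ r s : Fin N, ¬ (a r < a s ∧ a s < b r ∧ b r < b s)

/-- The (unordered) link relation of a link pattern. -/
def LinkPattern.Linked {N : ℕ} (β : LinkPattern N) (p q : ℕ) : Prop :=
  ∃ r, (β.a r = p ∧ β.b r = q) ∨ (β.a r = q ∧ β.b r = p)

/-- The positive real integral `ρ_{k_1,…,k_N}(x)`. -/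
noncomputable def rho (N : ℕ) (k : Fin N → ℕ) (x : ℕ → ℝ) : ℝ :=
  (∏ p ∈ (Finset.Icc 1 (2 * N) ×ˢ Finset.Icc 1 (2 * N)).filter fun p => p.1 < p.2,
      (x p.2 - x p.1) ^ ((4 : ℝ)⁻¹)) *
  ∫ u : Fin N → ℝ in Set.univ.pi fun r => Set.Ioo (x (k r)) (x (k r + 1)),
    (∏ p ∈ (Finset.univ ×ˢ Finset.univ : Finset (Fin N × Fin N)).filter fun p => p.1 < p.2,
        (u p.2 - u p.1)) *
      ∏ r, ∏ i ∈ Finset.Icc 1 (2 * N), |u r - x i| ^ (-(2 : ℝ)⁻¹)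

/-- The coefficient `c_β(k_1,…,k_N)`. -/
noncomputable def linkCoeff (N : ℕ) (β : LinkPattern N) (k : Fin N → ℕ) : ℂ :=
  Complex.I ^ ((∑ r, (k r : ℤ)) - ∑ r, (β.a r : ℤ)) *
    ∑ σ : Equiv.Perm (Fin N),
      ((Equiv.Perm.sign σ : ℤ) : ℂ) *
        ∏ r, if β.a r ≤ k (σ r) ∧ k (σ r) < β.b r then (1 : ℂ) else 0

/-- The Coulomb gas integral `F_β(x)`. -/
noncomputable def coulomb (N : ℕ) (β : LinkPattern N) (x : ℕ → ℝ) : ℂ :=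
  ∑ k ∈ (Fintype.piFinset fun _ : Fin N => Finset.Icc 1 (2 * N - 1)).filter
      fun k => ∀ r s : Fin N, r < s → k r < k s,
    linkCoeff N β k * (rho N k x : ℂ)

/-- Membership in the open chamber `𝔛_{2N}` (only coordinates `1,…,2N` are relevant). -/
def IsChamber (N : ℕ) (x : ℕ → ℝ) : Prop :=
  ∀ i k : ℕ, 1 ≤ i → i < k → k ≤ 2 * N → x i < x k

namespace LinkPattern

variable {N : ℕ} (β : LinkPattern N)

lemma a_mem (r : Fin N) : 1 ≤ β.a r ∧ β.a r ≤ 2 * N :=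
  (β.cover _).1 ⟨(r, false), by simp⟩

lemma b_mem (r : Fin N) : 1 ≤ β.b r ∧ β.b r ≤ 2 * N :=
  (β.cover _).1 ⟨(r, true), by simp⟩

lemma eq_a_or_eq_b {m : ℕ} (h1 : 1 ≤ m) (h2 : m ≤ 2 * N) :
    ∃ r, β.a r = m ∨ β.b r = m := by
  obtain ⟨⟨r, b⟩, h⟩ := (β.cover m).2 ⟨h1, h2⟩
  cases b
  · exact ⟨r, Or.inl (by simpa using h)⟩
  · exact ⟨r, Or.inr (by simpa using h)⟩

/-- The link `r` covers the interval `(k, k + 1)`. -/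
def Covers (r : Fin N) (k : ℕ) : Prop := β.a r ≤ k ∧ k < β.b r

/-- The link `r` is the innermost one covering the interval `(k, k + 1)`. -/
def Innermost (r : Fin N) (k : ℕ) : Prop :=
  β.Covers r k ∧ ∀ s, r < s → ¬ β.Covers s k

variable {β}

lemma Innermost.unique {r s : Fin N} {k : ℕ} (hr : β.Innermost r k) (hs : β.Innermost s k) :
    r = s := by
  rcases lt_trichotomy r s with h | h | h
  · exact (hr.2 s h hs.1).elim
  · exact h
  · exact (hs.2 r h hr.1).elim

lemma innermost_a (r : Fin N) : β.Innermost r (β.a r) :=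
  ⟨⟨le_rfl, β.a_lt_b r⟩, fun _ hs h => (β.a_mono hs).not_ge h.1⟩

lemma Covers.exists_innermost {r : Fin N} {k : ℕ} (h : β.Covers r k) :
    ∃ s, r ≤ s ∧ β.Innermost s k := by
  classical
  have hne : (Finset.univ.filter fun s => β.Covers s k).Nonempty := ⟨r, by simpa using h⟩
  refine ⟨Finset.max' _ hne, Finset.le_max' _ r (by simpa using h), ?_, ?_⟩
  · simpa using Finset.max'_mem _ hne
  · intro s hs hc
    exact hs.not_ge (Finset.le_max' _ s (by simpa using hc))

lemma Covers.b_le_b {r s : Fin N} {k : ℕ} (hr : β.Covers r k) (hs : β.Covers s k)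
    (hrs : r ≤ s) : β.b s ≤ β.b r := by
  rcases hrs.eq_or_lt with rfl | h
  · exact le_rfl
  · by_contra! hb
    exact β.noncross r s ⟨β.a_mono h, hs.1.trans_lt hr.2, hb⟩

variable (β)

open Classical in
/-- The indicator matrix of the nesting order of the links. -/
noncomputable def nestMatrix : Matrix (Fin N) (Fin N) ℂ :=
  Matrix.of fun r s => if r ≤ s ∧ β.b s ≤ β.b r then 1 else 0

open Classical in
/-- The indicator matrix of the relation `Covers` at the points `k`. -/
noncomputable def coverMatrix (k : Fin N → ℕ) : Matrix (Fin N) (Fin N) ℂ :=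
  Matrix.of fun r j => if β.Covers r (k j) then 1 else 0

open Classical in
/-- The indicator matrix of the relation `Innermost` at the points `k`. -/
noncomputable def innermostMatrix (k : Fin N → ℕ) : Matrix (Fin N) (Fin N) ℂ :=
  Matrix.of fun r j => if β.Innermost r (k j) then 1 else 0

lemma det_nestMatrix : β.nestMatrix.det = 1 := by
  rw [Matrix.det_of_isUpperTriangular]
  · exact Finset.prod_eq_one fun r _ => by simp [nestMatrix]
  · intro r s (h : s < r)
    simp [nestMatrix, h.not_ge]

lemma coverMatrix_eq_mul (k : Fin N → ℕ) :
    β.coverMatrix k = β.nestMatrix * β.innermostMatrix k := by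
  ext r j
  rw [Matrix.mul_apply]
  by_cases h : β.Covers r (k j)
  · obtain ⟨s, hrs, hs⟩ := h.exists_innermost
    rw [Finset.sum_eq_single s]
    · simp [coverMatrix, nestMatrix, innermostMatrix, h, hs, hrs, h.b_le_b hs.1 hrs]
    · intro t _ ht
      have : ¬ β.Innermost t (k j) := fun h' => ht (h'.unique hs)
      simp [innermostMatrix, this]
    · simp
  · rw [Finset.sum_eq_zero]
    · simp [coverMatrix, h]
    · intro s _
      by_cases hn : r ≤ s ∧ β.b s ≤ β.b r
      · have : ¬ β.Innermost s (k j) := fun h' =>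
          h ⟨(β.a_mono.monotone hn.1).trans h'.1.1, h'.1.2.trans_le hn.2⟩
        simp [innermostMatrix, this]
      · simp [nestMatrix, hn]

lemma linkCoeff_eq_det (k : Fin N → ℕ) :
    linkCoeff N β k = Complex.I ^ ((∑ r, (k r : ℤ)) - ∑ r, (β.a r : ℤ)) *
      (β.innermostMatrix k).det := by
  have : (β.coverMatrix k).det = (β.innermostMatrix k).det := by
    rw [coverMatrix_eq_mul, Matrix.det_mul, det_nestMatrix, one_mul]
  rw [← this, ← Matrix.det_transpose, Matrix.det_apply']
  refine congrArg _ (Finset.sum_congr rfl fun σ _ => congrArg _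
    (Finset.prod_congr rfl fun r _ => ?_))
  simp only [coverMatrix, Covers, Matrix.transpose_apply, Matrix.of_apply]
  congr

variable {β}

/-- The points strictly after `β.a r` up to a point of the innermost region of the link `r` are
matched among themselves. -/
lemma Innermost.card_eq {r : Fin N} {m : ℕ} (h : β.Innermost r m) :
    m = β.a r + 2 * ((Finset.Ioi r).filter fun s => β.a s ≤ m).card := by
  classical
  have key : Finset.Ioc (β.a r) m =
      (((Finset.Ioi r).filter fun s => β.a s ≤ m) ×ˢ (Finset.univ : Finset Bool)).image
        (fun p : Fin N × Bool => if p.2 then β.b p.1 else β.a p.1) := by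
    ext l
    simp only [Finset.mem_Ioc, Finset.mem_image, Finset.mem_product, Finset.mem_filter,
      Finset.mem_Ioi, Finset.mem_univ, and_true]
    constructor
    · rintro ⟨h1, h2⟩
      have hb := h.1.2
      obtain ⟨s, hs | hs⟩ := β.eq_a_or_eq_b (m := l) (by omega)
        (by have := (β.b_mem r).2; omega)
      · exact ⟨(s, false), ⟨β.a_mono.lt_iff_lt.1 (by simp only; omega), by simp; omega⟩,
          by simpa using hs⟩
      · have hab := β.a_lt_b s
        refine ⟨(s, true), ⟨?_, by simp; omega⟩, by simpa using hs⟩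
        rcases lt_trichotomy r s with hrs | rfl | hrs
        · exact hrs
        · omega
        · exact (β.noncross s r ⟨β.a_mono hrs, by omega, by omega⟩).elim
    · rintro ⟨⟨s, b⟩, ⟨hrs, hsm⟩, rfl⟩
      have h1 := β.a_mono hrs
      have hab := β.a_lt_b s
      have h2 : β.b s ≤ m := by
        by_contra! hc
        exact h.2 s hrs ⟨hsm, hc⟩
      cases b <;> simp <;> grind
  have hcard := congrArg Finset.card key
  rw [Finset.card_image_of_injective _ β.inj, Finset.card_product, Nat.card_Ioc,
    Finset.card_univ, Fintype.card_bool] at hcard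
  have := h.1.1
  omega

lemma det_innermostMatrix_of_forall {k : Fin N → ℕ} {σ : Equiv.Perm (Fin N)}
    (hσ : ∀ r, β.Innermost r (k (σ r))) :
    (β.innermostMatrix k).det = ((Equiv.Perm.sign σ : ℤ) : ℂ) := by
  rw [← Matrix.det_transpose, Matrix.det_apply', Finset.sum_eq_single σ]
  · simp [innermostMatrix, hσ]
  · intro τ _ hτ
    obtain ⟨r, hr⟩ : ∃ r, τ r ≠ σ r := by
      by_contra! hc
      exact hτ (Equiv.ext hc)
    have : ¬ β.Innermost r (k (τ r)) := by
      intro h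
      have h' := hσ (σ.symm (τ r))
      rw [Equiv.apply_symm_apply] at h'
      exact hr ((Equiv.eq_symm_apply σ).1 (h.unique h')).symm
    rw [Finset.prod_eq_zero (Finset.mem_univ r) (by simp [innermostMatrix, this]), mul_zero]
  · simp

lemma det_innermostMatrix_of_not_exists {k : Fin N → ℕ}
    (h : ¬ ∃ σ : Equiv.Perm (Fin N), ∀ r, β.Innermost r (k (σ r))) :
    (β.innermostMatrix k).det = 0 := by
  rw [← Matrix.det_transpose, Matrix.det_apply']
  refine Finset.sum_eq_zero fun σ _ => ?_
  push Not at h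
  obtain ⟨r, hr⟩ := h σ
  rw [Finset.prod_eq_zero (Finset.mem_univ r) (by simp [innermostMatrix, hr]), mul_zero]

lemma linkCoeff_eq_one {k : Fin N → ℕ} (hk : StrictMono k) {σ : Equiv.Perm (Fin N)}
    (hσ : ∀ r, β.Innermost r (k (σ r))) : linkCoeff N β k = 1 := by
  have hsign : ((Equiv.Perm.sign σ : ℤ) : ℂ) =
      ∏ r, (-1 : ℂ) ^ ((Finset.Ioi r).filter fun s => β.a s ≤ k (σ r)).card := by
    rw [Equiv.Perm.sign_eq_prod_prod_Ioi]
    push_cast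
    refine Finset.prod_congr rfl fun r _ => ?_
    rw [← Finset.prod_const, Finset.prod_filter]
    refine Finset.prod_congr rfl fun s hs => ?_
    rw [Finset.mem_Ioi] at hs
    have hiff : σ r < σ s ↔ ¬ β.a s ≤ k (σ r) := by
      constructor
      · intro hlt ha
        have h1 : ¬ k (σ r) < β.b s := fun hc => (hσ r).2 s hs ⟨ha, hc⟩
        have h2 := (hσ s).1.2
        have h3 := hk hlt
        omega
      · intro ha
        have h2 := (hσ s).1.1
        exact hk.lt_iff_lt.1 (by omega)
    by_cases h : β.a s ≤ k (σ r) <;> simp [hiff, h]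
  have hsum : (∑ r, (k r : ℤ)) - ∑ r, (β.a r : ℤ) =
      ((∑ r, 2 * ((Finset.Ioi r).filter fun s => β.a s ≤ k (σ r)).card : ℕ) : ℤ) := by
    rw [← Equiv.sum_comp σ, ← Finset.sum_sub_distrib]
    push_cast
    refine Finset.sum_congr rfl fun r _ => ?_
    have := (hσ r).card_eq
    omega
  rw [linkCoeff_eq_det, det_innermostMatrix_of_forall hσ, hsign, hsum, zpow_natCast,
    ← Finset.prod_pow_eq_pow_sum, ← Finset.prod_mul_distrib]
  refine Finset.prod_eq_one fun r _ => ?_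
  rw [pow_mul, Complex.I_sq, ← mul_pow]
  norm_num

lemma linkCoeff_a : linkCoeff N β β.a = 1 :=
  linkCoeff_eq_one β.a_mono (σ := 1) fun r => innermost_a r

lemma linkCoeff_eq_zero_or_one {k : Fin N → ℕ} (hk : StrictMono k) :
    linkCoeff N β k = 0 ∨ linkCoeff N β k = 1 := by
  by_cases h : ∃ σ : Equiv.Perm (Fin N), ∀ r, β.Innermost r (k (σ r))
  · obtain ⟨σ, hσ⟩ := h
    exact Or.inr (linkCoeff_eq_one hk hσ)
  · left
    rw [linkCoeff_eq_det, det_innermostMatrix_of_not_exists h, mul_zero]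

end LinkPattern

section Integrals

variable {N : ℕ} {k : Fin N → ℕ} {x : ℕ → ℝ}

/-- The domain of integration of `rho`. -/
def rhoDomain (k : Fin N → ℕ) (x : ℕ → ℝ) : Set (Fin N → ℝ) :=
  Set.univ.pi fun r => Set.Ioo (x (k r)) (x (k r + 1))

/-- The integrand of `rho`. -/
noncomputable def rhoIntegrand (N : ℕ) (x : ℕ → ℝ) (u : Fin N → ℝ) : ℝ :=
  (∏ p ∈ (Finset.univ ×ˢ Finset.univ : Finset (Fin N × Fin N)).filter fun p => p.1 < p.2,
      (u p.2 - u p.1)) *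
    ∏ r, ∏ i ∈ Finset.Icc 1 (2 * N), |u r - x i| ^ (-(2 : ℝ)⁻¹)

lemma IsChamber.monotone (hx : IsChamber N x) {i j : ℕ} (hi : 1 ≤ i) (hij : i ≤ j)
    (hj : j ≤ 2 * N) : x i ≤ x j := by
  rcases hij.eq_or_lt with rfl | h
  · exact le_rfl
  · exact (hx i j hi h hj).le

lemma IsChamber.ne_of_mem_Ioo (hx : IsChamber N x) {j i : ℕ} (hj : 1 ≤ j) (hj' : j + 1 ≤ 2 * N)
    (hi : i ∈ Finset.Icc 1 (2 * N)) {t : ℝ} (ht : t ∈ Set.Ioo (x j) (x (j + 1))) : t ≠ x i := by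
  rw [Finset.mem_Icc] at hi
  rintro rfl
  rcases le_or_gt i j with h | h
  · exact (hx.monotone hi.1 h (by omega)).not_gt ht.1
  · exact (hx.monotone (by omega) (Nat.succ_le_of_lt h) hi.2).not_gt ht.2

lemma rhoIntegrand_pos (hx : IsChamber N x) (hk : StrictMono k)
    (hmem : ∀ r, k r ∈ Finset.Icc 1 (2 * N - 1)) {u : Fin N → ℝ} (hu : u ∈ rhoDomain k x) :
    0 < rhoIntegrand N x u := by
  have hu' : ∀ r, u r ∈ Set.Ioo (x (k r)) (x (k r + 1)) := fun r => hu r (Set.mem_univ r)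
  have hm : ∀ r, 1 ≤ k r ∧ k r + 1 ≤ 2 * N := fun r => by
    have := Finset.mem_Icc.1 (hmem r)
    omega
  refine mul_pos (Finset.prod_pos fun p hp => ?_)
    (Finset.prod_pos fun r _ => Finset.prod_pos fun i hi => ?_)
  · have hlt := hk (Finset.mem_filter.1 hp).2
    have h1 := (hu' p.1).2
    have h2 := (hu' p.2).1
    have h3 := hx.monotone (i := k p.1 + 1) (j := k p.2) (by omega) hlt (by have := hm p.2; omega)
    linarith
  · exact Real.rpow_pos_of_pos (abs_pos.2 (sub_ne_zero.2
      (hx.ne_of_mem_Ioo (hm r).1 (hm r).2 hi (hu' r)))) _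

lemma measurableSet_rhoDomain : MeasurableSet (rhoDomain k x) :=
  MeasurableSet.univ_pi fun _ => measurableSet_Ioo

lemma rhoPrefactor_pos (hx : IsChamber N x) :
    0 < ∏ p ∈ (Finset.Icc 1 (2 * N) ×ˢ Finset.Icc 1 (2 * N)).filter fun p => p.1 < p.2,
      (x p.2 - x p.1) ^ ((4 : ℝ)⁻¹) := by
  refine Finset.prod_pos fun p hp => Real.rpow_pos_of_pos (sub_pos.2 ?_) _
  simp only [Finset.mem_filter, Finset.mem_product, Finset.mem_Icc] at hp
  exact hx _ _ hp.1.1.1 hp.2 hp.1.2.2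

lemma rho_nonneg (hx : IsChamber N x) (hk : StrictMono k)
    (hmem : ∀ r, k r ∈ Finset.Icc 1 (2 * N - 1)) : 0 ≤ rho N k x :=
  mul_nonneg (rhoPrefactor_pos hx).le
    (setIntegral_nonneg measurableSet_rhoDomain fun _ hu => (rhoIntegrand_pos hx hk hmem hu).le)

lemma inv_sqrt_mul_inv_sqrt_le {a b t : ℝ} (ht : t ∈ Set.Ioo a b) :
    (t - a) ^ (-(2 : ℝ)⁻¹) * (b - t) ^ (-(2 : ℝ)⁻¹) ≤
      ((b - a) / 2) ^ (-(2 : ℝ)⁻¹) * ((t - a) ^ (-(2 : ℝ)⁻¹) + (b - t) ^ (-(2 : ℝ)⁻¹)) := by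
  have h1 : 0 < t - a := sub_pos.2 ht.1
  have h2 : 0 < b - t := sub_pos.2 ht.2
  have p1 := Real.rpow_pos_of_pos h1 (-(2 : ℝ)⁻¹)
  have p2 := Real.rpow_pos_of_pos h2 (-(2 : ℝ)⁻¹)
  have p3 := Real.rpow_pos_of_pos (show 0 < (b - a) / 2 by linarith) (-(2 : ℝ)⁻¹)
  rcases le_total ((b - a) / 2) (t - a) with h | h
  · have := Real.rpow_le_rpow_of_nonpos (by linarith) h (show -(2 : ℝ)⁻¹ ≤ 0 by norm_num)
    nlinarith
  · have := Real.rpow_le_rpow_of_nonpos (y := b - t) (show 0 < (b - a) / 2 by linarith)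
      (by linarith) (show -(2 : ℝ)⁻¹ ≤ 0 by norm_num)
    nlinarith

lemma integrableOn_inv_sqrt_mul_inv_sqrt {a b : ℝ} (hab : a ≤ b) :
    IntegrableOn (fun t => |t - a| ^ (-(2 : ℝ)⁻¹) * |t - b| ^ (-(2 : ℝ)⁻¹)) (Set.Ioo a b) := by
  have hi : ∀ c d : ℝ, IntervalIntegrable (fun t : ℝ => t ^ (-(2 : ℝ)⁻¹)) volume c d :=
    fun c d => intervalIntegral.intervalIntegrable_rpow' (by norm_num)
  have h1 : IntervalIntegrable (fun t => (t - a) ^ (-(2 : ℝ)⁻¹)) volume a b := by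
    simpa using (hi 0 (b - a)).comp_sub_right a
  have h2 : IntervalIntegrable (fun t => (b - t) ^ (-(2 : ℝ)⁻¹)) volume a b := by
    simpa using (hi (b - a) 0).comp_sub_left b
  have h3 := ((h1.add h2).const_mul (((b - a) / 2) ^ (-(2 : ℝ)⁻¹)))
  have h4 := ((intervalIntegrable_iff_integrableOn_Ioc_of_le hab).1 h3).mono_set
    Set.Ioo_subset_Ioc_self
  refine Integrable.mono' h4 (by fun_prop) ?_
  refine (ae_restrict_iff' measurableSet_Ioo).2 (Filter.Eventually.of_forall fun t ht => ?_)
  rw [Real.norm_of_nonneg (by positivity), abs_of_pos (sub_pos.2 ht.1),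
    abs_of_neg (sub_neg.2 ht.2), neg_sub]
  exact inv_sqrt_mul_inv_sqrt_le ht

lemma IsChamber.exists_abs_rpow_le (hx : IsChamber N x) {j i : ℕ} (hj : 1 ≤ j)
    (hj' : j + 1 ≤ 2 * N) (hi : i ∈ Finset.Icc 1 (2 * N)) (h1 : i ≠ j) (h2 : i ≠ j + 1) :
    ∃ C, ∀ t ∈ Set.Ioo (x j) (x (j + 1)), |t - x i| ^ (-(2 : ℝ)⁻¹) ≤ C := by
  rw [Finset.mem_Icc] at hi
  rcases lt_or_gt_of_ne h1 with h | h
  · refine ⟨(x j - x i) ^ (-(2 : ℝ)⁻¹), fun t ht => ?_⟩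
    have h3 := hx i j hi.1 h (by omega)
    refine Real.rpow_le_rpow_of_nonpos (sub_pos.2 h3) ?_ (by norm_num)
    exact (by linarith [ht.1] : x j - x i ≤ t - x i).trans (le_abs_self _)
  · refine ⟨(x i - x (j + 1)) ^ (-(2 : ℝ)⁻¹), fun t ht => ?_⟩
    have h3 := hx (j + 1) i (by omega) (by omega) hi.2
    refine Real.rpow_le_rpow_of_nonpos (sub_pos.2 h3) ?_ (by norm_num)
    exact (by linarith [ht.2] : x i - x (j + 1) ≤ -(t - x i)).trans (neg_le_abs _)

lemma IsChamber.integrableOn_prod (hx : IsChamber N x) {j : ℕ} (hj : 1 ≤ j)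
    (hj' : j + 1 ≤ 2 * N) :
    IntegrableOn (fun t => ∏ i ∈ Finset.Icc 1 (2 * N), |t - x i| ^ (-(2 : ℝ)⁻¹))
      (Set.Ioo (x j) (x (j + 1))) := by
  have hjm : j ∈ Finset.Icc 1 (2 * N) := Finset.mem_Icc.2 (by omega)
  have hjm' : j + 1 ∈ (Finset.Icc 1 (2 * N)).erase j :=
    Finset.mem_erase.2 ⟨by omega, Finset.mem_Icc.2 (by omega)⟩
  have hsplit : (fun t => ∏ i ∈ Finset.Icc 1 (2 * N), |t - x i| ^ (-(2 : ℝ)⁻¹)) = fun t =>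
      (|t - x j| ^ (-(2 : ℝ)⁻¹) * |t - x (j + 1)| ^ (-(2 : ℝ)⁻¹)) *
        ∏ i ∈ ((Finset.Icc 1 (2 * N)).erase j).erase (j + 1), |t - x i| ^ (-(2 : ℝ)⁻¹) := by
    ext t
    rw [← Finset.mul_prod_erase _ _ hjm, ← Finset.mul_prod_erase _ _ hjm', mul_assoc]
  have hb : ∀ i ∈ ((Finset.Icc 1 (2 * N)).erase j).erase (j + 1),
      ∃ C, ∀ t ∈ Set.Ioo (x j) (x (j + 1)), |t - x i| ^ (-(2 : ℝ)⁻¹) ≤ C := by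
    intro i hi
    rw [Finset.mem_erase, Finset.mem_erase] at hi
    exact hx.exists_abs_rpow_le hj hj' hi.2.2 hi.2.1 hi.1
  choose! C hC using hb
  rw [hsplit]
  refine Integrable.mul_bdd (c := ∏ i ∈ ((Finset.Icc 1 (2 * N)).erase j).erase (j + 1), C i)
    (integrableOn_inv_sqrt_mul_inv_sqrt (hx j (j + 1) hj (by omega) hj').le)
    (Measurable.aestronglyMeasurable (by fun_prop)) ?_
  refine (ae_restrict_iff' measurableSet_Ioo).2 (Filter.Eventually.of_forall fun t ht => ?_)
  rw [Real.norm_of_nonneg (by positivity)]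
  exact Finset.prod_le_prod (fun i _ => by positivity) fun i hi => hC i hi t ht

lemma integrableOn_rhoIntegrand (hx : IsChamber N x)
    (hmem : ∀ r, k r ∈ Finset.Icc 1 (2 * N - 1)) :
    IntegrableOn (rhoIntegrand N x) (rhoDomain k x) := by
  have hm : ∀ r, 1 ≤ k r ∧ k r + 1 ≤ 2 * N := fun r => by
    have := Finset.mem_Icc.1 (hmem r)
    omega
  have hprod : IntegrableOn (fun u : Fin N → ℝ =>
      ∏ r, ∏ i ∈ Finset.Icc 1 (2 * N), |u r - x i| ^ (-(2 : ℝ)⁻¹)) (rhoDomain k x) := by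
    rw [IntegrableOn, rhoDomain, volume_pi, Measure.restrict_pi_pi]
    exact Integrable.fintype_prod fun r => hx.integrableOn_prod (hm r).1 (hm r).2
  obtain ⟨C, hC⟩ : ∃ C, ∀ u ∈ rhoDomain k x,
      ‖∏ p ∈ (Finset.univ ×ˢ Finset.univ : Finset (Fin N × Fin N)).filter fun p => p.1 < p.2,
        (u p.2 - u p.1)‖ ≤ C := by
    have hcomp : IsCompact (Set.univ.pi fun r => Set.Icc (x (k r)) (x (k r + 1))) :=
      isCompact_univ_pi fun _ => isCompact_Icc
    obtain ⟨C, hC⟩ := hcomp.exists_bound_of_continuousOn (f := fun u : Fin N → ℝ =>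
      ∏ p ∈ (Finset.univ ×ˢ Finset.univ : Finset (Fin N × Fin N)).filter fun p => p.1 < p.2,
        (u p.2 - u p.1)) (by fun_prop)
    exact ⟨C, fun u hu => hC u fun r hr => Set.Ioo_subset_Icc_self (hu r hr)⟩
  refine Integrable.bdd_mul (c := C) hprod (by fun_prop) ?_
  exact (ae_restrict_iff' measurableSet_rhoDomain).2 (Filter.Eventually.of_forall hC)

lemma rho_pos (hx : IsChamber N x) (hk : StrictMono k)
    (hmem : ∀ r, k r ∈ Finset.Icc 1 (2 * N - 1)) : 0 < rho N k x := by
  refine mul_pos (rhoPrefactor_pos hx) ?_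
  have hpos := fun u (hu : u ∈ rhoDomain k x) => rhoIntegrand_pos hx hk hmem hu
  refine (setIntegral_pos_iff_support_of_nonneg_ae
    ((ae_restrict_iff' measurableSet_rhoDomain).2
      (Filter.Eventually.of_forall fun u hu => (hpos u hu).le))
    (integrableOn_rhoIntegrand hx hmem)).2 ?_
  have : Function.support (rhoIntegrand N x) ∩ rhoDomain k x = rhoDomain k x :=
    Set.inter_eq_right.2 fun u hu => (hpos u hu).ne'
  refine lt_of_lt_of_eq ?_ (congrArg volume this.symm)
  rw [rhoDomain, volume_pi_pi]
  refine pos_iff_ne_zero.2 (Finset.prod_ne_zero_iff.2 fun r _ => ?_)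
  have hr := Finset.mem_Icc.1 (hmem r)
  have := hx (k r) (k r + 1) hr.1 (by omega) (by omega)
  simpa using this

end Integrals

/-- **Positivity of the Coulomb gas integrals.** For every `N ≥ 1`, every planar link pattern
`β ∈ LP_N` and every `x ∈ 𝔛_{2N}`, the value `F_β(x)` is a strictly positive real number. -/
theorem coulomb_pos (N : ℕ) (hN : 1 ≤ N) (β : LinkPattern N) (x : ℕ → ℝ)
    (hx : IsChamber N x) :
    (coulomb N β x).im = 0 ∧ 0 < (coulomb N β x).re := by
  have hterm : ∀ k ∈ (Fintype.piFinset fun _ : Fin N => Finset.Icc 1 (2 * N - 1)).filter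
      fun k => ∀ r s : Fin N, r < s → k r < k s,
      (linkCoeff N β k * (rho N k x : ℂ)).im = 0 ∧
        0 ≤ (linkCoeff N β k * (rho N k x : ℂ)).re := by
    intro k hk
    rw [Finset.mem_filter, Fintype.mem_piFinset] at hk
    have hmono : StrictMono k := fun r s h => hk.2 r s h
    rcases LinkPattern.linkCoeff_eq_zero_or_one (β := β) hmono with h | h
    · simp [h]
    · simpa [h] using rho_nonneg hx hmono hk.1
  have ha : ∀ r, β.a r ∈ Finset.Icc 1 (2 * N - 1) := fun r => by
    have h1 := β.a_mem r
    have h2 := β.b_mem r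
    have h3 := β.a_lt_b r
    rw [Finset.mem_Icc]
    omega
  rw [coulomb, Complex.im_sum, Complex.re_sum]
  refine ⟨Finset.sum_eq_zero fun k hk => (hterm k hk).1,
    Finset.sum_pos' (fun k hk => (hterm k hk).2) ⟨β.a, ?_, ?_⟩⟩
  · exact Finset.mem_filter.2 ⟨Fintype.mem_piFinset.2 ha, fun r s h => β.a_mono h⟩
  · simpa [LinkPattern.linkCoeff_a] using rho_pos hx β.a_mono ha
end

section
/- For every integer N ≥ 1 and every planar link pattern β ∈ LP_N, the Coulomb gas integral F_β is infinitely differentiable on the open chamber 𝔛_{2N} and satisfies, for every j ∈ {1,…,2N} and every x ∈ 𝔛_{2N}, the second-order BPZ partial differential equation 4·∂²F_β/∂x_j²(x) + Σ_{i≠j} [ (2/(x_i − x_j))·∂F_β/∂x_i(x) + (1/4)·(x_i − x_j)^{−2}·F_β(x) ] = 0. -/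
open MeasureTheory

open scoped ContDiff

/-- The Coulomb gas integral as a function on `Fin (2N) → ℝ` (with `1`-based index `i`
corresponding to the coordinate `i − 1`). -/
noncomputable def coulombFin (N : ℕ) (β : LinkPattern N) (y : Fin (2 * N) → ℝ) : ℂ :=
  coulomb N β fun i => if h : 1 ≤ i ∧ i ≤ 2 * N then y ⟨i - 1, by omega⟩ else 0

/-- The open chamber `𝔛_{2N}` as a subset of `Fin (2N) → ℝ`. -/
def chamberFin (N : ℕ) : Set (Fin (2 * N) → ℝ) :=
  {y | ∀ i j : Fin (2 * N), i < j → y i < y j}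

section ParametricIntegral

variable {H E : Type*} [NormedAddCommGroup H] [NormedSpace ℝ H] [FiniteDimensional ℝ H]
  [NormedAddCommGroup E] [NormedSpace ℝ E]

/-- Differentiation under the integral sign over a compact interval, for a `C¹` integrand. -/
theorem hasFDerivAt_intervalIntegral_of_contDiffOn {U : Set H} (hU : IsOpen U) {F : H × ℝ → E}
    (hF : ContDiffOn ℝ 1 F (U ×ˢ Set.univ)) (a b : ℝ) {x : H} (hx : x ∈ U) :
    HasFDerivAt (fun x => ∫ t in a..b, F (x, t))
      (∫ t in a..b, (fderiv ℝ F (x, t)).comp (ContinuousLinearMap.inl ℝ H ℝ)) x := by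
  have hO : IsOpen (U ×ˢ (Set.univ : Set ℝ)) := hU.prod isOpen_univ
  have hcF : ContinuousOn F (U ×ˢ Set.univ) := hF.continuousOn
  have hcF' : ContinuousOn (fun z => (fderiv ℝ F z).comp (ContinuousLinearMap.inl ℝ H ℝ))
      (U ×ˢ Set.univ) :=
    (hF.continuousOn_fderiv_of_isOpen hO le_rfl).clm_comp continuousOn_const
  have hline : ∀ y ∈ U, Continuous fun t : ℝ => F (y, t) := fun y hy =>
    hcF.comp_continuous (by fun_prop) fun t => ⟨hy, Set.mem_univ _⟩
  obtain ⟨ε, hε, hball⟩ := Metric.isOpen_iff.1 hU x hx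
  have hsub : Metric.closedBall x (ε / 2) ⊆ U :=
    (Metric.closedBall_subset_ball (by linarith)).trans hball
  have := FiniteDimensional.proper ℝ H
  obtain ⟨C, hC⟩ := ((isCompact_closedBall x (ε / 2)).prod
    (isCompact_uIcc (a := a) (b := b))).exists_bound_of_continuousOn
    (hcF'.mono (Set.prod_mono hsub (Set.subset_univ _)))
  refine intervalIntegral.hasFDerivAt_integral_of_dominated_of_fderiv_le
    (s := Metric.closedBall x (ε / 2)) (bound := fun _ => C)
    (F' := fun x t => (fderiv ℝ F (x, t)).comp (ContinuousLinearMap.inl ℝ H ℝ))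
    (Metric.closedBall_mem_nhds x (by positivity)) ?_ ?_ ?_ ?_ ?_ ?_
  · filter_upwards [hU.mem_nhds hx] with y hy
    exact (hline y hy).aestronglyMeasurable
  · exact (hline x hx).intervalIntegrable _ _
  · exact (hcF'.comp_continuous (f := fun t : ℝ => (x, t)) (by fun_prop)
      fun t => ⟨hx, Set.mem_univ _⟩).aestronglyMeasurable
  · exact .of_forall fun t ht y hy => hC (y, t) ⟨hy, Set.uIoc_subset_uIcc ht⟩
  · exact intervalIntegrable_const
  · refine .of_forall fun t _ y hy => ?_
    have h1 : HasFDerivAt F (fderiv ℝ F (y, t)) (y, t) :=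
      ((hF.contDiffAt (hO.mem_nhds ⟨hsub hy, Set.mem_univ _⟩)).differentiableAt
        (by norm_num)).hasFDerivAt
    exact h1.comp y (hasFDerivAt_prodMk_left y t)

end ParametricIntegral

/-- An integral over a compact interval of a smooth integrand depends smoothly on parameters. -/
theorem contDiffOn_intervalIntegral {H E : Type} [NormedAddCommGroup H] [NormedSpace ℝ H]
    [FiniteDimensional ℝ H] [NormedAddCommGroup E] [NormedSpace ℝ E] {U : Set H} (hU : IsOpen U)
    {F : H × ℝ → E} (hF : ContDiffOn ℝ ∞ F (U ×ˢ Set.univ)) (a b : ℝ) :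
    ContDiffOn ℝ ∞ (fun x => ∫ t in a..b, F (x, t)) U := by
  rw [contDiffOn_infty]
  intro n
  induction n generalizing E with
  | zero =>
    rw [Nat.cast_zero, contDiffOn_zero]
    exact fun x hx => (hasFDerivAt_intervalIntegral_of_contDiffOn hU
      (hF.of_le (by exact_mod_cast le_top)) a b hx).continuousAt.continuousWithinAt
  | succ n ih =>
    have hO : IsOpen (U ×ˢ (Set.univ : Set ℝ)) := hU.prod isOpen_univ
    have hD : ∀ x ∈ U, HasFDerivAt (fun x => ∫ t in a..b, F (x, t))
        (∫ t in a..b, (fderiv ℝ F (x, t)).comp (ContinuousLinearMap.inl ℝ H ℝ)) x :=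
      fun x hx => hasFDerivAt_intervalIntegral_of_contDiffOn hU
        (hF.of_le (by exact_mod_cast le_top)) a b hx
    rw [Nat.cast_add, Nat.cast_one, contDiffOn_succ_iff_fderiv_of_isOpen hU]
    refine ⟨fun x hx => (hD x hx).differentiableAt.differentiableWithinAt, by simp, ?_⟩
    refine (ih (F := fun z => (fderiv ℝ F z).comp (ContinuousLinearMap.inl ℝ H ℝ)) ?_).congr
      fun x hx => (hD x hx).fderiv
    exact (hF.fderiv_of_isOpen hO (by simp)).clm_comp contDiffOn_const

section AbsRpow

theorem hasDerivAt_abs_rpow_neg_half {v : ℝ} (hv : v ≠ 0) :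
    HasDerivAt (fun v : ℝ => |v| ^ (-(2 : ℝ)⁻¹)) (-(1 / (2 * v)) * |v| ^ (-(2 : ℝ)⁻¹)) v := by
  have h := (hasDerivAt_abs hv).rpow_const (p := -(2 : ℝ)⁻¹) (Or.inl (abs_ne_zero.2 hv))
  refine h.congr_deriv ?_
  rw [Real.rpow_sub_one (abs_ne_zero.2 hv)]
  rcases hv.lt_or_gt with h | h
  · rw [abs_of_neg h, sign_neg h]
    field_simp
    simp
  · rw [abs_of_pos h, sign_pos h]
    field_simp
    simp

theorem contDiffAt_abs_rpow_neg_half {v : ℝ} (hv : v ≠ 0) :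
    ContDiffAt ℝ ∞ (fun v : ℝ => |v| ^ (-(2 : ℝ)⁻¹)) v :=
  (contDiffAt_abs hv).rpow_const_of_ne (abs_ne_zero.2 hv)

end AbsRpow

section SineParam

variable {ι : Type}

/-- The parametrization of `[x p, x q]` by the sine. -/
noncomputable def sineParam (p q : ι) (x : ι → ℝ) (θ : ℝ) : ℝ :=
  (x p + x q) / 2 + (x q - x p) / 2 * Real.sin θ

theorem sineParam_mem_Icc {p q : ι} {x : ι → ℝ} (hx : x p ≤ x q) (θ : ℝ) :
    sineParam p q x θ ∈ Set.Icc (x p) (x q) := by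
  have h1 := Real.sin_le_one θ
  have h2 := Real.neg_one_le_sin θ
  constructor <;> unfold sineParam <;> nlinarith

theorem hasDerivAt_sineParam_angle (p q : ι) (x : ι → ℝ) (θ : ℝ) :
    HasDerivAt (sineParam p q x) ((x q - x p) / 2 * Real.cos θ) θ :=
  ((Real.hasDerivAt_sin θ).const_mul _).const_add _

/-- The sign with which the endpoint `i` enters the boundary terms. -/
def endpointSign [DecidableEq ι] (p q i : ι) : ℝ := (if i = q then 1 else 0) - if i = p then 1 else 0

theorem sineParam_single [DecidableEq ι] (p q i : ι) (θ : ℝ) :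
    sineParam p q (Pi.single i 1) θ =
      ((if i = q then 1 else 0) + if i = p then 1 else 0) / 2 +
        endpointSign p q i / 2 * Real.sin θ := by
  simp only [sineParam, endpointSign, Pi.single_apply, eq_comm (a := i)]
  ring

theorem mul_sineParam_single [DecidableEq ι] {p q : ι} (hpq : p ≠ q) (i : ι) (x : ι → ℝ) (θ : ℝ) :
    (sineParam p q x θ - x i) * sineParam p q (Pi.single i 1) θ =
      -(endpointSign p q i / 2 * Real.cos θ * ((x q - x p) / 2 * Real.cos θ)) := by
  rw [sineParam_single]
  have h := Real.sin_sq_add_cos_sq θ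
  by_cases hq : i = q
  · subst hq
    simp only [sineParam, endpointSign, hpq.symm, if_true, if_false]
    linear_combination ((x i - x p) / 4) * h
  by_cases hp : i = p
  · subst hp
    simp only [sineParam, endpointSign, hpq, if_true, if_false]
    linear_combination -((x q - x i) / 4) * h
  · simp [endpointSign, hp, hq]

end SineParam

section Integrand

variable {ι : Type} [Fintype ι] [DecidableEq ι]

/-- The set of configurations for which `(x p, x q)` is an interval containing no other point. -/
def gapDomain (p q : ι) : Set (ι → ℝ) :=
  {x | x p < x q ∧ ∀ l, l ≠ p → l ≠ q → x l < x p ∨ x q < x l}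

/-- The indices different from `p` and `q`. -/
def others (p q : ι) : Finset ι := Finset.univ.filter fun l => l ≠ p ∧ l ≠ q

/-- The product of `|u - x l| ^ (-1/2)` over the indices `l` different from `p` and `q`. -/
noncomputable def otherWeight (p q : ι) (u : ℝ) (x : ι → ℝ) : ℝ :=
  ∏ l ∈ others p q, |u - x l| ^ (-(2 : ℝ)⁻¹)

/-- The power `(u - x j) ^ s` times the weight of the indices different from `p` and `q`. -/
noncomputable def gapIntegrand (p q j : ι) (s : ℕ) (u : ℝ) (x : ι → ℝ) : ℝ :=
  (u - x j) ^ s * otherWeight p q u x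

/-- The derivative of `gapIntegrand` in the direction `(τ, v)`. -/
noncomputable def gapIntegrandDeriv (p q j : ι) (s : ℕ) (u : ℝ) (x : ι → ℝ) (τ : ℝ)
    (v : ι → ℝ) : ℝ :=
  (s * (u - x j) ^ (s - 1) * (τ - v j)
    - (u - x j) ^ s * ∑ l ∈ others p q, (τ - v l) / (2 * (u - x l))) * otherWeight p q u x

/-- The half-period `∫ (u - x j) ^ s ∏ |u - x l| ^ (-1/2) du` over `(x p, x q)`, written in the
sine parametrization. -/
noncomputable def gapPeriod (p q j : ι) (s : ℕ) (x : ι → ℝ) : ℝ :=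
  ∫ θ in -(Real.pi / 2)..Real.pi / 2, gapIntegrand p q j s (sineParam p q x θ) x

theorem isOpen_gapDomain (p q : ι) : IsOpen (gapDomain p q) := by
  have : gapDomain p q = {x : ι → ℝ | x p < x q} ∩
      ⋂ l : ι, {x : ι → ℝ | l ≠ p → l ≠ q → x l < x p ∨ x q < x l} := by
    ext x
    simp [gapDomain]
  rw [this]
  refine (isOpen_lt (continuous_apply p) (continuous_apply q)).inter
    (isOpen_iInter_of_finite fun l => ?_)
  by_cases hp : l = p
  · simp [hp]
  by_cases hq : l = q
  · simp [hq]
  simp only [ne_eq, hp, hq, not_false_eq_true, forall_const]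
  exact (isOpen_lt (continuous_apply l) (continuous_apply p)).union
    (isOpen_lt (continuous_apply q) (continuous_apply l))

theorem sineParam_ne {p q : ι} {x : ι → ℝ} (hx : x ∈ gapDomain p q) (θ : ℝ) {l : ι}
    (hl : l ∈ others p q) : sineParam p q x θ ≠ x l := by
  obtain ⟨h1, h2⟩ := sineParam_mem_Icc hx.1.le θ
  simp only [others, Finset.mem_filter, Finset.mem_univ, true_and] at hl
  rcases hx.2 l hl.1 hl.2 with h | h
  · exact (h.trans_le h1).ne'
  · exact (h2.trans_lt h).ne

theorem hasDerivAt_otherWeight (p q : ι) {u : ℝ → ℝ} {x : ℝ → ι → ℝ} {t τ : ℝ} {v : ι → ℝ}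
    (hu : HasDerivAt u τ t) (hx : HasDerivAt x v t) (hne : ∀ l ∈ others p q, u t ≠ x t l) :
    HasDerivAt (fun t => otherWeight p q (u t) (x t))
      (-(∑ l ∈ others p q, (τ - v l) / (2 * (u t - x t l))) * otherWeight p q (u t) (x t)) t := by
  have hfac : ∀ l ∈ others p q, HasDerivAt (fun t => |u t - x t l| ^ (-(2 : ℝ)⁻¹))
      (-(1 / (2 * (u t - x t l))) * |u t - x t l| ^ (-(2 : ℝ)⁻¹) * (τ - v l)) t := by
    intro l hl
    have hl' := hu.fun_sub (hasDerivAt_pi.1 hx l)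
    have h0 : (fun t => u t - x t l) t ≠ 0 := sub_ne_zero.2 (hne l hl)
    exact (hasDerivAt_abs_rpow_neg_half h0).comp t hl'
  refine (HasDerivAt.fun_finsetProd hfac).congr_deriv ?_
  rw [← Finset.sum_neg_distrib, Finset.sum_mul]
  refine Finset.sum_congr rfl fun l hl => ?_
  rw [otherWeight, ← Finset.mul_prod_erase _ _ hl, smul_eq_mul]
  ring

theorem hasDerivAt_gapIntegrand (p q j : ι) (s : ℕ) {u : ℝ → ℝ} {x : ℝ → ι → ℝ} {t τ : ℝ}
    {v : ι → ℝ} (hu : HasDerivAt u τ t) (hx : HasDerivAt x v t)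
    (hne : ∀ l ∈ others p q, u t ≠ x t l) :
    HasDerivAt (fun t => gapIntegrand p q j s (u t) (x t))
      (gapIntegrandDeriv p q j s (u t) (x t) τ v) t := by
  refine (((hu.sub (hasDerivAt_pi.1 hx j)).pow s).mul
    (hasDerivAt_otherWeight p q hu hx hne)).congr_deriv ?_
  simp only [gapIntegrandDeriv, Pi.sub_apply, Pi.pow_apply]
  ring

theorem contDiffOn_gapIntegrand (p q j : ι) (s : ℕ) :
    ContDiffOn ℝ ∞ (fun z : (ι → ℝ) × ℝ => gapIntegrand p q j s (sineParam p q z.1 z.2) z.1)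
      (gapDomain p q ×ˢ Set.univ) := by
  have hc : ∀ l : ι, ContDiff ℝ ∞ fun z : (ι → ℝ) × ℝ => z.1 l := fun l =>
    (contDiff_apply ℝ ℝ l).comp contDiff_fst
  have hu : ContDiff ℝ ∞ fun z : (ι → ℝ) × ℝ => sineParam p q z.1 z.2 :=
    (((hc p).add (hc q)).div_const 2).add
      ((((hc q).sub (hc p)).div_const 2).mul (Real.contDiff_sin.comp contDiff_snd))
  rintro ⟨x, θ⟩ ⟨hx, -⟩
  have hw : ContDiffAt ℝ ∞ (fun z : (ι → ℝ) × ℝ =>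
      ∏ l ∈ others p q, |sineParam p q z.1 z.2 - z.1 l| ^ (-(2 : ℝ)⁻¹)) (x, θ) :=
    contDiffAt_prod fun l hl => by
      have h0 : (fun z : (ι → ℝ) × ℝ => sineParam p q z.1 z.2 - z.1 l) (x, θ) ≠ 0 :=
        sub_ne_zero.2 (sineParam_ne hx θ hl)
      exact (contDiffAt_abs_rpow_neg_half h0).comp (x, θ) (hu.sub (hc l)).contDiffAt
  exact (((hu.sub (hc j)).pow s).contDiffAt.mul hw).contDiffWithinAt

theorem contDiffOn_gapPeriod (p q j : ι) (s : ℕ) :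
    ContDiffOn ℝ ∞ (gapPeriod p q j s) (gapDomain p q) :=
  contDiffOn_intervalIntegral (isOpen_gapDomain p q) (contDiffOn_gapIntegrand p q j s) _ _

theorem fderiv_gapIntegrand {p q : ι} (j : ι) (s : ℕ) {x : ι → ℝ} (hx : x ∈ gapDomain p q)
    (θ τ : ℝ) (v : ι → ℝ) :
    fderiv ℝ (fun z : (ι → ℝ) × ℝ => gapIntegrand p q j s (sineParam p q z.1 z.2) z.1) (x, θ)
      (v, τ) = gapIntegrandDeriv p q j s (sineParam p q x θ) x
        (sineParam p q v θ + (x q - x p) / 2 * Real.cos θ * τ) v := by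
  set F : (ι → ℝ) × ℝ → ℝ := fun z => gapIntegrand p q j s (sineParam p q z.1 z.2) z.1
  have hF : HasFDerivAt F (fderiv ℝ F (x, θ)) (x, θ) :=
    (((contDiffOn_gapIntegrand p q j s).contDiffAt
      (((isOpen_gapDomain p q).prod isOpen_univ).mem_nhds ⟨hx, Set.mem_univ θ⟩)).differentiableAt
        (by simp)).hasFDerivAt
  have hx' : HasDerivAt (fun t : ℝ => x + t • v) v 0 := by
    simpa using ((hasDerivAt_id (0 : ℝ)).smul_const v).const_add x
  have hθ' : HasDerivAt (fun t : ℝ => θ + t * τ) τ 0 := by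
    simpa using ((hasDerivAt_id (0 : ℝ)).mul_const τ).const_add θ
  have hF' : HasFDerivAt F (fderiv ℝ F (x, θ)) (x + (0 : ℝ) • v, θ + 0 * τ) := by simpa using hF
  have h1 := hF'.comp_hasDerivAt (0 : ℝ) (hx'.prodMk hθ')
  have hu : HasDerivAt (fun t : ℝ => sineParam p q (x + t • v) (θ + t * τ))
      (sineParam p q v θ + (x q - x p) / 2 * Real.cos θ * τ) 0 := by
    have hp := hasDerivAt_pi.1 hx' p
    have hq := hasDerivAt_pi.1 hx' q
    refine (((hp.add hq).div_const 2).add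
      (((hq.sub hp).div_const 2).mul (hθ'.sin))).congr_deriv ?_
    simp [sineParam]
    ring
  have h2 := hasDerivAt_gapIntegrand p q j s hu hx' (fun l hl => by
    simpa using sineParam_ne hx θ hl)
  simpa [F] using h1.unique h2

theorem continuous_gapIntegrand {p q : ι} (j : ι) (s : ℕ) {x : ι → ℝ} (hx : x ∈ gapDomain p q) :
    Continuous fun θ => gapIntegrand p q j s (sineParam p q x θ) x :=
  (contDiffOn_gapIntegrand p q j s).continuousOn.comp_continuous
    (f := fun θ : ℝ => (x, θ)) (by fun_prop) fun _ => ⟨hx, Set.mem_univ _⟩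

theorem continuous_gapIntegrandDeriv {p q : ι} (j : ι) (s : ℕ) {x : ι → ℝ}
    (hx : x ∈ gapDomain p q) (τ : ℝ) (v : ι → ℝ) :
    Continuous fun θ => gapIntegrandDeriv p q j s (sineParam p q x θ) x
        (sineParam p q v θ + (x q - x p) / 2 * Real.cos θ * τ) v := by
  have h := ((contDiffOn_gapIntegrand p q j s).continuousOn_fderiv_of_isOpen
    ((isOpen_gapDomain p q).prod isOpen_univ) (by simp)).comp_continuous
    (f := fun θ : ℝ => (x, θ)) (by fun_prop) fun _ => ⟨hx, Set.mem_univ _⟩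
  simpa only [Function.comp_apply, fderiv_gapIntegrand j s hx] using
    h.clm_apply (continuous_const (y := (v, τ)))

theorem fderiv_gapPeriod {p q : ι} (j : ι) (s : ℕ) {x : ι → ℝ} (hx : x ∈ gapDomain p q)
    (v : ι → ℝ) :
    fderiv ℝ (gapPeriod p q j s) x v = ∫ θ in -(Real.pi / 2)..Real.pi / 2,
      gapIntegrandDeriv p q j s (sineParam p q x θ) x (sineParam p q v θ) v := by
  have hO := (isOpen_gapDomain p q).prod (isOpen_univ (X := ℝ))
  have hF := contDiffOn_gapIntegrand p q j s
  have h := (hasFDerivAt_intervalIntegral_of_contDiffOn (isOpen_gapDomain p q)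
    (hF.of_le (by exact_mod_cast le_top)) (-(Real.pi / 2)) (Real.pi / 2) hx).fderiv
  have hc := ((hF.continuousOn_fderiv_of_isOpen hO (by simp)).clm_comp
    (continuousOn_const (c := ContinuousLinearMap.inl ℝ (ι → ℝ) ℝ))).comp_continuous
    (f := fun θ : ℝ => (x, θ)) (by fun_prop) fun _ => ⟨hx, Set.mem_univ _⟩
  unfold gapPeriod
  have happ := ContinuousLinearMap.intervalIntegral_apply
    (hc.intervalIntegrable (μ := volume) (-(Real.pi / 2)) (Real.pi / 2)) v
  simp only [Function.comp_apply] at happ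
  rw [h, happ]
  refine intervalIntegral.integral_congr fun θ _ => ?_
  simpa using fderiv_gapIntegrand j s hx θ 0 v

/-- Translation invariance. -/
theorem sum_fderiv_gapPeriod {p q : ι} (j : ι) (s : ℕ) {x : ι → ℝ} (hx : x ∈ gapDomain p q) :
    ∑ i, fderiv ℝ (gapPeriod p q j s) x (Pi.single i 1) = 0 := by
  rw [← map_sum, fderiv_gapPeriod j s hx, ← intervalIntegral.integral_zero]
  refine intervalIntegral.integral_congr fun θ _ => ?_
  simp [gapIntegrandDeriv, sineParam]

theorem gapIntegrandDeriv_succ (p q j : ι) (s : ℕ) (u : ℝ) (x : ι → ℝ) (τ : ℝ) (v : ι → ℝ) :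
    gapIntegrandDeriv p q j (s + 1) u x τ v = (τ - v j) * gapIntegrand p q j s u x
      + (u - x j) * gapIntegrandDeriv p q j s u x τ v := by
  simp only [gapIntegrandDeriv, gapIntegrand]
  rcases s with _ | s
  · simp
    ring
  · simp only [Nat.add_sub_cancel]
    push_cast
    ring

theorem gapIntegrandDeriv_eq_add (p q j : ι) (s : ℕ) (u : ℝ) (x : ι → ℝ) (τ : ℝ) (v : ι → ℝ) :
    gapIntegrandDeriv p q j s u x τ v = τ * gapIntegrandDeriv p q j s u x 1 0
      + gapIntegrandDeriv p q j s u x 0 v := by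
  have h : ∑ l ∈ others p q, (τ - v l) / (2 * (u - x l)) =
      τ * ∑ l ∈ others p q, 1 / (2 * (u - x l)) +
        ∑ l ∈ others p q, (0 - v l) / (2 * (u - x l)) := by
    rw [Finset.mul_sum, ← Finset.sum_add_distrib]
    exact Finset.sum_congr rfl fun l _ => by ring
  simp only [gapIntegrandDeriv, h, Pi.zero_apply, sub_zero]
  ring

/-- The part of the derivative along `x i` that does not come from moving `u`. -/
theorem mul_gapIntegrandDeriv_zero_single {p q : ι} (i j : ι) (s : ℕ) {u : ℝ} {x : ι → ℝ}
    (hne : ∀ l ∈ others p q, u ≠ x l) :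
    (u - x i) * gapIntegrandDeriv p q j s u x 0 (Pi.single i 1) =
      ((if i ∈ others p q then 1 / 2 else 0) - if i = j then (s : ℝ) else 0)
        * gapIntegrand p q j s u x := by
  have hsum : (u - x i) * ∑ l ∈ others p q, (0 - Pi.single (M := fun _ => ℝ) i 1 l) /
      (2 * (u - x l)) = -(if i ∈ others p q then 1 / 2 else 0) := by
    split_ifs with hi
    · have := sub_ne_zero.2 (hne i hi)
      rw [Finset.sum_eq_single_of_mem i hi fun l _ hl => by simp [hl]]
      simp
      field_simp
    · rw [Finset.sum_eq_zero fun l hl => by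
        have : l ≠ i := fun h => hi (h ▸ hl)
        simp [this]]
      simp
  have hpow : (u - x i) * ((s : ℝ) * (u - x j) ^ (s - 1) *
      (0 - Pi.single (M := fun _ => ℝ) i 1 j)) = -(if i = j then (s : ℝ) else 0) *
        (u - x j) ^ s := by
    split_ifs with hij
    · subst hij
      rcases s with _ | s
      · simp
      · simp
        ring
    · simp [Ne.symm hij]
  simp only [gapIntegrandDeriv, gapIntegrand]
  linear_combination otherWeight p q u x * hpow - (u - x j) ^ s * otherWeight p q u x * hsum

theorem integral_boundary_eq_zero {p q : ι} (j : ι) (s : ℕ) {x : ι → ℝ}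
    (hx : x ∈ gapDomain p q) :
    ∫ θ in -(Real.pi / 2)..Real.pi / 2,
      (Real.sin θ * gapIntegrand p q j s (sineParam p q x θ) x - Real.cos θ *
        gapIntegrandDeriv p q j s (sineParam p q x θ) x ((x q - x p) / 2 * Real.cos θ) 0) = 0 := by
  have hd : ∀ θ : ℝ, HasDerivAt
      (fun θ => -Real.cos θ * gapIntegrand p q j s (sineParam p q x θ) x)
      (Real.sin θ * gapIntegrand p q j s (sineParam p q x θ) x - Real.cos θ *
        gapIntegrandDeriv p q j s (sineParam p q x θ) x ((x q - x p) / 2 * Real.cos θ) 0) θ := by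
    intro θ
    refine ((Real.hasDerivAt_cos θ).neg.mul (hasDerivAt_gapIntegrand p q j s
      (hasDerivAt_sineParam_angle p q x θ) (hasDerivAt_const θ x)
      fun l hl => sineParam_ne hx θ hl)).congr_deriv ?_
    simp only [Pi.neg_apply]
    ring
  have hc := continuous_gapIntegrandDeriv j s hx 1 0
  have h0 : ∀ θ, sineParam p q (0 : ι → ℝ) θ = 0 := fun θ => by simp [sineParam]
  simp only [h0, zero_add, mul_one] at hc
  rw [intervalIntegral.integral_eq_sub_of_hasDerivAt (fun θ _ => hd θ)
    (((Real.continuous_sin.mul (continuous_gapIntegrand j s hx)).sub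
      (Real.continuous_cos.mul hc)).intervalIntegrable _ _)]
  simp

/-- Contiguity relation for the derivatives of the half-periods. -/
theorem fderiv_gapPeriod_succ {p q : ι} (i j : ι) (s : ℕ) {x : ι → ℝ}
    (hx : x ∈ gapDomain p q) :
    fderiv ℝ (gapPeriod p q j (s + 1)) x (Pi.single i 1) =
      (x i - x j) * fderiv ℝ (gapPeriod p q j s) x (Pi.single i 1)
        + (1 / 2 - if i = j then (s : ℝ) + 1 else 0) * gapPeriod p q j s x := by
  have hpq : p ≠ q := fun h => by
    have := hx.1
    simp [h] at this
  have hlin : ∀ {f g h : ℝ → ℝ} (a b c : ℝ), Continuous f → Continuous g → Continuous h →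
      ∫ θ in -(Real.pi / 2)..Real.pi / 2, (a * f θ + b * g θ + c * h θ) =
        a * (∫ θ in -(Real.pi / 2)..Real.pi / 2, f θ) +
        b * (∫ θ in -(Real.pi / 2)..Real.pi / 2, g θ) +
        c * ∫ θ in -(Real.pi / 2)..Real.pi / 2, h θ := by
    intro f g h a b c hf hg hh
    rw [intervalIntegral.integral_add (Continuous.intervalIntegrable (by fun_prop) _ _)
      (Continuous.intervalIntegrable (by fun_prop) _ _),
      intervalIntegral.integral_add (Continuous.intervalIntegrable (by fun_prop) _ _)
      (Continuous.intervalIntegrable (by fun_prop) _ _)]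
    simp only [intervalIntegral.integral_const_mul]
  have hc1 := continuous_gapIntegrandDeriv j s hx 0 (Pi.single i 1)
  have hc2 := continuous_gapIntegrand j s hx
  have hc3 := continuous_gapIntegrandDeriv j s hx 1 0
  have h0 : ∀ θ, sineParam p q (0 : ι → ℝ) θ = 0 := fun θ => by simp [sineParam]
  simp only [h0, zero_add, mul_one] at hc3
  simp only [mul_zero, add_zero] at hc1
  have hb := integral_boundary_eq_zero j s hx
  have hl := hlin (x i - x j) (1 / 2 - if i = j then (s : ℝ) + 1 else 0) (endpointSign p q i / 2)
    hc1 hc2 ((Real.continuous_sin.mul hc2).sub (Real.continuous_cos.mul hc3))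
  simp only [Pi.sub_apply, Pi.mul_apply] at hl
  rw [hb, mul_zero, add_zero] at hl
  rw [fderiv_gapPeriod j (s + 1) hx, fderiv_gapPeriod j s hx, gapPeriod, ← hl]
  refine intervalIntegral.integral_congr fun θ _ => ?_
  have hm := mul_gapIntegrandDeriv_zero_single (x := x) i j s fun l hl => sineParam_ne hx θ hl
  have hs := mul_sineParam_single hpq i x θ
  have hs' := sineParam_single p q i θ
  rw [gapIntegrandDeriv_succ, gapIntegrandDeriv_eq_add p q j s _ _ (sineParam p q _ θ),
    gapIntegrandDeriv_eq_add p q j s _ _ ((x q - x p) / 2 * Real.cos θ)]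
  have hz : gapIntegrandDeriv p q j s (sineParam p q x θ) x 0 0 = 0 := by
    simp [gapIntegrandDeriv]
  have hval : sineParam p q (Pi.single i 1) θ - Pi.single (M := fun _ => ℝ) i 1 j
      + ((if i ∈ others p q then 1 / 2 else 0) - if i = j then (s : ℝ) else 0) =
      1 / 2 - (if i = j then (s : ℝ) + 1 else 0) + endpointSign p q i / 2 * Real.sin θ := by
    rw [hs', Pi.single_apply]
    have hcount : (((if i = q then 1 else 0) + if i = p then 1 else 0) / 2 +
        if i ∈ others p q then 1 / 2 else 0 : ℝ) = 1 / 2 := by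
      by_cases hp : i = p
      · subst hp
        simp [others, hpq]
      · by_cases hq : i = q <;> simp [others, hp, hq, hpq.symm]
    simp only [eq_comm (a := j)]
    split_ifs at hcount ⊢ <;> linear_combination hcount
  linear_combination hm + gapIntegrandDeriv p q j s (sineParam p q x θ) x 1 0 * hs
    + gapIntegrand p q j s (sineParam p q x θ) x * hval
    + endpointSign p q i / 2 * Real.cos θ * hz

end Integrand

section Alternating

variable {ι : Type} [Fintype ι] [DecidableEq ι] {V : Type} [AddCommGroup V] [Module ℝ V] {M : ℕ}

theorem AlternatingMap.map_update_smul_eq_zero {n : Type} [DecidableEq n] (Λ : V [⋀^n]→ₗ[ℝ] ℝ)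
    (v : n → V) {s t : n} (hst : s ≠ t) (c : ℝ) : Λ (Function.update v s (c • v t)) = 0 := by
  rw [Λ.map_update_smul, Λ.map_update_self _ hst, smul_zero]

/-- Differentiating a determinant whose rows after the first have derivatives proportional to the
preceding row only sees the first row. -/
theorem sum_map_update_eq_map_update_zero (Λ : V [⋀^Fin (M + 1)]→ₗ[ℝ] ℝ) (g d : ℕ → V) (c : ℕ → ℝ)
    (hd : ∀ s, d (s + 1) = c s • g s) :
    ∑ s : Fin (M + 1), Λ (Function.update (fun s : Fin (M + 1) => g s) s (d s)) =
      Λ (Function.update (fun s : Fin (M + 1) => g s) 0 (d 0)) := by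
  rw [Fin.sum_univ_succ, Finset.sum_eq_zero, add_zero, Fin.val_zero]
  intro t _
  rw [Fin.val_succ, hd]
  exact Λ.map_update_smul_eq_zero (fun s : Fin (M + 1) => g s) (t := t.castSucc)
    (Fin.castSucc_lt_succ).ne' _

/-- The cancellation between the second derivative and the cross terms in a row of positive
index. -/
theorem second_order_row_succ (Λ : V [⋀^Fin (M + 1)]→ₗ[ℝ] ℝ) (g d : ℕ → V)
    (hd : ∀ s : ℕ, d (s + 1) = ((1 : ℝ) / 2 - (s + 1)) • g s) (t : Fin M) :
    4 * Λ (Function.update (Function.update (fun s : Fin (M + 1) => g s) 0 (d 0)) t.succ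
        (d (t + 1))) =
      2 * Λ (Function.update (fun s : Fin (M + 1) => g s) t.succ (d t)) := by
  have hne : t.succ ≠ t.castSucc := (Fin.castSucc_lt_succ).ne'
  rcases Nat.eq_zero_or_pos (t : ℕ) with h0 | h0
  · have hc : t.castSucc = 0 := Fin.ext h0
    have hswap := Λ.map_swap (Function.update (fun s : Fin (M + 1) => g s) t.succ (d 0))
      (i := 0) (j := t.succ) (by rw [← hc]; exact hne.symm)
    have hfun : Function.update (fun s : Fin (M + 1) => g s) t.succ (d 0) ∘
        Equiv.swap 0 t.succ = Function.update (Function.update (fun s : Fin (M + 1) => g s) 0 (d 0))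
          t.succ (g 0) := by
      funext s
      by_cases hs : s = t.succ
      · subst hs
        simp [hc ▸ hne.symm]
      · by_cases hs0 : s = 0
        · subst hs0
          simp [hs]
        · simp [Equiv.swap_apply_of_ne_of_ne hs0 hs, hs, hs0]
    rw [hfun] at hswap
    rw [hd, h0, Λ.map_update_smul, hswap]
    norm_num
    ring
  · obtain ⟨r, hr⟩ : ∃ r : ℕ, (t : ℕ) = r + 1 := ⟨t - 1, by omega⟩
    have hr' : r < M + 1 := by have := t.2; omega
    have e1 : Function.update (fun s : Fin (M + 1) => g s) 0 (d 0) t.castSucc = g t := by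
      rw [Function.update_of_ne]
      · rfl
      · intro h
        have := congrArg Fin.val h
        simp at this
        omega
    rw [hd, ← e1, Λ.map_update_smul_eq_zero _ hne, hr, hd]
    have := Λ.map_update_smul_eq_zero (fun s : Fin (M + 1) => g s) (s := t.succ) (t := ⟨r, hr'⟩)
      (by intro h; have := congrArg Fin.val h; simp at this; omega) ((1 : ℝ) / 2 - (r + 1))
    rw [this]
    ring

/-- The algebraic core of the second-order equation satisfied by the determinant of periods. -/
theorem second_order_identity (Λ : V [⋀^Fin (M + 1)]→ₗ[ℝ] ℝ) (j : ι) (ξ : ι → ℝ) (g : ℕ → V)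
    (D : ι → ℕ → V) (e : V) (hj : ξ j = 0) (hξ : ∀ i, i ≠ j → ξ i ≠ 0)
    (hrec : ∀ i s, D i (s + 1) =
      ξ i • D i s + ((1 : ℝ) / 2 - if i = j then (s : ℝ) + 1 else 0) • g s)
    (hsum : ∀ s, ∑ i, D i s = 0)
    (he : (4 : ℝ) • e = -∑ i ∈ Finset.univ.filter fun i => i ≠ j, (2 / ξ i) • (D i 0 - D j 0)) :
    4 * (Λ (Function.update (fun s : Fin (M + 1) => g s) 0 e) +
        ∑ t : Fin M, Λ (Function.update (Function.update (fun s : Fin (M + 1) => g s) 0 (D j 0))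
          t.succ (D j (t + 1)))) +
      ∑ i ∈ Finset.univ.filter fun i => i ≠ j,
        2 / ξ i * ∑ s : Fin (M + 1), Λ (Function.update (fun s : Fin (M + 1) => g s) s (D i s)) =
    (∑ i ∈ Finset.univ.filter fun i => i ≠ j, 2 / ξ i) *
      Λ (Function.update (fun s : Fin (M + 1) => g s) 0 (D j 0)) := by
  have hd : ∀ s : ℕ, D j (s + 1) = ((1 : ℝ) / 2 - (s + 1)) • g s := by
    intro s
    rw [hrec, hj, zero_smul, zero_add, if_pos rfl]
  have hrow : ∀ t : Fin M,
      4 * Λ (Function.update (Function.update (fun s : Fin (M + 1) => g s) 0 (D j 0)) t.succ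
        (D j (t + 1))) + ∑ i ∈ Finset.univ.filter fun i => i ≠ j,
        2 / ξ i * Λ (Function.update (fun s : Fin (M + 1) => g s) t.succ (D i (t + 1))) = 0 := by
    intro t
    have hterm : ∀ i ∈ Finset.univ.filter fun i => i ≠ j,
        2 / ξ i * Λ (Function.update (fun s : Fin (M + 1) => g s) t.succ (D i (t + 1))) =
          2 * Λ (Function.update (fun s : Fin (M + 1) => g s) t.succ (D i t)) := by
      intro i hi
      have hij : i ≠ j := (Finset.mem_filter.1 hi).2
      rw [hrec, Λ.map_update_add, if_neg hij, Λ.map_update_smul]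
      have := Λ.map_update_smul_eq_zero (fun s : Fin (M + 1) => g s) (s := t.succ)
        (t := t.castSucc) (Fin.castSucc_lt_succ).ne' ((1 : ℝ) / 2 - 0)
      rw [Fin.val_castSucc] at this
      rw [this, smul_eq_mul]
      have := hξ i hij
      field_simp
      ring
    have hs : ∑ i ∈ Finset.univ.filter fun i => i ≠ j, D i t = -D j t := by
      rw [eq_neg_iff_add_eq_zero, ← hsum t, Finset.filter_ne', add_comm]
      exact Finset.add_sum_erase _ (fun i => D i t) (Finset.mem_univ j)
    rw [second_order_row_succ Λ g (D j) hd, Finset.sum_congr rfl hterm, ← Finset.mul_sum,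
      ← Λ.map_update_sum, hs, Λ.map_update_neg]
    ring
  have hzero : 4 * Λ (Function.update (fun s : Fin (M + 1) => g s) 0 e) +
      ∑ i ∈ Finset.univ.filter fun i => i ≠ j,
        2 / ξ i * Λ (Function.update (fun s : Fin (M + 1) => g s) 0 (D i 0)) =
      (∑ i ∈ Finset.univ.filter fun i => i ≠ j, 2 / ξ i) *
        Λ (Function.update (fun s : Fin (M + 1) => g s) 0 (D j 0)) := by
    rw [← smul_eq_mul (4 : ℝ), ← Λ.map_update_smul, he, Λ.map_update_neg, Λ.map_update_sum,
      Finset.sum_mul, ← Finset.sum_neg_distrib, ← Finset.sum_add_distrib]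
    refine Finset.sum_congr rfl fun i _ => ?_
    rw [Λ.map_update_smul, Λ.map_update_sub, smul_eq_mul]
    ring
  have hsplit : ∑ i ∈ Finset.univ.filter fun i => i ≠ j,
        2 / ξ i * ∑ s : Fin (M + 1), Λ (Function.update (fun s : Fin (M + 1) => g s) s (D i s)) =
      (∑ i ∈ Finset.univ.filter fun i => i ≠ j,
        2 / ξ i * Λ (Function.update (fun s : Fin (M + 1) => g s) 0 (D i 0))) +
      ∑ t : Fin M, ∑ i ∈ Finset.univ.filter fun i => i ≠ j,
        2 / ξ i * Λ (Function.update (fun s : Fin (M + 1) => g s) t.succ (D i (t + 1))) := by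
    rw [Finset.sum_comm, ← Finset.sum_add_distrib]
    refine Finset.sum_congr rfl fun i _ => ?_
    rw [Fin.sum_univ_succ, mul_add, Finset.mul_sum]
    rfl
  have htot : ∑ t : Fin M, (4 * Λ (Function.update (Function.update (fun s : Fin (M + 1) => g s) 0
      (D j 0)) t.succ (D j (t + 1))) + ∑ i ∈ Finset.univ.filter fun i => i ≠ j,
        2 / ξ i * Λ (Function.update (fun s : Fin (M + 1) => g s) t.succ (D i (t + 1)))) = 0 :=
    Finset.sum_eq_zero fun t _ => hrow t
  rw [Finset.sum_add_distrib, ← Finset.mul_sum] at htot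
  rw [hsplit]
  linear_combination hzero + htot

end Alternating

section DeterminantEquation

variable {ι : Type} [Fintype ι] {V : Type} [NormedAddCommGroup V]
  [NormedSpace ℝ V] {M : ℕ}

theorem fderiv_alternating_apply (Λ : V [⋀^Fin (M + 1)]→L[ℝ] ℝ) {b : Fin (M + 1) → (ι → ℝ) → V}
    {x : ι → ℝ} (hb : ∀ s, DifferentiableAt ℝ (b s) x) (v : ι → ℝ) :
    fderiv ℝ (fun y => Λ fun s => b s y) x v =
      ∑ s, Λ.toAlternatingMap (Function.update (fun s => b s x) s (fderiv ℝ (b s) x v)) := by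
  have h := HasFDerivAt.multilinear_comp (f := Λ.toContinuousMultilinearMap)
    fun s => (hb s).hasFDerivAt
  have h2 : fderiv ℝ (fun y => Λ fun s => b s y) x = _ := h.fderiv
  rw [h2]
  simp

theorem contDiffOn_fderiv_apply {E : Type} [NormedAddCommGroup E] [NormedSpace ℝ E]
    {U : Set (ι → ℝ)} (hU : IsOpen U) {f : (ι → ℝ) → E} (hf : ContDiffOn ℝ ∞ f U) (v : ι → ℝ) :
    ContDiffOn ℝ ∞ (fun y => fderiv ℝ f y v) U :=
  (hf.fderiv_of_isOpen hU (m := ∞) (by simp)).clm_apply contDiffOn_const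

theorem fderiv_fderiv_comm {E : Type} [NormedAddCommGroup E] [NormedSpace ℝ E]
    {U : Set (ι → ℝ)} (hU : IsOpen U) {f : (ι → ℝ) → E} (hf : ContDiffOn ℝ ∞ f U) {x : ι → ℝ}
    (hx : x ∈ U) (v w : ι → ℝ) :
    fderiv ℝ (fun y => fderiv ℝ f y v) x w = fderiv ℝ (fun y => fderiv ℝ f y w) x v := by
  have hd : DifferentiableAt ℝ (fderiv ℝ f) x :=
    ((hf.fderiv_of_isOpen hU (m := ∞) (by simp)).contDiffAt (hU.mem_nhds hx)).differentiableAt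
      (by simp)
  have hs : IsSymmSndFDerivAt ℝ f x :=
    (hf.contDiffAt (hU.mem_nhds hx)).isSymmSndFDerivAt (by
      rw [minSmoothness_of_isRCLikeNormedField]; exact WithTop.coe_le_coe.2 le_top)
  rw [fderiv_clm_apply hd (differentiableAt_const v), fderiv_clm_apply hd (differentiableAt_const w)]
  simpa using hs.eq w v

variable [DecidableEq ι]

/-- The Euler–Poisson–Darboux equation, from the first-order recursion. -/
theorem mul_fderiv_fderiv_of_recursion {U : Set (ι → ℝ)} (hU : IsOpen U) {G₀ G₁ : (ι → ℝ) → V}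
    (h₀ : ContDiffOn ℝ ∞ G₀ U) (h₁ : ContDiffOn ℝ ∞ G₁ U) {i j : ι} (hij : i ≠ j)
    (hi : ∀ y ∈ U, fderiv ℝ G₁ y (Pi.single i 1) =
      (y i - y j) • fderiv ℝ G₀ y (Pi.single i 1) + ((1 : ℝ) / 2) • G₀ y)
    (hj : ∀ y ∈ U, fderiv ℝ G₁ y (Pi.single j 1) = -((1 : ℝ) / 2) • G₀ y) {x : ι → ℝ}
    (hx : x ∈ U) :
    (x i - x j) • fderiv ℝ (fun y => fderiv ℝ G₀ y (Pi.single i 1)) x (Pi.single j 1) =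
      ((1 : ℝ) / 2) • (fderiv ℝ G₀ x (Pi.single i 1) - fderiv ℝ G₀ x (Pi.single j 1)) := by
  have hsymm := fderiv_fderiv_comm hU h₁ hx (Pi.single i 1) (Pi.single j 1)
  have ei : (fun y => fderiv ℝ G₁ y (Pi.single i 1)) =ᶠ[nhds x] fun y =>
      (y i - y j) • fderiv ℝ G₀ y (Pi.single i 1) + ((1 : ℝ) / 2) • G₀ y :=
    Filter.eventually_of_mem (hU.mem_nhds hx) hi
  have ej : (fun y => fderiv ℝ G₁ y (Pi.single j 1)) =ᶠ[nhds x] fun y =>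
      -((1 : ℝ) / 2) • G₀ y :=
    Filter.eventually_of_mem (hU.mem_nhds hx) hj
  have d0 : DifferentiableAt ℝ G₀ x :=
    (h₀.contDiffAt (hU.mem_nhds hx)).differentiableAt (by simp)
  have d1 : DifferentiableAt ℝ (fun y => fderiv ℝ G₀ y (Pi.single i 1)) x :=
    ((contDiffOn_fderiv_apply hU h₀ _).contDiffAt (hU.mem_nhds hx)).differentiableAt (by simp)
  have dc : HasFDerivAt (fun y : ι → ℝ => y i - y j)
      (ContinuousLinearMap.proj (R := ℝ) (φ := fun _ : ι => ℝ) i -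
        ContinuousLinearMap.proj (R := ℝ) (φ := fun _ : ι => ℝ) j) x :=
    (hasFDerivAt_apply i x).sub (hasFDerivAt_apply j x)
  have l := (dc.smul d1.hasFDerivAt).add (d0.hasFDerivAt.const_smul ((1 : ℝ) / 2))
  have r := d0.hasFDerivAt.const_smul (-((1 : ℝ) / 2))
  have hl := l.fderiv
  have hr := r.fderiv
  rw [ei.fderiv_eq, ej.fderiv_eq] at hsymm
  have hl' := congrArg (fun T => T (Pi.single j (1 : ℝ))) hl
  have hr' := congrArg (fun T => T (Pi.single i (1 : ℝ))) hr
  have key := hl'.symm.trans (Eq.trans hsymm hr')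
  simp [hij] at key
  have : (x i - x j) • fderiv ℝ (fun y => fderiv ℝ G₀ y (Pi.single i 1)) x (Pi.single j 1) =
      ((x i - x j) • fderiv ℝ (fun y => fderiv ℝ G₀ y (Pi.single i 1)) x (Pi.single j 1) +
        -fderiv ℝ G₀ x (Pi.single i 1) + (2⁻¹ : ℝ) • fderiv ℝ G₀ x (Pi.single j 1)) +
      fderiv ℝ G₀ x (Pi.single i 1) - (2⁻¹ : ℝ) • fderiv ℝ G₀ x (Pi.single j 1) := by abel
  rw [this, key]
  module

/-- The second-order equation satisfied by a determinant of periods. -/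
theorem second_order_alternating {U : Set (ι → ℝ)} (hU : IsOpen U) (Λ : V [⋀^Fin (M + 1)]→L[ℝ] ℝ)
    (G : ℕ → (ι → ℝ) → V) (j : ι) (hG : ∀ s, ContDiffOn ℝ ∞ (G s) U)
    (hrec : ∀ i s, ∀ y ∈ U, fderiv ℝ (G (s + 1)) y (Pi.single i 1) =
      (y i - y j) • fderiv ℝ (G s) y (Pi.single i 1) +
        ((1 : ℝ) / 2 - if i = j then (s : ℝ) + 1 else 0) • G s y)
    (hsum : ∀ s, ∀ y ∈ U, ∑ i, fderiv ℝ (G s) y (Pi.single i 1) = 0)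
    {x : ι → ℝ} (hx : x ∈ U) (hne : ∀ i, i ≠ j → x i - x j ≠ 0) :
    4 * fderiv ℝ (fun z => fderiv ℝ (fun y => Λ fun s : Fin (M + 1) => G s y) z (Pi.single j 1)) x
        (Pi.single j 1) +
      ∑ i ∈ Finset.univ.filter fun i => i ≠ j,
        2 / (x i - x j) * fderiv ℝ (fun y => Λ fun s : Fin (M + 1) => G s y) x (Pi.single i 1) =
    (∑ i ∈ Finset.univ.filter fun i => i ≠ j, 2 / (x i - x j)) *
      fderiv ℝ (fun y => Λ fun s : Fin (M + 1) => G s y) x (Pi.single j 1) := by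
  have hdiff : ∀ s, ∀ y ∈ U, DifferentiableAt ℝ (G s) y := fun s y hy =>
    ((hG s).contDiffAt (hU.mem_nhds hy)).differentiableAt (by simp)
  have hdj : ∀ s, ContDiffOn ℝ ∞ (fun y => fderiv ℝ (G s) y (Pi.single j 1)) U := fun s =>
    contDiffOn_fderiv_apply hU (hG s) _
  have hfirst : ∀ y ∈ U, ∀ i, fderiv ℝ (fun y => Λ fun s : Fin (M + 1) => G s y) y
      (Pi.single i 1) = ∑ s : Fin (M + 1), Λ.toAlternatingMap (Function.update
        (fun s : Fin (M + 1) => G s y) s (fderiv ℝ (G s) y (Pi.single i 1))) := fun y hy i =>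
    fderiv_alternating_apply Λ (b := fun s : Fin (M + 1) => G s) (fun s => hdiff s y hy) _
  have hfirstj : ∀ y ∈ U, fderiv ℝ (fun y => Λ fun s : Fin (M + 1) => G s y) y
      (Pi.single j 1) = Λ.toAlternatingMap (Function.update
        (fun s : Fin (M + 1) => G s y) 0 (fderiv ℝ (G 0) y (Pi.single j 1))) := by
    intro y hy
    rw [hfirst y hy]
    exact sum_map_update_eq_map_update_zero Λ.toAlternatingMap (fun s => G s y)
      (fun s => fderiv ℝ (G s) y (Pi.single j 1)) (fun s => (1 : ℝ) / 2 - ((s : ℝ) + 1))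
      fun s => by rw [hrec j s y hy]; simp
  set b : Fin (M + 1) → (ι → ℝ) → V := Function.update (fun s : Fin (M + 1) => G s) 0
    fun y => fderiv ℝ (G 0) y (Pi.single j 1) with hb
  have hbx : ∀ y, (fun s => b s y) = Function.update (fun s : Fin (M + 1) => G s y) 0
      (fderiv ℝ (G 0) y (Pi.single j 1)) := by
    intro y
    funext s
    rcases eq_or_ne s 0 with rfl | hs
    · simp [hb]
    · simp [hb, hs]
  have hbdiff : ∀ s, DifferentiableAt ℝ (b s) x := by
    intro s
    rcases eq_or_ne s 0 with rfl | hs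
    · simpa [hb] using ((hdj 0).contDiffAt (hU.mem_nhds hx)).differentiableAt (by simp)
    · simpa [hb, hs] using hdiff s x hx
  have hsecond : fderiv ℝ (fun z => fderiv ℝ (fun y => Λ fun s : Fin (M + 1) => G s y) z
        (Pi.single j 1)) x (Pi.single j 1) =
      Λ.toAlternatingMap (Function.update (fun s : Fin (M + 1) => G s x) 0
        (fderiv ℝ (fun y => fderiv ℝ (G 0) y (Pi.single j 1)) x (Pi.single j 1))) +
      ∑ t : Fin M, Λ.toAlternatingMap (Function.update (Function.update
        (fun s : Fin (M + 1) => G s x) 0 (fderiv ℝ (G 0) x (Pi.single j 1))) t.succ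
          (fderiv ℝ (G (t + 1)) x (Pi.single j 1))) := by
    have he : (fun z => fderiv ℝ (fun y => Λ fun s : Fin (M + 1) => G s y) z (Pi.single j 1))
        =ᶠ[nhds x] fun y => Λ fun s => b s y :=
      Filter.eventually_of_mem (hU.mem_nhds hx) fun y hy => (hfirstj y hy).trans
        (congrArg Λ (hbx y).symm)
    rw [he.fderiv_eq, fderiv_alternating_apply Λ hbdiff, Fin.sum_univ_succ, hbx]
    congr 1
    simp [hb]
  have hepd : ∀ i, i ≠ j →
      (4 : ℝ) • fderiv ℝ (fun y => fderiv ℝ (G 0) y (Pi.single i 1)) x (Pi.single j 1) =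
        (2 / (x i - x j)) • (fderiv ℝ (G 0) x (Pi.single i 1) -
          fderiv ℝ (G 0) x (Pi.single j 1)) := by
    intro i hij
    have h := mul_fderiv_fderiv_of_recursion hU (hG 0) (hG 1) hij
      (fun y hy => by rw [hrec i 0 y hy]; simp [hij])
      (fun y hy => by rw [hrec j 0 y hy]; norm_num) hx
    have h2 := congrArg (fun w => (4 / (x i - x j)) • w) h
    simp only [smul_smul] at h2
    rw [div_mul_cancel₀ _ (hne i hij)] at h2
    rw [h2]
    congr 1
    ring
  have hsum2 : ∑ i, fderiv ℝ (fun y => fderiv ℝ (G 0) y (Pi.single i 1)) x (Pi.single j 1) = 0 := by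
    have hz : (fun y => ∑ i, fderiv ℝ (G 0) y (Pi.single i 1)) =ᶠ[nhds x] fun _ => (0 : V) :=
      Filter.eventually_of_mem (hU.mem_nhds hx) (hsum 0)
    have hz' := hz.fderiv_eq (𝕜 := ℝ)
    rw [fderiv_fun_sum fun i _ => ((contDiffOn_fderiv_apply hU (hG 0) _).contDiffAt
      (hU.mem_nhds hx)).differentiableAt (by simp)] at hz'
    simpa using congrArg (fun T => T (Pi.single j (1 : ℝ))) hz'
  have he : (4 : ℝ) • fderiv ℝ (fun y => fderiv ℝ (G 0) y (Pi.single j 1)) x (Pi.single j 1) =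
      -∑ i ∈ Finset.univ.filter fun i => i ≠ j, (2 / (x i - x j)) •
        (fderiv ℝ (G 0) x (Pi.single i 1) - fderiv ℝ (G 0) x (Pi.single j 1)) := by
    rw [eq_neg_iff_add_eq_zero, ← Finset.sum_congr rfl fun i hi => hepd i (Finset.mem_filter.1 hi).2,
      ← Finset.smul_sum (r := (4 : ℝ)), ← smul_add, Finset.filter_ne', Finset.add_sum_erase _
        (fun i => fderiv ℝ (fun y => fderiv ℝ (G 0) y (Pi.single i 1)) x (Pi.single j 1))
        (Finset.mem_univ j), hsum2, smul_zero]
  rw [hsecond, hfirstj x hx]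
  simp only [hfirst x hx]
  exact second_order_identity Λ.toAlternatingMap j (fun i => x i - x j) (fun s => G s x)
    (fun i s => fderiv ℝ (G s) x (Pi.single i 1)) _ (sub_self _) hne
    (fun i s => hrec i s x hx) (fun s => hsum s x hx) he

end DeterminantEquation

section Prefactor

variable {n : ℕ}

/-- The Coulomb prefactor `∏_{a<b} (y b - y a)^{1/4}`. -/
noncomputable def prefactor (n : ℕ) (y : Fin n → ℝ) : ℝ :=
  ∏ p ∈ (Finset.univ : Finset (Fin n × Fin n)).filter fun p => p.1 < p.2,
    (y p.2 - y p.1) ^ ((4 : ℝ)⁻¹)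

/-- The logarithmic derivative of `prefactor` in the coordinate `i`. -/
noncomputable def prefactorLogDeriv (i : Fin n) (y : Fin n → ℝ) : ℝ :=
  (4 : ℝ)⁻¹ * ∑ l, (y i - y l)⁻¹

theorem isOpen_setOf_increasing (n : ℕ) :
    IsOpen {y : Fin n → ℝ | ∀ i j : Fin n, i < j → y i < y j} := by
  simp only [Set.ofPred_forall]
  exact isOpen_iInter_of_finite fun i => isOpen_iInter_of_finite fun j =>
    isOpen_iInter_of_finite fun _ => isOpen_lt (continuous_apply i) (continuous_apply j)

theorem sub_ne_zero_of_increasing {y : Fin n → ℝ} (hy : ∀ i j : Fin n, i < j → y i < y j)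
    {i j : Fin n} (hij : i ≠ j) : y i - y j ≠ 0 := by
  rcases lt_or_gt_of_ne hij with h | h
  · exact (sub_neg.2 (hy i j h)).ne
  · exact (sub_pos.2 (hy j i h)).ne'

theorem prefactor_eq_exp {y : Fin n → ℝ} (hy : ∀ i j : Fin n, i < j → y i < y j) :
    prefactor n y = Real.exp (∑ p ∈ (Finset.univ : Finset (Fin n × Fin n)).filter
      fun p => p.1 < p.2, Real.log (y p.2 - y p.1) * (4 : ℝ)⁻¹) := by
  rw [Real.exp_sum]
  exact Finset.prod_congr rfl fun p hp =>
    Real.rpow_def_of_pos (sub_pos.2 (hy _ _ (Finset.mem_filter.1 hp).2)) _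

theorem contDiffOn_prefactor (n : ℕ) :
    ContDiffOn ℝ ∞ (prefactor n) {y : Fin n → ℝ | ∀ i j : Fin n, i < j → y i < y j} := by
  refine ContDiffOn.congr ?_ fun y hy => prefactor_eq_exp hy
  refine Real.contDiff_exp.comp_contDiffOn (ContDiffOn.sum fun p hp => ?_)
  refine ContDiffOn.mul (ContDiffOn.log (by fun_prop) fun y hy => ?_) contDiffOn_const
  exact (sub_pos.2 (hy _ _ (Finset.mem_filter.1 hp).2)).ne'

theorem sum_pairs_eq {k : Fin n → Fin n → ℝ} (hk : ∀ a b, k a b = -k b a) (i : Fin n) :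
    ∑ p ∈ (Finset.univ : Finset (Fin n × Fin n)).filter fun p => p.1 < p.2,
      k p.1 p.2 * ((Pi.single i (1 : ℝ) : Fin n → ℝ) p.2 - (Pi.single i (1 : ℝ) : Fin n → ℝ) p.1) =
      ∑ l, k l i := by
  have hterm : ∀ a b : Fin n, (if a < b then k a b * ((Pi.single i (1 : ℝ) : Fin n → ℝ) b -
      (Pi.single i (1 : ℝ) : Fin n → ℝ) a) else 0) =
      (if b = i then (if a < b then k a b else 0) else 0) -
        if a = i then (if a < b then k a b else 0) else 0 := by
    intro a b
    simp only [Pi.single_apply]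
    split_ifs <;> ring
  rw [Finset.sum_filter, Fintype.sum_prod_type]
  simp only [hterm, Finset.sum_sub_distrib, Finset.sum_ite_eq', Finset.mem_univ, if_true]
  rw [Finset.sum_comm (f := fun a b => if a = i then (if a < b then k a b else 0) else 0)]
  simp only [Finset.sum_ite_eq', Finset.mem_univ, if_true]
  rw [← Finset.sum_sub_distrib]
  refine Finset.sum_congr rfl fun l _ => ?_
  rcases lt_trichotomy l i with h | h | h
  · simp [h, h.not_gt]
  · subst h
    have := hk l l
    simp
    linarith
  · simp [h, h.not_gt, hk i l]

theorem fderiv_prefactor {y : Fin n → ℝ} (hy : ∀ i j : Fin n, i < j → y i < y j) (i : Fin n) :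
    fderiv ℝ (prefactor n) y (Pi.single i 1) = prefactor n y * prefactorLogDeriv i y := by
  have he : prefactor n =ᶠ[nhds y] fun y => Real.exp (∑ p ∈ (Finset.univ : Finset
      (Fin n × Fin n)).filter fun p => p.1 < p.2, Real.log (y p.2 - y p.1) * (4 : ℝ)⁻¹) :=
    Filter.eventually_of_mem ((isOpen_setOf_increasing n).mem_nhds hy) fun z hz =>
      prefactor_eq_exp hz
  have hl : ∀ p ∈ (Finset.univ : Finset (Fin n × Fin n)).filter fun p => p.1 < p.2,
      HasFDerivAt (fun y : Fin n → ℝ => Real.log (y p.2 - y p.1) * (4 : ℝ)⁻¹)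
        ((4 : ℝ)⁻¹ • (y p.2 - y p.1)⁻¹ •
          (ContinuousLinearMap.proj (R := ℝ) (φ := fun _ : Fin n => ℝ) p.2 -
            ContinuousLinearMap.proj (R := ℝ) (φ := fun _ : Fin n => ℝ) p.1)) y := fun p hp =>
    (((hasFDerivAt_apply p.2 y).sub (hasFDerivAt_apply p.1 y)).log
      (sub_pos.2 (hy _ _ (Finset.mem_filter.1 hp).2)).ne').mul_const _
  rw [he.fderiv_eq, (HasFDerivAt.fun_sum hl).exp.fderiv, ← prefactor_eq_exp hy]
  simp only [smul_apply, sum_apply, smul_eq_mul,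
    sub_apply, ContinuousLinearMap.proj_apply]
  rw [← Finset.mul_sum, sum_pairs_eq (k := fun a b => (y b - y a)⁻¹) (fun a b => by
    rw [← neg_sub, inv_neg]) i, prefactorLogDeriv]

theorem hasFDerivAt_inv_sub {y : Fin n → ℝ} {i l : Fin n} (h : y i - y l ≠ 0) :
    HasFDerivAt (fun y : Fin n → ℝ => (y i - y l)⁻¹)
      (-((y i - y l) ^ 2)⁻¹ • (ContinuousLinearMap.proj (R := ℝ) (φ := fun _ : Fin n => ℝ) i -
        ContinuousLinearMap.proj (R := ℝ) (φ := fun _ : Fin n => ℝ) l)) y :=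
  (hasDerivAt_inv h).comp_hasFDerivAt (x := y)
    (f := fun y : Fin n → ℝ => y i - y l) ((hasFDerivAt_apply i y).sub (hasFDerivAt_apply l y))

theorem hasFDerivAt_prefactorLogDeriv {y : Fin n → ℝ} (hy : ∀ i j : Fin n, i < j → y i < y j)
    (i : Fin n) :
    HasFDerivAt (prefactorLogDeriv i) ((4 : ℝ)⁻¹ • ∑ l, -((y i - y l) ^ 2)⁻¹ •
      (ContinuousLinearMap.proj (R := ℝ) (φ := fun _ : Fin n => ℝ) i -
        ContinuousLinearMap.proj (R := ℝ) (φ := fun _ : Fin n => ℝ) l)) y := by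
  refine HasFDerivAt.const_mul (HasFDerivAt.fun_sum fun l _ => ?_) _
  rcases eq_or_ne l i with rfl | hl
  · simpa using hasFDerivAt_const (0 : ℝ) y
  · exact hasFDerivAt_inv_sub (sub_ne_zero_of_increasing hy hl.symm)

theorem fderiv_prefactorLogDeriv {y : Fin n → ℝ} (hy : ∀ i j : Fin n, i < j → y i < y j)
    (j : Fin n) :
    fderiv ℝ (prefactorLogDeriv j) y (Pi.single j 1) =
      -((4 : ℝ)⁻¹ * ∑ i ∈ Finset.univ.filter fun i => i ≠ j, ((y i - y j) ^ 2)⁻¹) := by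
  rw [(hasFDerivAt_prefactorLogDeriv hy j).fderiv]
  simp only [smul_apply, sum_apply, smul_eq_mul,
    sub_apply, ContinuousLinearMap.proj_apply]
  rw [← mul_neg, ← Finset.sum_neg_distrib, Finset.sum_filter]
  congr 1
  refine Finset.sum_congr rfl fun l _ => ?_
  rcases eq_or_ne l j with rfl | hl
  · simp
  · rw [if_pos hl, Pi.single_eq_same, Pi.single_eq_of_ne hl, ← neg_sub (y l) (y j)]
    ring

theorem sum_inv_mul_inv_sub (T : Finset (Fin n)) (ξ : Fin n → ℝ) (h0 : ∀ i ∈ T, ξ i ≠ 0)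
    (hne : ∀ i l, i ≠ l → ξ i - ξ l ≠ 0) :
    2 * ∑ i ∈ T, ∑ l ∈ T, (ξ i)⁻¹ * (ξ i - ξ l)⁻¹ =
      ∑ i ∈ T, ((ξ i) ^ 2)⁻¹ - (∑ i ∈ T, (ξ i)⁻¹) ^ 2 := by
  have hterm : ∀ i ∈ T, ∀ l ∈ T, (ξ i)⁻¹ * (ξ i - ξ l)⁻¹ + (ξ l)⁻¹ * (ξ l - ξ i)⁻¹ =
      (if i = l then ((ξ i) ^ 2)⁻¹ else 0) - (ξ i)⁻¹ * (ξ l)⁻¹ := by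
    intro i hi l hl
    have hi0 := h0 i hi
    have hl0 := h0 l hl
    rcases eq_or_ne i l with rfl | hil
    · simp
      ring
    · rw [if_neg hil, ← neg_sub (ξ i) (ξ l)]
      have := hne i l hil
      field_simp
      ring
  calc 2 * ∑ i ∈ T, ∑ l ∈ T, (ξ i)⁻¹ * (ξ i - ξ l)⁻¹
      = ∑ i ∈ T, ∑ l ∈ T, ((ξ i)⁻¹ * (ξ i - ξ l)⁻¹ + (ξ l)⁻¹ * (ξ l - ξ i)⁻¹) := by
        simp only [Finset.sum_add_distrib]
        rw [Finset.sum_comm (f := fun i l => (ξ l)⁻¹ * (ξ l - ξ i)⁻¹)]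
        ring
    _ = ∑ i ∈ T, ∑ l ∈ T, ((if i = l then ((ξ i) ^ 2)⁻¹ else 0) - (ξ i)⁻¹ * (ξ l)⁻¹) :=
        Finset.sum_congr rfl fun i hi => Finset.sum_congr rfl fun l hl => hterm i hi l hl
    _ = _ := by
        simp only [Finset.sum_sub_distrib, Finset.sum_ite_eq]
        rw [pow_two, Finset.sum_mul_sum]
        congr 1
        exact Finset.sum_congr rfl fun i hi => if_pos hi

theorem prefactor_identity {y : Fin n → ℝ} (hy : ∀ i j : Fin n, i < j → y i < y j) (j : Fin n) :
    4 * (prefactorLogDeriv j y ^ 2 + fderiv ℝ (prefactorLogDeriv j) y (Pi.single j 1)) +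
      ∑ i ∈ Finset.univ.filter fun i => i ≠ j, (2 / (y i - y j) * prefactorLogDeriv i y +
        (4 : ℝ)⁻¹ * ((y i - y j) ^ 2)⁻¹) = 0 := by
  set T := Finset.univ.filter fun i : Fin n => i ≠ j with hT
  have hS : prefactorLogDeriv j y = -((4 : ℝ)⁻¹ * ∑ i ∈ T, (y i - y j)⁻¹) := by
    rw [prefactorLogDeriv, ← mul_neg, ← Finset.sum_neg_distrib, hT, Finset.sum_filter]
    congr 1
    refine Finset.sum_congr rfl fun l _ => ?_
    rcases eq_or_ne l j with rfl | hl
    · simp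
    · rw [if_pos hl, ← inv_neg, neg_sub]
  have hSi : ∀ i, prefactorLogDeriv i y =
      (4 : ℝ)⁻¹ * ((y i - y j)⁻¹ + ∑ l ∈ T, (y i - y j - (y l - y j))⁻¹) := by
    intro i
    simp only [sub_sub_sub_cancel_right]
    rw [prefactorLogDeriv, hT, Finset.filter_ne', Finset.add_sum_erase _
      (fun l => (y i - y l)⁻¹) (Finset.mem_univ j)]
  have hsum := sum_inv_mul_inv_sub T (fun i => y i - y j)
    (fun i hi => sub_ne_zero_of_increasing hy (Finset.mem_filter.1 hi).2)
    (fun i l hil => by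
      simpa only [sub_sub_sub_cancel_right] using sub_ne_zero_of_increasing hy hil)
  have hcross : ∑ i ∈ T, (2 / (y i - y j) * prefactorLogDeriv i y +
      (4 : ℝ)⁻¹ * ((y i - y j) ^ 2)⁻¹) = 3 / 4 * ∑ i ∈ T, ((y i - y j) ^ 2)⁻¹ +
      1 / 2 * ∑ i ∈ T, ∑ l ∈ T, (y i - y j)⁻¹ * (y i - y j - (y l - y j))⁻¹ := by
    rw [Finset.mul_sum, Finset.mul_sum, ← Finset.sum_add_distrib]
    refine Finset.sum_congr rfl fun i _ => ?_
    rw [hSi, ← Finset.mul_sum, pow_two, mul_inv]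
    ring
  rw [hcross, fderiv_prefactorLogDeriv hy, ← hT, hS]
  linear_combination (1 / 4) * hsum

/-- Multiplying a solution of the second-order equation for determinants by the prefactor gives a
solution of the level-two equation. -/
theorem level_two_equation_of_second_order {Z : (Fin n → ℝ) → ℝ}
    (hZ : ContDiffOn ℝ ∞ Z {y : Fin n → ℝ | ∀ i j : Fin n, i < j → y i < y j})
    {x : Fin n → ℝ} (hx : ∀ i j : Fin n, i < j → x i < x j) (j : Fin n)
    (hj : 4 * fderiv ℝ (fun z => fderiv ℝ Z z (Pi.single j 1)) x (Pi.single j 1) +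
      ∑ i ∈ Finset.univ.filter fun i => i ≠ j,
        2 / (x i - x j) * fderiv ℝ Z x (Pi.single i 1) =
      (∑ i ∈ Finset.univ.filter fun i => i ≠ j, 2 / (x i - x j)) *
        fderiv ℝ Z x (Pi.single j 1)) :
    4 * fderiv ℝ (fun z => fderiv ℝ (fun y => prefactor n y * Z y) z (Pi.single j 1)) x
        (Pi.single j 1) +
      ∑ i ∈ Finset.univ.filter fun i => i ≠ j,
        (2 / (x i - x j) * fderiv ℝ (fun y => prefactor n y * Z y) x (Pi.single i 1) +
          (4 : ℝ)⁻¹ * ((x i - x j) ^ 2)⁻¹ * (prefactor n x * Z x)) = 0 := by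
  have hU := isOpen_setOf_increasing n
  have hPd : ∀ y ∈ {y : Fin n → ℝ | ∀ i j : Fin n, i < j → y i < y j},
      DifferentiableAt ℝ (prefactor n) y := fun y hy =>
    ((contDiffOn_prefactor n).contDiffAt (hU.mem_nhds hy)).differentiableAt (by simp)
  have hZd : ∀ y ∈ {y : Fin n → ℝ | ∀ i j : Fin n, i < j → y i < y j},
      DifferentiableAt ℝ Z y := fun y hy =>
    (hZ.contDiffAt (hU.mem_nhds hy)).differentiableAt (by simp)
  have hfirst : ∀ y ∈ {y : Fin n → ℝ | ∀ i j : Fin n, i < j → y i < y j}, ∀ i,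
      fderiv ℝ (fun y => prefactor n y * Z y) y (Pi.single i 1) =
        prefactor n y * (prefactorLogDeriv i y * Z y + fderiv ℝ Z y (Pi.single i 1)) := by
    intro y hy i
    rw [fderiv_fun_mul (hPd y hy) (hZd y hy)]
    simp only [add_apply, smul_apply, smul_eq_mul,
      fderiv_prefactor hy]
    ring
  have hSd : DifferentiableAt ℝ (prefactorLogDeriv j) x :=
    (hasFDerivAt_prefactorLogDeriv hx j).differentiableAt
  have hZ2 : DifferentiableAt ℝ (fun y => fderiv ℝ Z y (Pi.single j 1)) x :=
    ((contDiffOn_fderiv_apply hU hZ _).contDiffAt (hU.mem_nhds hx)).differentiableAt (by simp)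
  have he : (fun z => fderiv ℝ (fun y => prefactor n y * Z y) z (Pi.single j 1)) =ᶠ[nhds x]
      fun y => prefactor n y * (prefactorLogDeriv j y * Z y + fderiv ℝ Z y (Pi.single j 1)) :=
    Filter.eventually_of_mem (hU.mem_nhds hx) fun y hy => hfirst y hy j
  have hsecond : fderiv ℝ (fun z => fderiv ℝ (fun y => prefactor n y * Z y) z (Pi.single j 1)) x
      (Pi.single j 1) = prefactor n x * (
        (prefactorLogDeriv j x ^ 2 + fderiv ℝ (prefactorLogDeriv j) x (Pi.single j 1)) * Z x +
        2 * prefactorLogDeriv j x * fderiv ℝ Z x (Pi.single j 1) +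
        fderiv ℝ (fun y => fderiv ℝ Z y (Pi.single j 1)) x (Pi.single j 1)) := by
    rw [he.fderiv_eq, fderiv_fun_mul (hPd x hx) ((hSd.fun_mul (hZd x hx)).fun_add hZ2),
      fderiv_fun_add (hSd.fun_mul (hZd x hx)) hZ2, fderiv_fun_mul hSd (hZd x hx)]
    simp only [add_apply, smul_apply, smul_eq_mul,
      fderiv_prefactor hx]
    ring
  have hS : 8 * prefactorLogDeriv j x =
      -∑ i ∈ Finset.univ.filter fun i => i ≠ j, 2 / (x i - x j) := by
    rw [prefactorLogDeriv, ← Finset.sum_neg_distrib, Finset.sum_filter, ← mul_assoc,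
      Finset.mul_sum]
    refine Finset.sum_congr rfl fun l _ => ?_
    rcases eq_or_ne l j with rfl | hl
    · simp
    · rw [if_pos hl, ← neg_sub (x l) (x j), inv_neg]
      ring
  have hid := prefactor_identity hx j
  have hsplit : ∑ i ∈ Finset.univ.filter fun i => i ≠ j,
        (2 / (x i - x j) * fderiv ℝ (fun y => prefactor n y * Z y) x (Pi.single i 1) +
          (4 : ℝ)⁻¹ * ((x i - x j) ^ 2)⁻¹ * (prefactor n x * Z x)) =
      prefactor n x * Z x * (∑ i ∈ Finset.univ.filter fun i => i ≠ j,
        (2 / (x i - x j) * prefactorLogDeriv i x + (4 : ℝ)⁻¹ * ((x i - x j) ^ 2)⁻¹)) +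
      prefactor n x * ∑ i ∈ Finset.univ.filter fun i => i ≠ j,
        2 / (x i - x j) * fderiv ℝ Z x (Pi.single i 1) := by
    rw [Finset.mul_sum, Finset.mul_sum, ← Finset.sum_add_distrib]
    refine Finset.sum_congr rfl fun i _ => ?_
    rw [hfirst x hx]
    ring
  rw [hsplit, hsecond]
  linear_combination (prefactor n x * Z x) * hid + prefactor n x * hj +
    prefactor n x * fderiv ℝ Z x (Pi.single j 1) * hS

end Prefactor

section SineSubstitution

variable {ι : Type}

theorem injOn_sineParam {p q : ι} {x : ι → ℝ} (hx : x p < x q) :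
    Set.InjOn (sineParam p q x) (Set.Ioo (-(Real.pi / 2)) (Real.pi / 2)) := by
  intro a ha b hb hab
  refine Real.injOn_sin (Set.Ioo_subset_Icc_self ha) (Set.Ioo_subset_Icc_self hb) ?_
  have h : (x q - x p) / 2 ≠ 0 := (half_pos (sub_pos.2 hx)).ne'
  exact mul_left_cancel₀ h (add_left_cancel hab)

theorem image_sineParam {p q : ι} {x : ι → ℝ} (hx : x p < x q) :
    Set.image (sineParam p q x) (Set.Ioo (-(Real.pi / 2)) (Real.pi / 2)) = Set.Ioo (x p) (x q) := by
  ext u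
  constructor
  · rintro ⟨θ, hθ, rfl⟩
    have h1 : -1 < Real.sin θ := by
      rw [← Real.neg_pi_div_two_lt_arcsin, Real.arcsin_sin hθ.1.le hθ.2.le]
      exact hθ.1
    have h2 : Real.sin θ < 1 := by
      rw [← Real.arcsin_lt_pi_div_two, Real.arcsin_sin hθ.1.le hθ.2.le]
      exact hθ.2
    constructor <;> unfold sineParam <;> nlinarith
  · rintro ⟨h1, h2⟩
    have hpos : 0 < x q - x p := sub_pos.2 hx
    have hlow : -1 < (2 * u - x p - x q) / (x q - x p) := by
      rw [lt_div_iff₀ hpos]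
      linarith
    have hupp : (2 * u - x p - x q) / (x q - x p) < 1 := by
      rw [div_lt_one hpos]
      linarith
    refine ⟨Real.arcsin ((2 * u - x p - x q) / (x q - x p)),
      ⟨Real.neg_pi_div_two_lt_arcsin.2 hlow, Real.arcsin_lt_pi_div_two.2 hupp⟩, ?_⟩
    rw [sineParam, Real.sin_arcsin hlow.le hupp.le]
    field_simp
    ring

theorem abs_deriv_mul_endpoint_weights {p q : ι} {x : ι → ℝ} (hx : x p < x q) {θ : ℝ}
    (hθ : θ ∈ Set.Ioo (-(Real.pi / 2)) (Real.pi / 2)) :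
    |(x q - x p) / 2 * Real.cos θ| * (|sineParam p q x θ - x p| ^ (-(2 : ℝ)⁻¹) *
      |sineParam p q x θ - x q| ^ (-(2 : ℝ)⁻¹)) = 1 := by
  have hpos : 0 < (x q - x p) / 2 * Real.cos θ :=
    mul_pos (half_pos (sub_pos.2 hx)) (Real.cos_pos_of_mem_Ioo hθ)
  have hprod : |sineParam p q x θ - x p| * |sineParam p q x θ - x q| =
      ((x q - x p) / 2 * Real.cos θ) ^ 2 := by
    have : (sineParam p q x θ - x p) * (sineParam p q x θ - x q) =
        -((x q - x p) / 2 * Real.cos θ) ^ 2 := by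
      unfold sineParam
      linear_combination ((x q - x p) / 2) ^ 2 * Real.sin_sq_add_cos_sq θ
    rw [← abs_mul, this, abs_neg, abs_of_nonneg (sq_nonneg _)]
  rw [← Real.mul_rpow (abs_nonneg _) (abs_nonneg _), hprod, Real.rpow_neg (sq_nonneg _),
    abs_of_pos hpos, ← one_div (2 : ℝ), ← Real.sqrt_eq_rpow, Real.sqrt_sq hpos.le]
  exact mul_inv_cancel₀ hpos.ne'

variable [Fintype ι] [DecidableEq ι]

/-- The integrand `(u - x j) ^ s ∏ |u - x l| ^ (-1/2)` of a period. -/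
noncomputable def periodIntegrand (j : ι) (s : ℕ) (x : ι → ℝ) (u : ℝ) : ℝ :=
  (u - x j) ^ s * ∏ l, |u - x l| ^ (-(2 : ℝ)⁻¹)

theorem abs_deriv_smul_periodIntegrand {p q : ι} (j : ι) (s : ℕ) {x : ι → ℝ} (hx : x p < x q)
    {θ : ℝ} (hθ : θ ∈ Set.Ioo (-(Real.pi / 2)) (Real.pi / 2)) :
    |(x q - x p) / 2 * Real.cos θ| • periodIntegrand j s x (sineParam p q x θ) =
      gapIntegrand p q j s (sineParam p q x θ) x := by
  have hpq : p ≠ q := fun h => hx.ne (congrArg x h)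
  have ho : others p q = (Finset.univ.erase p).erase q := by
    ext l
    simp [others, and_comm]
  have h := abs_deriv_mul_endpoint_weights hx hθ
  rw [periodIntegrand, gapIntegrand, otherWeight, ho, smul_eq_mul,
    ← Finset.mul_prod_erase Finset.univ _ (Finset.mem_univ p),
    ← Finset.mul_prod_erase (Finset.univ.erase p) _
      (Finset.mem_erase.2 ⟨hpq.symm, Finset.mem_univ q⟩)]
  set A := ∏ l ∈ (Finset.univ.erase p).erase q, |sineParam p q x θ - x l| ^ (-(2 : ℝ)⁻¹)
  linear_combination ((sineParam p q x θ - x j) ^ s * A) * h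

theorem integrableOn_periodIntegrand {p q : ι} (j : ι) (s : ℕ) {x : ι → ℝ}
    (hx : x ∈ gapDomain p q) :
    IntegrableOn (periodIntegrand j s x) (Set.Ioo (x p) (x q)) := by
  rw [← image_sineParam hx.1, integrableOn_image_iff_integrableOn_abs_deriv_smul
    measurableSet_Ioo (fun θ _ => (hasDerivAt_sineParam_angle p q x θ).hasDerivWithinAt)
    (injOn_sineParam hx.1)]
  refine IntegrableOn.congr_fun ?_
    (fun θ hθ => (abs_deriv_smul_periodIntegrand j s hx.1 hθ).symm) measurableSet_Ioo
  exact ((continuous_gapIntegrand j s hx).integrableOn_Icc).mono_set Set.Ioo_subset_Icc_self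

theorem integral_periodIntegrand {p q : ι} (j : ι) (s : ℕ) {x : ι → ℝ}
    (hx : x ∈ gapDomain p q) :
    ∫ u in Set.Ioo (x p) (x q), periodIntegrand j s x u = gapPeriod p q j s x := by
  rw [← image_sineParam hx.1, integral_image_eq_integral_abs_deriv_smul
    measurableSet_Ioo (fun θ _ => (hasDerivAt_sineParam_angle p q x θ).hasDerivWithinAt)
    (injOn_sineParam hx.1), gapPeriod, intervalIntegral.integral_of_le
      (by linarith [Real.pi_pos]), integral_Ioc_eq_integral_Ioo]
  exact setIntegral_congr_fun measurableSet_Ioo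
    fun θ hθ => abs_deriv_smul_periodIntegrand j s hx.1 hθ

end SineSubstitution

section DeterminantFormula

variable {ι : Type} [Fintype ι] [DecidableEq ι] {N : ℕ}

theorem prod_pairs_sub_eq_sum (u : Fin N → ℝ) (c : ℝ) :
    ∏ p ∈ (Finset.univ ×ˢ Finset.univ : Finset (Fin N × Fin N)).filter (fun p => p.1 < p.2),
        (u p.2 - u p.1) =
      ∑ σ : Equiv.Perm (Fin N), ((Equiv.Perm.sign σ : ℤ) : ℝ) * ∏ r, (u r - c) ^ (σ r : ℕ) := by
  have h := Matrix.det_vandermonde fun r => u r - c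
  rw [← Matrix.det_transpose, Matrix.det_apply'] at h
  simp only [Matrix.transpose_apply, Matrix.vandermonde_apply, sub_sub_sub_cancel_right] at h
  rw [h, Finset.prod_filter, Finset.prod_product]
  refine Finset.prod_congr rfl fun r _ => ?_
  rw [← Finset.prod_filter]
  congr 1
  ext s
  simp

/-- The multiple integral with a Vandermonde factor is the determinant of the periods. -/
theorem integral_vandermonde_eq_det (p q : Fin N → ι) (j : ι) {x : ι → ℝ}
    (hx : ∀ r, x ∈ gapDomain (p r) (q r)) :
    ∫ u : Fin N → ℝ in Set.univ.pi fun r => Set.Ioo (x (p r)) (x (q r)),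
      (∏ a ∈ (Finset.univ ×ˢ Finset.univ : Finset (Fin N × Fin N)).filter fun a => a.1 < a.2,
        (u a.2 - u a.1)) * ∏ r, ∏ l, |u r - x l| ^ (-(2 : ℝ)⁻¹) =
      (Matrix.of fun s r : Fin N => gapPeriod (p r) (q r) j s x).det := by
  have hexp : ∀ u : Fin N → ℝ,
      (∏ a ∈ (Finset.univ ×ˢ Finset.univ : Finset (Fin N × Fin N)).filter fun a => a.1 < a.2,
        (u a.2 - u a.1)) * ∏ r, ∏ l, |u r - x l| ^ (-(2 : ℝ)⁻¹) =
      ∑ σ : Equiv.Perm (Fin N), ((Equiv.Perm.sign σ : ℤ) : ℝ) *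
        ∏ r, periodIntegrand j (σ r) x (u r) := by
    intro u
    rw [prod_pairs_sub_eq_sum u (x j), Finset.sum_mul]
    refine Finset.sum_congr rfl fun σ _ => ?_
    rw [mul_assoc, ← Finset.prod_mul_distrib]
    rfl
  simp only [hexp]
  rw [volume_pi, Measure.restrict_pi_pi, integral_finsetSum, Matrix.det_apply']
  · refine Finset.sum_congr rfl fun σ _ => ?_
    rw [integral_const_mul, integral_fintype_prod_eq_prod]
    congr 1
    exact Finset.prod_congr rfl fun r _ => integral_periodIntegrand j (σ r) (hx r)
  · intro σ _
    exact (Integrable.fintype_prod fun r =>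
      integrableOn_periodIntegrand j (σ r) (hx r)).const_mul _

end DeterminantFormula

section SingleIntegral

/-- The determinant as a continuous alternating map in the rows. -/
noncomputable def detContinuousAlternating (n : ℕ) : (Fin n → ℝ) [⋀^Fin n]→L[ℝ] ℝ :=
  { Matrix.detRowAlternating (n := Fin n) (R := ℝ) with
    cont := Continuous.matrix_det continuous_id }

theorem detContinuousAlternating_apply {n : ℕ} (v : Fin n → Fin n → ℝ) :
    detContinuousAlternating n v = (Matrix.of v).det := rfl

/-- The vector of the periods with exponent `s`, over the gaps `(p r, q r)`. -/
noncomputable def periodRow {n N : ℕ} (p q : Fin N → Fin n) (j : Fin n) (s : ℕ) (y : Fin n → ℝ) :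
    Fin N → ℝ :=
  fun r => gapPeriod (p r) (q r) j s y

theorem contDiffOn_periodRow {n N : ℕ} (p q : Fin N → Fin n) (j : Fin n) (s : ℕ)
    {U : Set (Fin n → ℝ)} (hU : ∀ r, U ⊆ gapDomain (p r) (q r)) :
    ContDiffOn ℝ ∞ (periodRow p q j s) U :=
  contDiffOn_pi.2 fun r => (contDiffOn_gapPeriod (p r) (q r) j s).mono (hU r)

theorem fderiv_periodRow {n N : ℕ} (p q : Fin N → Fin n) (j : Fin n) (s : ℕ) {y : Fin n → ℝ}
    (hy : ∀ r, y ∈ gapDomain (p r) (q r)) (v : Fin n → ℝ) :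
    fderiv ℝ (periodRow p q j s) y v = fun r => fderiv ℝ (gapPeriod (p r) (q r) j s) y v := by
  have h : fderiv ℝ (periodRow p q j s) y = _ :=
    fderiv_pi (φ := fun r => gapPeriod (p r) (q r) j s) fun r =>
    ((contDiffOn_gapPeriod (p r) (q r) j s).contDiffAt
      ((isOpen_gapDomain _ _).mem_nhds (hy r))).differentiableAt (by simp)
  rw [h]
  rfl

theorem prod_Icc_one_eq (m : ℕ) (g : ℕ → ℝ) :
    ∏ i ∈ Finset.Icc 1 m, g i = ∏ i : Fin m, g (i + 1) := by
  rw [← Finset.prod_range fun i => g (i + 1), Finset.range_eq_Ico,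
    Finset.prod_Ico_add' g 0 m 1]
  rfl

/-- The extension of a configuration to a function of the `1`-based index. -/
noncomputable def extendIndex (N : ℕ) (y : Fin (2 * N) → ℝ) (i : ℕ) : ℝ :=
  if h : 1 ≤ i ∧ i ≤ 2 * N then y ⟨i - 1, by omega⟩ else 0

theorem extendIndex_succ {N : ℕ} (y : Fin (2 * N) → ℝ) (i : Fin (2 * N)) :
    extendIndex N y (i + 1) = y i := by
  have := i.2
  rw [extendIndex, dif_pos ⟨by omega, by omega⟩]
  rfl

theorem mem_gapDomain_of_mem_chamberFin {N : ℕ} {y : Fin (2 * N) → ℝ} (hy : y ∈ chamberFin N)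
    {p q : Fin (2 * N)} (hpq : (q : ℕ) = p + 1) : y ∈ gapDomain p q := by
  refine ⟨hy p q (Fin.lt_def.2 (by omega)), fun l hp hq => ?_⟩
  have hp' : (l : ℕ) ≠ p := fun h => hp (Fin.ext h)
  have hq' : (l : ℕ) ≠ q := fun h => hq (Fin.ext h)
  rcases lt_or_gt_of_ne hp' with h | h
  · exact Or.inl (hy l p (Fin.lt_def.2 h))
  · exact Or.inr (hy q l (Fin.lt_def.2 (by omega)))

theorem rho_extendIndex_eq {N : ℕ} {k : Fin N → ℕ} {p q : Fin N → Fin (2 * N)}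
    (hp : ∀ r, k r = p r + 1) (hq : ∀ r, (q r : ℕ) = p r + 1) (j : Fin (2 * N))
    {y : Fin (2 * N) → ℝ} (hy : y ∈ chamberFin N) :
    rho N k (extendIndex N y) = prefactor (2 * N) y *
      detContinuousAlternating N fun s : Fin N => periodRow p q j s y := by
  have hpre : (∏ p ∈ (Finset.Icc 1 (2 * N) ×ˢ Finset.Icc 1 (2 * N)).filter fun p => p.1 < p.2,
      (extendIndex N y p.2 - extendIndex N y p.1) ^ ((4 : ℝ)⁻¹)) = prefactor (2 * N) y := by
    rw [prefactor, Finset.prod_filter, Finset.prod_product, Finset.prod_filter,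
      Fintype.prod_prod_type]
    simp only [prod_Icc_one_eq, extendIndex_succ, add_lt_add_iff_right, Fin.val_fin_lt]
  have hleft : ∀ r, extendIndex N y (k r) = y (p r) := fun r => by
    rw [hp, extendIndex_succ]
  have hright : ∀ r, extendIndex N y (k r + 1) = y (q r) := fun r => by
    rw [hp, ← hq, extendIndex_succ]
  rw [rho, hpre, detContinuousAlternating_apply]
  congr 1
  simp only [prod_Icc_one_eq, extendIndex_succ, hleft, hright]
  exact integral_vandermonde_eq_det p q j fun r => mem_gapDomain_of_mem_chamberFin hy (hq r)

theorem exists_gap_indices {N : ℕ} {k : Fin N → ℕ} (hk : ∀ r, 1 ≤ k r ∧ k r ≤ 2 * N - 1) :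
    ∃ p q : Fin N → Fin (2 * N), (∀ r, k r = p r + 1) ∧ ∀ r, (q r : ℕ) = p r + 1 :=
  ⟨fun r => ⟨k r - 1, by have := hk r; omega⟩, fun r => ⟨k r, by have := hk r; omega⟩,
    fun r => (Nat.sub_add_cancel (hk r).1).symm, fun r => (Nat.sub_add_cancel (hk r).1).symm⟩

/-- The functions whose combinations are the Coulomb gas integrals are smooth on the chamber. -/
theorem contDiffOn_rho {N : ℕ} (hN : 1 ≤ N) {k : Fin N → ℕ}
    (hk : ∀ r, 1 ≤ k r ∧ k r ≤ 2 * N - 1) :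
    ContDiffOn ℝ ∞ (fun y => rho N k (extendIndex N y)) (chamberFin N) := by
  obtain ⟨p, q, hp, hq⟩ := exists_gap_indices hk
  have j : Fin (2 * N) := ⟨0, by omega⟩
  refine ContDiffOn.congr ?_ fun y hy => rho_extendIndex_eq hp hq j hy
  refine (contDiffOn_prefactor (2 * N)).mul ?_
  exact (detContinuousAlternating N).toContinuousMultilinearMap.contDiff.comp_contDiffOn
    (contDiffOn_pi.2 fun s => contDiffOn_periodRow p q j s fun r _ hy =>
      mem_gapDomain_of_mem_chamberFin hy (hq r))

/-- The functions whose combinations are the Coulomb gas integrals solve the level-two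
equations. -/
theorem level_two_equation_rho {N : ℕ} {k : Fin N → ℕ}
    (hk : ∀ r, 1 ≤ k r ∧ k r ≤ 2 * N - 1) (j : Fin (2 * N)) {y : Fin (2 * N) → ℝ}
    (hy : y ∈ chamberFin N) :
    4 * fderiv ℝ (fun z => fderiv ℝ (fun y => rho N k (extendIndex N y)) z (Pi.single j 1)) y
        (Pi.single j 1) +
      ∑ i ∈ Finset.univ.filter fun i => i ≠ j,
        (2 / (y i - y j) * fderiv ℝ (fun y => rho N k (extendIndex N y)) y (Pi.single i 1) +
          (4 : ℝ)⁻¹ * ((y i - y j) ^ 2)⁻¹ * rho N k (extendIndex N y)) = 0 := by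
  obtain ⟨p, q, hp, hq⟩ := exists_gap_indices hk
  have hU : IsOpen (chamberFin N) := isOpen_setOf_increasing (2 * N)
  have hgap : ∀ z ∈ chamberFin N, ∀ r, z ∈ gapDomain (p r) (q r) := fun z hz r =>
    mem_gapDomain_of_mem_chamberFin hz (hq r)
  have hrow : ∀ s, ContDiffOn ℝ ∞ (periodRow p q j s) (chamberFin N) := fun s =>
    contDiffOn_periodRow p q j s fun r z hz => hgap z hz r
  set Z : (Fin (2 * N) → ℝ) → ℝ := fun y =>
    detContinuousAlternating N fun s : Fin N => periodRow p q j s y with hZdef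
  have hZ : ContDiffOn ℝ ∞ Z (chamberFin N) :=
    (detContinuousAlternating N).toContinuousMultilinearMap.contDiff.comp_contDiffOn
      (contDiffOn_pi.2 fun s => hrow s)
  have hZeq : 4 * fderiv ℝ (fun z => fderiv ℝ Z z (Pi.single j 1)) y (Pi.single j 1) +
      ∑ i ∈ Finset.univ.filter fun i => i ≠ j,
        2 / (y i - y j) * fderiv ℝ Z y (Pi.single i 1) =
      (∑ i ∈ Finset.univ.filter fun i => i ≠ j, 2 / (y i - y j)) *
        fderiv ℝ Z y (Pi.single j 1) := by
    obtain ⟨M, rfl⟩ : ∃ M, N = M + 1 := ⟨N - 1, by have := j.2; omega⟩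
    refine second_order_alternating hU (detContinuousAlternating (M + 1)) (periodRow p q j) j hrow
      (fun i s z hz => ?_) (fun s z hz => ?_) hy fun i hij => sub_ne_zero_of_increasing hy hij
    · rw [fderiv_periodRow p q j _ (hgap z hz), fderiv_periodRow p q j _ (hgap z hz)]
      funext r
      exact fderiv_gapPeriod_succ i j s (hgap z hz r)
    · funext r
      simp only [fderiv_periodRow p q j _ (hgap z hz), Finset.sum_apply]
      exact sum_fderiv_gapPeriod j s (hgap z hz r)
  have heq : ∀ z ∈ chamberFin N, (fun y => rho N k (extendIndex N y)) =ᶠ[nhds z]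
      fun y => prefactor (2 * N) y * Z y := fun z hz =>
    Filter.eventually_of_mem (hU.mem_nhds hz) fun w hw => rho_extendIndex_eq hp hq j hw
  have heq2 : (fun z => fderiv ℝ (fun y => rho N k (extendIndex N y)) z (Pi.single j 1)) =ᶠ[nhds y]
      fun z => fderiv ℝ (fun y => prefactor (2 * N) y * Z y) z (Pi.single j 1) :=
    Filter.eventually_of_mem (hU.mem_nhds hy) fun w hw => by
      simp only [(heq w hw).fderiv_eq]
  rw [heq2.fderiv_eq, (heq y hy).fderiv_eq, rho_extendIndex_eq hp hq j hy]
  exact level_two_equation_of_second_order hZ hy j hZeq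

end SingleIntegral

section Assembly

/-- A linear equation of order two is inherited by complex linear combinations of real
solutions. -/
theorem level_two_equation_sum {n : ℕ} {K : Type} (T : Finset K) (c : K → ℂ)
    (f : K → (Fin n → ℝ) → ℝ) {U : Set (Fin n → ℝ)} (hU : IsOpen U)
    (hf : ∀ k ∈ T, ContDiffOn ℝ ∞ (f k) U) (j : Fin n) {y : Fin n → ℝ} (hy : y ∈ U)
    (a b : Fin n → ℝ)
    (heq : ∀ k ∈ T, 4 * fderiv ℝ (fun z => fderiv ℝ (f k) z (Pi.single j 1)) y (Pi.single j 1) +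
      ∑ i ∈ Finset.univ.filter fun i => i ≠ j,
        (a i * fderiv ℝ (f k) y (Pi.single i 1) + b i * f k y) = 0) :
    (4 : ℂ) * fderiv ℝ (fun z => fderiv ℝ (fun y => ∑ k ∈ T, c k * (f k y : ℂ)) z
        (Pi.single j 1)) y (Pi.single j 1) +
      ∑ i ∈ Finset.univ.filter fun i => i ≠ j,
        ((a i : ℂ) * fderiv ℝ (fun y => ∑ k ∈ T, c k * (f k y : ℂ)) y (Pi.single i 1) +
          (b i : ℂ) * ∑ k ∈ T, c k * (f k y : ℂ)) = 0 := by
  have hcomb : ∀ (g : K → (Fin n → ℝ) → ℝ) (z v : Fin n → ℝ),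
      (∀ k ∈ T, DifferentiableAt ℝ (g k) z) →
      fderiv ℝ (fun y => ∑ k ∈ T, c k * (g k y : ℂ)) z v =
        ∑ k ∈ T, c k * ((fderiv ℝ (g k) z v : ℝ) : ℂ) := by
    intro g z v hg
    have h : HasFDerivAt (fun y => ∑ k ∈ T, c k * (g k y : ℂ))
        (∑ k ∈ T, c k • Complex.ofRealCLM.comp (fderiv ℝ (g k) z)) z :=
      HasFDerivAt.fun_sum fun k hk =>
        (Complex.ofRealCLM.hasFDerivAt.comp z (hg k hk).hasFDerivAt).const_mul (c k)
    rw [h.fderiv]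
    simp
  have hd : ∀ z ∈ U, ∀ k ∈ T, DifferentiableAt ℝ (f k) z := fun z hz k hk =>
    ((hf k hk).contDiffAt (hU.mem_nhds hz)).differentiableAt (by simp)
  have he : (fun z => fderiv ℝ (fun y => ∑ k ∈ T, c k * (f k y : ℂ)) z (Pi.single j 1)) =ᶠ[nhds y]
      fun z => ∑ k ∈ T, c k * ((fderiv ℝ (f k) z (Pi.single j 1) : ℝ) : ℂ) :=
    Filter.eventually_of_mem (hU.mem_nhds hy) fun z hz => hcomb f z _ (hd z hz)
  rw [he.fderiv_eq, hcomb (fun k z => fderiv ℝ (f k) z (Pi.single j 1)) y _ fun k hk =>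
    ((contDiffOn_fderiv_apply hU (hf k hk) _).contDiffAt (hU.mem_nhds hy)).differentiableAt
      (by simp)]
  simp only [hcomb f y _ (hd y hy)]
  have hsum : ∑ k ∈ T, c k * ((4 * fderiv ℝ (fun z => fderiv ℝ (f k) z (Pi.single j 1)) y
      (Pi.single j 1) + ∑ i ∈ Finset.univ.filter fun i => i ≠ j,
        (a i * fderiv ℝ (f k) y (Pi.single i 1) + b i * f k y) : ℝ) : ℂ) = 0 :=
    Finset.sum_eq_zero fun k hk => by rw [heq k hk, Complex.ofReal_zero, mul_zero]
  rw [← hsum]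
  push_cast
  simp only [mul_add, Finset.sum_add_distrib, Finset.mul_sum]
  rw [Finset.sum_comm (s := Finset.univ.filter fun i => i ≠ j),
    Finset.sum_comm (s := Finset.univ.filter fun i => i ≠ j)]
  congr 1
  · exact Finset.sum_congr rfl fun k _ => by ring
  · congr 1 <;>
    exact Finset.sum_congr rfl fun k _ => Finset.sum_congr rfl fun i _ => by ring

end Assembly

/-- **Smoothness and BPZ PDEs for the Coulomb gas integrals.** `F_β` is infinitely
differentiable on `𝔛_{2N}` and satisfies the level-two BPZ PDE in each variable. -/
theorem coulomb_smooth_and_BPZ (N : ℕ) (hN : 1 ≤ N) (β : LinkPattern N) :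
    ContDiffOn ℝ ∞ (coulombFin N β) (chamberFin N) ∧
    ∀ j : Fin (2 * N), ∀ y ∈ chamberFin N,
      (4 : ℂ) *
          fderiv ℝ (fun z => fderiv ℝ (coulombFin N β) z (Pi.single j 1)) y (Pi.single j 1) +
        ∑ i ∈ Finset.univ.filter fun i => i ≠ j,
          (((2 / (y i - y j) : ℝ) : ℂ) * fderiv ℝ (coulombFin N β) y (Pi.single i 1) +
            ((((4 : ℝ)⁻¹ * ((y i - y j) ^ 2)⁻¹ : ℝ)) : ℂ) * coulombFin N β y) = 0 := by
  have hrange : ∀ k ∈ (Fintype.piFinset fun _ : Fin N => Finset.Icc 1 (2 * N - 1)).filter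
      fun k => ∀ r s : Fin N, r < s → k r < k s, ∀ r, 1 ≤ k r ∧ k r ≤ 2 * N - 1 :=
    fun k hk r => Finset.mem_Icc.1 (Fintype.mem_piFinset.1 (Finset.mem_filter.1 hk).1 r)
  refine ⟨ContDiffOn.sum fun k hk => contDiffOn_const.mul
    (Complex.ofRealCLM.contDiff.comp_contDiffOn (contDiffOn_rho hN (hrange k hk))), ?_⟩
  intro j y hy
  exact level_two_equation_sum _ (linkCoeff N β) (fun k y => rho N k (extendIndex N y))
    (isOpen_setOf_increasing (2 * N)) (fun k hk => contDiffOn_rho hN (hrange k hk)) j hy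
    (fun i => 2 / (y i - y j)) (fun i => (4 : ℝ)⁻¹ * ((y i - y j) ^ 2)⁻¹)
    fun k hk => level_two_equation_rho (hrange k hk) j hy
end

section
/- Let N ≥ 1, β ∈ LP_N, and x ∈ 𝔛_{2N}. Let a, b, c, d ∈ ℝ with ad − bc > 0 and set φ(t) = (a t + b)/(c t + d). Assume c·x_i + d ≠ 0 for all i ∈ {1,…,2N} and φ(x_1) < φ(x_2) < ⋯ < φ(x_{2N}). Then the Coulomb gas integral satisfies the Möbius covariance F_β(x_1,…,x_{2N}) = ∏_{i=1}^{2N} φ′(x_i)^{−1/8} · F_β(φ(x_1),…,φ(x_{2N})), where φ′(x_i) = (ad − bc)/(c x_i + d)² > 0. -/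
open MeasureTheory

/-- The inverse square root of the absolute value. -/
noncomputable def absInvSqrt (t : ℝ) : ℝ := |t| ^ (-(2 : ℝ)⁻¹)

lemma absInvSqrt_eq (t : ℝ) : absInvSqrt t = 1 / √|t| := by
  rw [absInvSqrt, Real.rpow_neg (abs_nonneg t), Real.sqrt_eq_rpow, one_div, one_div]

lemma absInvSqrt_nonneg (t : ℝ) : 0 ≤ absInvSqrt t := Real.rpow_nonneg (abs_nonneg t) _

lemma absInvSqrt_mul (s t : ℝ) : absInvSqrt (s * t) = absInvSqrt s * absInvSqrt t := by
  rw [absInvSqrt, abs_mul, Real.mul_rpow (abs_nonneg _) (abs_nonneg _)]; rfl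

lemma absInvSqrt_sub_comm (s t : ℝ) : absInvSqrt (s - t) = absInvSqrt (t - s) := by
  rw [absInvSqrt, abs_sub_comm]; rfl

lemma absInvSqrt_continuousAt {t : ℝ} (ht : t ≠ 0) : ContinuousAt absInvSqrt t :=
  continuous_abs.continuousAt.rpow_const (Or.inl (abs_ne_zero.mpr ht))

lemma affine_pos {p q c d v : ℝ} (hp : 0 < c * p + d) (hq : 0 < c * q + d)
    (hv : v ∈ Set.Icc p q) : 0 < c * v + d := by
  obtain ⟨h1, h2⟩ := hv
  rcases le_total 0 c with h | h
  · nlinarith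
  · nlinarith

lemma arcsine_hasDerivAt {p q c d v : ℝ} (hp : 0 < c * p + d) (hq : 0 < c * q + d)
    (hv : v ∈ Set.Ioo p q) :
    HasDerivAt (fun t => Real.arcsin (1 - 2 * (c * p + d) * (q - t) / ((q - p) * (c * t + d))))
      (√((c * p + d) * (c * q + d)) *
        (1 / (c * v + d) * (absInvSqrt (v - p) * absInvSqrt (v - q)))) v := by
  have hL := affine_pos hp hq ⟨hv.1.le, hv.2.le⟩
  obtain ⟨h1, h2⟩ := hv
  have h1' : 0 < v - p := sub_pos.mpr h1
  have h2' : 0 < q - v := sub_pos.mpr h2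
  have hpq : 0 < q - p := by linarith
  set M := 1 - 2 * (c * p + d) * (q - v) / ((q - p) * (c * v + d)) with hM
  have e1 : 1 - M = 2 * (c * p + d) * (q - v) / ((q - p) * (c * v + d)) := by rw [hM]; ring
  have e2 : 1 + M = 2 * (c * q + d) * (v - p) / ((q - p) * (c * v + d)) := by
    rw [hM]; field_simp; ring
  have p1 : 0 < 1 - M := by rw [e1]; positivity
  have p2 : 0 < 1 + M := by rw [e2]; positivity
  have hd : HasDerivAt (fun t => 1 - 2 * (c * p + d) * (q - t) / ((q - p) * (c * t + d)))
      (2 * (c * p + d) * (c * q + d) / ((q - p) * (c * v + d) ^ 2)) v := by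
    have ha : HasDerivAt (fun t => 2 * (c * p + d) * (q - t)) (2 * (c * p + d) * (-1)) v :=
      ((hasDerivAt_id v).const_sub q).const_mul _
    have hb : HasDerivAt (fun t => (q - p) * (c * t + d)) ((q - p) * (c * 1)) v :=
      (((hasDerivAt_id v).const_mul c).add_const d).const_mul _
    refine ((ha.div hb (by positivity)).const_sub 1).congr_deriv ?_
    field_simp
    ring
  refine ((Real.hasDerivAt_arcsin (by linarith) (by linarith)).comp v hd).congr_deriv ?_
  rw [absInvSqrt_eq, absInvSqrt_eq, abs_of_pos h1', abs_sub_comm, abs_of_pos h2']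
  have e3 : 1 - M ^ 2 = (2 / ((q - p) * (c * v + d))) ^ 2 *
      (((c * p + d) * (c * q + d)) * ((v - p) * (q - v))) := by
    rw [show 1 - M ^ 2 = (1 - M) * (1 + M) by ring, e1, e2]; field_simp
  rw [← hM, e3, Real.sqrt_mul (by positivity), Real.sqrt_sq (by positivity),
    Real.sqrt_mul (by positivity) ((v - p) * (q - v)), Real.sqrt_mul h1'.le]
  have s1 : 0 < √(v - p) := Real.sqrt_pos.mpr h1'
  have s2 : 0 < √(q - v) := Real.sqrt_pos.mpr h2'
  have s3 : 0 < √((c * p + d) * (c * q + d)) := Real.sqrt_pos.mpr (by positivity)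
  have s4 : √((c * p + d) * (c * q + d)) ^ 2 = (c * p + d) * (c * q + d) :=
    Real.sq_sqrt (by positivity)
  rw [mul_comm c p, mul_comm c q] at *
  field_simp
  rw [s4]

lemma arcsine_continuousOn {p q c d : ℝ} (hpq : p < q) (hp : 0 < c * p + d)
    (hq : 0 < c * q + d) : ContinuousOn
      (fun t => Real.arcsin (1 - 2 * (c * p + d) * (q - t) / ((q - p) * (c * t + d))))
      (Set.Icc p q) := by
  refine Real.continuous_arcsin.comp_continuousOn (continuousOn_const.sub
    (ContinuousOn.div (by fun_prop) (by fun_prop) fun t ht => ?_))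
  exact mul_ne_zero (sub_pos.mpr hpq).ne' (affine_pos hp hq ht).ne'

lemma arcsine_integrableOn {p q c d : ℝ} (hpq : p < q) (hp : 0 < c * p + d)
    (hq : 0 < c * q + d) : IntegrableOn (fun v =>
      1 / (c * v + d) * (absInvSqrt (v - p) * absInvSqrt (v - q))) (Set.Ioc p q) := by
  have s3 : 0 < √((c * p + d) * (c * q + d)) := Real.sqrt_pos.mpr (by positivity)
  have h := intervalIntegral.integrableOn_deriv_of_nonneg (arcsine_continuousOn hpq hp hq)
    (fun v hv => arcsine_hasDerivAt hp hq hv) (fun v hv => by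
      have := affine_pos hp hq ⟨hv.1.le, hv.2.le⟩
      have := absInvSqrt_nonneg (v - p)
      have := absInvSqrt_nonneg (v - q)
      positivity)
  have h2 := h.const_mul (√((c * p + d) * (c * q + d)))⁻¹
  simpa only [inv_mul_cancel_left₀ s3.ne', IntegrableOn] using h2

lemma arcsine_integral {p q c d : ℝ} (hpq : p < q) (hp : 0 < c * p + d)
    (hq : 0 < c * q + d) : ∫ v in Set.Ioo p q,
      1 / (c * v + d) * (absInvSqrt (v - p) * absInvSqrt (v - q)) =
      Real.pi * (absInvSqrt (c * p + d) * absInvSqrt (c * q + d)) := by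
  have s3 : 0 < √((c * p + d) * (c * q + d)) := Real.sqrt_pos.mpr (by positivity)
  have h := intervalIntegral.integral_eq_sub_of_hasDerivAt_of_le hpq.le
    (arcsine_continuousOn hpq hp hq) (fun v hv => arcsine_hasDerivAt hp hq hv)
    ((intervalIntegrable_iff_integrableOn_Ioc_of_le hpq.le).mpr
      ((arcsine_integrableOn hpq hp hq).const_mul _))
  rw [intervalIntegral.integral_const_mul, intervalIntegral.integral_of_le hpq.le,
    integral_Ioc_eq_integral_Ioo] at h
  have e1 : 1 - 2 * (c * p + d) * (q - q) / ((q - p) * (c * q + d)) = 1 := by simp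
  have e2 : 1 - 2 * (c * p + d) * (q - p) / ((q - p) * (c * p + d)) = -1 := by
    have : q - p ≠ 0 := (sub_pos.mpr hpq).ne'
    field_simp; ring
  rw [e1, e2, Real.arcsin_one, Real.arcsin_neg, Real.arcsin_one] at h
  rw [← absInvSqrt_mul, absInvSqrt_eq, abs_of_pos (by positivity)]
  rw [mul_one_div, eq_div_iff s3.ne', mul_comm]
  linarith

lemma arcsine_density_integrableOn {p q : ℝ} (hpq : p < q) :
    IntegrableOn (fun v => absInvSqrt (v - p) * absInvSqrt (v - q)) (Set.Icc p q) := by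
  have h := arcsine_integrableOn (c := 0) (d := 1) hpq (by norm_num) (by norm_num)
  rw [integrableOn_Icc_iff_integrableOn_Ioc]
  simpa using h

/-- The weight `∏ |u - x i|^{-1/2}`. -/
noncomputable def sqrtWeight (n : ℕ) (x : ℕ → ℝ) (u : ℝ) : ℝ :=
  ∏ i ∈ Finset.Icc 1 (2 * n), absInvSqrt (u - x i)

/-- The real period of `g` over the `k`-th interval. -/
noncomputable def period (n : ℕ) (x : ℕ → ℝ) (k : ℕ) (g : ℝ → ℝ) : ℝ :=
  ∫ u in Set.Ioo (x k) (x (k + 1)), g u * sqrtWeight n x u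

/-- The alternating sum of the periods over the odd intervals. -/
noncomputable def oddPeriod (n : ℕ) (x : ℕ → ℝ) (g : ℝ → ℝ) : ℝ :=
  ∑ j ∈ Finset.range n, (-1) ^ j * period n x (2 * j + 1) g

lemma IsChamber.le {n : ℕ} {x : ℕ → ℝ} (hx : IsChamber n x) {i k : ℕ} (hi : 1 ≤ i)
    (hik : i ≤ k) (hk : k ≤ 2 * n) : x i ≤ x k := by
  rcases hik.eq_or_lt with rfl | h
  · exact le_rfl
  · exact (hx i k hi h hk).le

lemma IsChamber.of_succ {n : ℕ} {x : ℕ → ℝ} (hx : IsChamber (n + 1) x) : IsChamber n x :=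
  fun i k hi hik hk => hx i k hi hik (by omega)

lemma sqrtWeight_succ (n : ℕ) (x : ℕ → ℝ) (u : ℝ) : sqrtWeight (n + 1) x u =
    sqrtWeight n x u * (absInvSqrt (u - x (2 * n + 1)) * absInvSqrt (u - x (2 * n + 2))) := by
  rw [sqrtWeight, show 2 * (n + 1) = 2 * n + 1 + 1 by ring,
    Finset.prod_Icc_succ_top (by omega), Finset.prod_Icc_succ_top (by omega), mul_assoc]
  rfl

lemma sqrtWeight_integrableOn {n : ℕ} {x : ℕ → ℝ} (hx : IsChamber n x) {k : ℕ} (hk : 1 ≤ k)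
    (hkn : k + 1 ≤ 2 * n) : IntegrableOn (sqrtWeight n x) (Set.Icc (x k) (x (k + 1))) := by
  have hlt := hx k (k + 1) hk (by omega) hkn
  have hsplit : ∀ u, sqrtWeight n x u =
      (∏ i ∈ ((Finset.Icc 1 (2 * n)).erase k).erase (k + 1), absInvSqrt (u - x i)) *
        (absInvSqrt (u - x k) * absInvSqrt (u - x (k + 1))) := by
    intro u
    have h1 : k ∈ Finset.Icc 1 (2 * n) := Finset.mem_Icc.mpr ⟨hk, by omega⟩
    have h2 : k + 1 ∈ (Finset.Icc 1 (2 * n)).erase k :=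
      Finset.mem_erase.mpr ⟨by omega, Finset.mem_Icc.mpr ⟨by omega, hkn⟩⟩
    rw [sqrtWeight, ← Finset.mul_prod_erase _ _ h1, ← Finset.mul_prod_erase _ _ h2]
    ring
  rw [funext hsplit]
  refine IntegrableOn.continuousOn_mul ?_ (arcsine_density_integrableOn hlt) isCompact_Icc
  refine continuousOn_finsetProd _ fun i hi => ?_
  intro u hu
  have hne : u - x i ≠ 0 := by
    simp only [Finset.mem_erase, Finset.mem_Icc] at hi
    obtain ⟨h1, h2, h3, h4⟩ := hi
    rcases lt_or_gt_of_ne h2 with h | h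
    · have := hx i k h3 h (by omega)
      have := hu.1
      intro h0; linarith
    · have := hx (k + 1) i (by omega) (by omega) h4
      have := hu.2
      intro h0; linarith
  exact ((absInvSqrt_continuousAt hne).comp
    (f := fun u => u - x i) (by fun_prop)).continuousWithinAt

lemma period_integrableOn {n : ℕ} {x : ℕ → ℝ} (hx : IsChamber n x) {k : ℕ} (hk : 1 ≤ k)
    (hkn : k + 1 ≤ 2 * n) {g : ℝ → ℝ} (hg : ContinuousOn g (Set.Icc (x k) (x (k + 1)))) :
    IntegrableOn (fun u => g u * sqrtWeight n x u) (Set.Ioo (x k) (x (k + 1))) :=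
  (IntegrableOn.continuousOn_mul hg (sqrtWeight_integrableOn hx hk hkn) isCompact_Icc).mono_set
    Set.Ioo_subset_Icc_self

lemma period_congr {n : ℕ} {x : ℕ → ℝ} {k : ℕ} {g h : ℝ → ℝ}
    (hgh : ∀ u ∈ Set.Ioo (x k) (x (k + 1)), g u = h u) : period n x k g = period n x k h :=
  setIntegral_congr_fun measurableSet_Ioo fun u hu => by simp only [hgh u hu]

lemma period_const_mul (n : ℕ) (x : ℕ → ℝ) (k : ℕ) (r : ℝ) (g : ℝ → ℝ) :
    period n x k (fun u => r * g u) = r * period n x k g := by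
  simp only [period, mul_assoc, integral_const_mul]

lemma period_add {n : ℕ} {x : ℕ → ℝ} (hx : IsChamber n x) {k : ℕ} (hk : 1 ≤ k)
    (hkn : k + 1 ≤ 2 * n) {g h : ℝ → ℝ} (hg : ContinuousOn g (Set.Icc (x k) (x (k + 1))))
    (hh : ContinuousOn h (Set.Icc (x k) (x (k + 1)))) :
    period n x k (fun u => g u + h u) = period n x k g + period n x k h := by
  simp only [period, add_mul]
  exact integral_add (period_integrableOn hx hk hkn hg) (period_integrableOn hx hk hkn hh)

lemma cauchy_kernel_integrable {n : ℕ} {x : ℕ → ℝ} (hx : IsChamber (n + 1) x) {k : ℕ}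
    (hk : 1 ≤ k) (hkn : k + 1 ≤ 2 * n) {g : ℝ → ℝ}
    (hg : ContinuousOn g (Set.Icc (x k) (x (k + 1)))) :
    Integrable (fun z : ℝ × ℝ => (g z.1 * (1 / (z.2 - z.1))) * (sqrtWeight n x z.1 *
        (absInvSqrt (z.2 - x (2 * n + 1)) * absInvSqrt (z.2 - x (2 * n + 2)))))
      ((volume.restrict (Set.Ioo (x k) (x (k + 1)))).prod
        (volume.restrict (Set.Ioo (x (2 * n + 1)) (x (2 * n + 2))))) := by
  have hpq := hx (2 * n + 1) (2 * n + 2) (by omega) (by omega) (by omega)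
  have hkp := hx (k + 1) (2 * n + 1) (by omega) (by omega) (by omega)
  have h1 := (sqrtWeight_integrableOn hx.of_succ hk hkn).integrable.mul_prod
    (arcsine_density_integrableOn hpq).integrable
  rw [Measure.prod_restrict] at h1 ⊢
  refine IntegrableOn.mono_set (t := Set.Icc (x k) (x (k + 1)) ×ˢ
    Set.Icc (x (2 * n + 1)) (x (2 * n + 2))) ?_
    (Set.prod_mono Set.Ioo_subset_Icc_self Set.Ioo_subset_Icc_self)
  refine IntegrableOn.continuousOn_mul ?_ h1 (isCompact_Icc.prod isCompact_Icc)
  refine ContinuousOn.mul (hg.comp continuousOn_fst fun z hz => hz.1) ?_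
  refine ContinuousOn.div (by fun_prop) (by fun_prop) fun z hz => ?_
  have := hz.1.2
  have := hz.2.1
  intro h0
  linarith

lemma period_kernel_integrableOn {n : ℕ} {x : ℕ → ℝ} (hx : IsChamber (n + 1) x) {k : ℕ}
    (hk : 1 ≤ k) (hkn : k + 1 ≤ 2 * n) {g : ℝ → ℝ}
    (hg : ContinuousOn g (Set.Icc (x k) (x (k + 1)))) :
    IntegrableOn (fun y => (absInvSqrt (y - x (2 * n + 1)) * absInvSqrt (y - x (2 * n + 2))) *
      period n x k (fun v => g v * (1 / (y - v))))
      (Set.Ioo (x (2 * n + 1)) (x (2 * n + 2))) := by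
  refine (cauchy_kernel_integrable hx hk hkn hg).integral_prod_right.congr
    (Filter.Eventually.of_forall fun y => ?_)
  simp only [period]
  rw [← integral_const_mul]
  congr 1
  ext v
  ring

lemma period_succ {n : ℕ} {x : ℕ → ℝ} (hx : IsChamber (n + 1) x) {k : ℕ}
    (hk : 1 ≤ k) (hkn : k + 1 ≤ 2 * n) {g : ℝ → ℝ}
    (hg : ContinuousOn g (Set.Icc (x k) (x (k + 1)))) :
    Real.pi * period (n + 1) x k g = ∫ y in Set.Ioo (x (2 * n + 1)) (x (2 * n + 2)),
      (absInvSqrt (y - x (2 * n + 1)) * absInvSqrt (y - x (2 * n + 2))) *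
      period n x k (fun v => g v * (1 / (y - v))) := by
  have hpq := hx (2 * n + 1) (2 * n + 2) (by omega) (by omega) (by omega)
  have hkp := hx (k + 1) (2 * n + 1) (by omega) (by omega) (by omega)
  have hswap := integral_integral_swap (f := fun v y => (g v * (1 / (y - v))) *
    (sqrtWeight n x v * (absInvSqrt (y - x (2 * n + 1)) * absInvSqrt (y - x (2 * n + 2)))))
    (cauchy_kernel_integrable hx hk hkn hg)
  have hr : ∀ y, (absInvSqrt (y - x (2 * n + 1)) * absInvSqrt (y - x (2 * n + 2))) *
      period n x k (fun v => g v * (1 / (y - v))) =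
      ∫ v in Set.Ioo (x k) (x (k + 1)), (g v * (1 / (y - v))) *
    (sqrtWeight n x v * (absInvSqrt (y - x (2 * n + 1)) * absInvSqrt (y - x (2 * n + 2)))) := by
    intro y
    simp only [period]
    rw [← integral_const_mul]
    congr 1
    ext v
    ring
  simp only [hr]
  rw [← hswap, period, ← integral_const_mul]
  refine setIntegral_congr_fun measurableSet_Ioo fun v hv => ?_
  have hv2 := hv.2
  have h := arcsine_integral (c := 1) (d := -v) hpq (by linarith) (by linarith)
  have e : ∀ y, g v * (1 / (y - v)) * (sqrtWeight n x v *
      (absInvSqrt (y - x (2 * n + 1)) * absInvSqrt (y - x (2 * n + 2)))) =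
      g v * sqrtWeight n x v * (1 / (1 * y + -v) *
      (absInvSqrt (y - x (2 * n + 1)) * absInvSqrt (y - x (2 * n + 2)))) := by
    intro y
    rw [show 1 * y + -v = y - v by ring]
    ring
  simp only [e]
  rw [integral_const_mul, h, sqrtWeight_succ, absInvSqrt_sub_comm v, absInvSqrt_sub_comm v,
    one_mul, one_mul, ← sub_eq_add_neg, ← sub_eq_add_neg]
  ring

lemma oddPeriod_succ {n : ℕ} {x : ℕ → ℝ} (hx : IsChamber (n + 1) x) {g : ℝ → ℝ}
    (hg : ContinuousOn g (Set.Icc (x 1) (x (2 * n + 2))))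
    (hker : ∀ y ∈ Set.Ioo (x (2 * n + 1)) (x (2 * n + 2)),
      oddPeriod n x (fun v => 1 / (y - v)) = -(Real.pi * (-1) ^ n * sqrtWeight n x y)) :
    Real.pi * oddPeriod (n + 1) x g = ∫ y in Set.Ioo (x (2 * n + 1)) (x (2 * n + 2)),
      (absInvSqrt (y - x (2 * n + 1)) * absInvSqrt (y - x (2 * n + 2))) *
      oddPeriod n x (fun v => (g v - g y) * (1 / (y - v))) := by
  have hgk : ∀ k, 1 ≤ k → k + 1 ≤ 2 * n + 2 → ContinuousOn g (Set.Icc (x k) (x (k + 1))) :=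
    fun k h1 h2 => hg.mono (Set.Icc_subset_Icc (hx.le le_rfl h1 (by omega))
      (hx.le (by omega) h2 (by omega)))
  have hR : ∀ y ∈ Set.Ioo (x (2 * n + 1)) (x (2 * n + 2)),
      (absInvSqrt (y - x (2 * n + 1)) * absInvSqrt (y - x (2 * n + 2))) *
        oddPeriod n x (fun v => (g v - g y) * (1 / (y - v))) =
      (∑ j ∈ Finset.range n, (-1) ^ j *
        ((absInvSqrt (y - x (2 * n + 1)) * absInvSqrt (y - x (2 * n + 2))) *
          period n x (2 * j + 1) (fun v => g v * (1 / (y - v))))) +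
        Real.pi * (-1) ^ n * (g y * sqrtWeight (n + 1) x y) := by
    intro y hy
    have h1 : oddPeriod n x (fun v => (g v - g y) * (1 / (y - v))) =
        (∑ j ∈ Finset.range n, (-1) ^ j *
          period n x (2 * j + 1) (fun v => g v * (1 / (y - v)))) -
        g y * oddPeriod n x (fun v => 1 / (y - v)) := by
      simp only [oddPeriod, Finset.mul_sum, ← Finset.sum_sub_distrib]
      refine Finset.sum_congr rfl fun j hj => ?_
      have hj' := Finset.mem_range.mp hj
      have hc : ContinuousOn (fun v => 1 / (y - v)) (Set.Icc (x (2 * j + 1)) (x (2 * j + 1 + 1))) := by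
        refine ContinuousOn.div (by fun_prop) (by fun_prop) fun v hv => ?_
        have := hv.2
        have := hy.1
        have := hx (2 * j + 1 + 1) (2 * n + 1) (by omega) (by omega) (by omega)
        intro h0
        linarith
      have h2 := period_add (g := fun v => g v * (1 / (y - v)))
        (h := fun v => -g y * (1 / (y - v))) hx.of_succ (k := 2 * j + 1) (by omega) (by omega)
        ((hgk (2 * j + 1) (by omega) (by omega)).mul hc) (continuousOn_const.mul hc)
      rw [period_const_mul] at h2
      have h3 : (fun v => (g v - g y) * (1 / (y - v))) =
        fun v => g v * (1 / (y - v)) + -g y * (1 / (y - v)) := by ext v; ring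
      rw [h3, h2]
      ring
    rw [h1, hker y hy, sqrtWeight_succ, mul_sub, Finset.mul_sum, sub_eq_add_neg]
    congr 1
    · exact Finset.sum_congr rfl fun j _ => by ring
    · ring
  rw [setIntegral_congr_fun measurableSet_Ioo hR, integral_add, integral_finsetSum,
    integral_const_mul, oddPeriod, Finset.sum_range_succ, mul_add, Finset.mul_sum]
  · congr 1
    · refine Finset.sum_congr rfl fun j hj => ?_
      have hj' := Finset.mem_range.mp hj
      rw [integral_const_mul, ← period_succ hx (by omega) (by omega)
        (hgk (2 * j + 1) (by omega) (by omega))]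
      ring
    · rw [period]; ring
  · intro j hj
    have hj' := Finset.mem_range.mp hj
    exact (period_kernel_integrableOn hx (by omega) (by omega)
        (hgk (2 * j + 1) (by omega) (by omega))).const_mul _
  · refine integrable_finsetSum _ fun j hj => ?_
    have hj' := Finset.mem_range.mp hj
    exact (period_kernel_integrableOn hx (by omega) (by omega)
        (hgk (2 * j + 1) (by omega) (by omega))).const_mul _
  · exact (period_integrableOn hx (k := 2 * n + 1) (by omega) (by omega)
      (hgk _ (by omega) (by omega))).const_mul _

lemma oddPeriod_congr {n : ℕ} {x : ℕ → ℝ} (hx : IsChamber n x) {g h : ℝ → ℝ}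
    (hgh : ∀ u ∈ Set.Ioo (x 1) (x (2 * n)), g u = h u) : oddPeriod n x g = oddPeriod n x h := by
  refine Finset.sum_congr rfl fun j hj => ?_
  have hj' := Finset.mem_range.mp hj
  rw [period_congr fun u hu => hgh u ⟨(hx.le le_rfl (by omega) (by omega)).trans_lt hu.1,
    hu.2.trans_le (hx.le (by omega) (by omega) le_rfl)⟩]

lemma oddPeriod_const_mul (n : ℕ) (x : ℕ → ℝ) (r : ℝ) (g : ℝ → ℝ) :
    oddPeriod n x (fun u => r * g u) = r * oddPeriod n x g := by
  simp only [oddPeriod, period_const_mul, Finset.mul_sum]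
  exact Finset.sum_congr rfl fun j _ => by ring

lemma oddPeriod_sum {n : ℕ} {x : ℕ → ℝ} (hx : IsChamber n x) (s : Finset ℕ) (r : ℕ → ℝ)
    {f : ℕ → ℝ → ℝ} (hf : ∀ i, Continuous (f i)) :
    oddPeriod n x (fun u => ∑ i ∈ s, r i * f i u) = ∑ i ∈ s, r i * oddPeriod n x (f i) := by
  simp only [oddPeriod, Finset.mul_sum]
  rw [Finset.sum_comm]
  refine Finset.sum_congr rfl fun j hj => ?_
  have hj' := Finset.mem_range.mp hj
  have : period n x (2 * j + 1) (fun u => ∑ i ∈ s, r i * f i u) =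
      ∑ i ∈ s, r i * period n x (2 * j + 1) (f i) := by
    simp only [period, Finset.sum_mul]
    rw [integral_finsetSum]
    · simp only [mul_assoc, integral_const_mul]
    · intro i _
      exact period_integrableOn hx (by omega) (by omega)
        ((continuous_const.mul (hf i)).continuousOn)
  rw [this, Finset.mul_sum]
  exact Finset.sum_congr rfl fun i _ => by ring

theorem oddPeriod_inv_affine (n : ℕ) {x : ℕ → ℝ} (hx : IsChamber (n + 1) x) {c d : ℝ}
    (h1 : 0 < c * x 1 + d) (h2 : 0 < c * x (2 * n + 2) + d) :
    oddPeriod (n + 1) x (fun v => 1 / (c * v + d)) =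
      Real.pi * c ^ n * ∏ i ∈ Finset.Icc 1 (2 * (n + 1)), absInvSqrt (c * x i + d) := by
  induction n generalizing c d with
  | zero =>
    have h := arcsine_integral (hx 1 2 le_rfl (by norm_num) le_rfl) h1 h2
    have hI : Finset.Icc 1 (2 * (0 + 1)) = {1, 2} := rfl
    rw [hI, Finset.prod_pair (by norm_num), pow_zero, mul_one, ← h]
    simp only [oddPeriod, period, sqrtWeight]
    simp [hI]
  | succ n ih =>
    have hpos : ∀ i, 1 ≤ i → i ≤ 2 * n + 4 → 0 < c * x i + d := fun i hi hi2 =>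
      affine_pos h1 h2 ⟨hx.le le_rfl hi (by omega), hx.le hi hi2 (by omega)⟩
    have hker : ∀ y ∈ Set.Ioo (x (2 * (n + 1) + 1)) (x (2 * (n + 1) + 2)),
        oddPeriod (n + 1) x (fun v => 1 / (y - v)) =
          -(Real.pi * (-1) ^ (n + 1) * sqrtWeight (n + 1) x y) := by
      intro y hy
      have hy1 := hy.1
      have ha := hx 1 (2 * (n + 1) + 1) (by omega) (by omega) (by omega)
      have hb := hx (2 * n + 2) (2 * (n + 1) + 1) (by omega) (by omega) (by omega)
      have h := ih hx.of_succ (c := -1) (d := y) (by linarith) (by linarith)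
      have e : ∀ v, -1 * v + y = y - v := fun v => by ring
      simp only [e] at h
      rw [h, sqrtWeight]
      ring
    have hc : ContinuousOn (fun v => 1 / (c * v + d)) (Set.Icc (x 1) (x (2 * (n + 1) + 2))) :=
      ContinuousOn.div (by fun_prop) (by fun_prop) fun v hv => (affine_pos h1 h2 hv).ne'
    have hs := oddPeriod_succ hx hc hker
    have hin : ∀ y ∈ Set.Ioo (x (2 * (n + 1) + 1)) (x (2 * (n + 1) + 2)),
        (absInvSqrt (y - x (2 * (n + 1) + 1)) * absInvSqrt (y - x (2 * (n + 1) + 2))) *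
          oddPeriod (n + 1) x (fun v => (1 / (c * v + d) - 1 / (c * y + d)) * (1 / (y - v))) =
        (c * (Real.pi * c ^ n * ∏ i ∈ Finset.Icc 1 (2 * (n + 1)), absInvSqrt (c * x i + d))) *
          (1 / (c * y + d) * (absInvSqrt (y - x (2 * (n + 1) + 1)) *
            absInvSqrt (y - x (2 * (n + 1) + 2)))) := by
      intro y hy
      have hLy := affine_pos (hpos (2 * (n + 1) + 1) (by omega) (by omega))
        (hpos (2 * (n + 1) + 2) (by omega) (by omega)) ⟨hy.1.le, hy.2.le⟩
      have hcg : oddPeriod (n + 1) x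
          (fun v => (1 / (c * v + d) - 1 / (c * y + d)) * (1 / (y - v))) =
          oddPeriod (n + 1) x (fun v => (c * (1 / (c * y + d))) * (1 / (c * v + d))) := by
        refine oddPeriod_congr hx.of_succ fun v hv => ?_
        have hLv := affine_pos h1 (hpos (2 * (n + 1)) (by omega) (by omega)) ⟨hv.1.le, hv.2.le⟩
        have hyv : y - v ≠ 0 := by
          have := hx (2 * (n + 1)) (2 * (n + 1) + 1) (by omega) (by omega) (by omega)
          have := hy.1
          have := hv.2
          intro h0
          linarith
        field_simp
        ring
      rw [hcg, oddPeriod_const_mul, ih hx.of_succ h1 (hpos (2 * n + 2) (by omega) (by omega))]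
      ring
    rw [setIntegral_congr_fun measurableSet_Ioo hin, integral_const_mul,
      arcsine_integral (hx _ _ (by omega) (by omega) (by omega))
        (hpos (2 * (n + 1) + 1) (by omega) (by omega))
        (hpos (2 * (n + 1) + 2) (by omega) (by omega))] at hs
    rw [show 2 * (n + 1 + 1) = 2 * (n + 1) + 1 + 1 by ring,
      Finset.prod_Icc_succ_top (by omega), Finset.prod_Icc_succ_top (by omega)]
    refine mul_left_cancel₀ Real.pi_ne_zero (hs.trans ?_)
    ring

lemma oddPeriod_kernel (n : ℕ) {x : ℕ → ℝ} (hx : IsChamber (n + 1) x) {y : ℝ}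
    (hy : x (2 * n + 2) < y) : oddPeriod (n + 1) x (fun v => 1 / (y - v)) =
      -(Real.pi * (-1) ^ (n + 1) * sqrtWeight (n + 1) x y) := by
  have ha := hx 1 (2 * n + 2) (by omega) (by omega) (by omega)
  have h := oddPeriod_inv_affine n hx (c := -1) (d := y) (by linarith) (by linarith)
  have e : ∀ v, -1 * v + y = y - v := fun v => by ring
  simp only [e] at h
  rw [h, sqrtWeight]
  ring

theorem oddPeriod_pow_affine (n : ℕ) {x : ℕ → ℝ} (hx : IsChamber (n + 1) x) (c d : ℝ) :
    ∀ m ≤ n, oddPeriod (n + 1) x (fun v => (c * v + d) ^ m) =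
      if m = n then Real.pi * (-c) ^ n else 0 := by
  induction n with
  | zero =>
    intro m hm
    obtain rfl : m = 0 := by omega
    have h := arcsine_integral (c := 0) (d := 1) (hx 1 2 le_rfl (by norm_num) le_rfl)
      (by norm_num) (by norm_num)
    have hI : Finset.Icc 1 (2 * (0 + 1)) = {1, 2} := rfl
    simp only [oddPeriod, period, sqrtWeight]
    simpa [hI, Finset.prod_pair, absInvSqrt] using h
  | succ n ih =>
    intro m hm
    have hs := oddPeriod_succ (g := fun v => (c * v + d) ^ m) hx (by fun_prop) fun y hy =>
      oddPeriod_kernel n hx.of_succ ((hx (2 * n + 2) (2 * (n + 1) + 1) (by omega) (by omega)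
        (by omega)).trans hy.1)
    have hin : ∀ y ∈ Set.Ioo (x (2 * (n + 1) + 1)) (x (2 * (n + 1) + 2)),
        (absInvSqrt (y - x (2 * (n + 1) + 1)) * absInvSqrt (y - x (2 * (n + 1) + 2))) *
          oddPeriod (n + 1) x (fun v => ((c * v + d) ^ m - (c * y + d) ^ m) * (1 / (y - v))) =
        (if m = n + 1 then Real.pi * (-c) ^ (n + 1) else 0) *
          (1 / (0 * y + 1) * (absInvSqrt (y - x (2 * (n + 1) + 1)) *
            absInvSqrt (y - x (2 * (n + 1) + 2)))) := by
      intro y hy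
      have hcg : oddPeriod (n + 1) x
          (fun v => ((c * v + d) ^ m - (c * y + d) ^ m) * (1 / (y - v))) =
          oddPeriod (n + 1) x (fun v => ∑ i ∈ Finset.range m,
            (-c * (c * y + d) ^ (m - 1 - i)) * (c * v + d) ^ i) := by
        refine oddPeriod_congr hx.of_succ fun v hv => ?_
        have hyv : y - v ≠ 0 := by
          have := hx (2 * (n + 1)) (2 * (n + 1) + 1) (by omega) (by omega) (by omega)
          have := hy.1
          have := hv.2
          intro h0
          linarith
        have hg := geom_sum₂_mul (c * v + d) (c * y + d) m
        rw [mul_one_div, div_eq_iff hyv, ← hg, Finset.sum_mul, Finset.sum_mul]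
        exact Finset.sum_congr rfl fun i _ => by ring
      have hval : ∑ i ∈ Finset.range m, (-c * (c * y + d) ^ (m - 1 - i)) *
          oddPeriod (n + 1) x (fun v => (c * v + d) ^ i) =
          if m = n + 1 then Real.pi * (-c) ^ (n + 1) else 0 := by
        have : ∀ i ∈ Finset.range m, (-c * (c * y + d) ^ (m - 1 - i)) *
          oddPeriod (n + 1) x (fun v => (c * v + d) ^ i) =
          if i = n then (-c * (c * y + d) ^ (m - 1 - i)) * (Real.pi * (-c) ^ n) else 0 := by
          intro i hi
          have hi' := Finset.mem_range.mp hi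
          rw [ih hx.of_succ i (by omega)]
          split_ifs <;> ring
        rw [Finset.sum_congr rfl this, Finset.sum_ite_eq']
        by_cases hmn : m = n + 1
        · subst hmn
          rw [if_pos (by simp), if_pos rfl, Nat.add_sub_cancel, Nat.sub_self]
          ring
        · rw [if_neg (by simp; omega), if_neg hmn]
      rw [hcg, oddPeriod_sum (f := fun i v => (c * v + d) ^ i) hx.of_succ _ _
        (fun i => by fun_prop), hval]
      ring
    rw [setIntegral_congr_fun measurableSet_Ioo hin, integral_const_mul,
      arcsine_integral (hx _ _ (by omega) (by omega) (by omega)) (by norm_num) (by norm_num)] at hs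
    refine mul_left_cancel₀ Real.pi_ne_zero (hs.trans ?_)
    simp [absInvSqrt, mul_comm]

theorem cauchy_binet {R α : Type*} [CommRing R] [LinearOrder α] {n : ℕ} (s : Finset α)
    (B : Fin n → α → R) (M : α → Fin n → R) :
    (Matrix.of fun r j => ∑ κ ∈ s, B r κ * M κ j).det =
      ∑ k ∈ (Fintype.piFinset fun _ : Fin n => s).filter
          fun k => ∀ r t : Fin n, r < t → k r < k t,
        (∑ σ : Equiv.Perm (Fin n), ((Equiv.Perm.sign σ : ℤ) : R) * ∏ r, B r (k (σ r))) *
          (Matrix.of fun r j => M (k r) j).det := by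
  classical
  have hrow : (Matrix.of fun r j => ∑ κ ∈ s, B r κ * M κ j).det =
      ∑ f ∈ Fintype.piFinset fun _ : Fin n => s,
        (∏ r, B r (f r)) * (Matrix.of fun r j => M (f r) j).det := by
    have h := (Matrix.detRowAlternating (n := Fin n) (R := R)).toMultilinearMap.map_sum_finset
      (fun r κ => B r κ • M κ) (fun _ => s)
    have e : (Matrix.of fun r j => ∑ κ ∈ s, B r κ * M κ j) =
        fun r => ∑ κ ∈ s, B r κ • M κ := by
      ext r j
      simp [Finset.sum_apply]
    rw [e]
    refine h.trans (Finset.sum_congr rfl fun f _ => ?_)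
    exact Matrix.det_mul_column _ _
  have hinj : ∑ f ∈ Fintype.piFinset fun _ : Fin n => s,
        (∏ r, B r (f r)) * (Matrix.of fun r j => M (f r) j).det =
      ∑ f ∈ (Fintype.piFinset fun _ : Fin n => s).filter Function.Injective,
        (∏ r, B r (f r)) * (Matrix.of fun r j => M (f r) j).det := by
    refine (Finset.sum_subset (Finset.filter_subset _ _) fun f hf hf' => ?_).symm
    have hni : ¬ Function.Injective f := fun h => hf' (Finset.mem_filter.mpr ⟨hf, h⟩)
    simp only [Function.Injective, not_forall] at hni
    obtain ⟨r, t, hrt, hne⟩ := hni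
    rw [Matrix.det_zero_of_row_eq hne, mul_zero]
    ext j
    simp [hrt]
  rw [hrow, hinj]
  have hsum : ∀ k : Fin n → α,
      (∑ σ : Equiv.Perm (Fin n), ((Equiv.Perm.sign σ : ℤ) : R) * ∏ r, B r (k (σ r))) *
          (Matrix.of fun r j => M (k r) j).det =
      ∑ σ : Equiv.Perm (Fin n), (∏ r, B r (k (σ r))) *
        (Matrix.of fun r j => M (k (σ r)) j).det := by
    intro k
    rw [Finset.sum_mul]
    refine Finset.sum_congr rfl fun σ _ => ?_
    have := Matrix.det_permute σ (Matrix.of fun r j => M (k r) j)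
    rw [show (Matrix.of fun r j => M (k (σ r)) j) =
      (Matrix.of fun r j => M (k r) j).submatrix σ id from rfl, this]
    ring
  rw [Finset.sum_congr rfl fun k _ => hsum k, ← Finset.sum_product']
  symm
  refine Finset.sum_bij' (fun p _ => p.1 ∘ p.2)
    (fun f _ => (f ∘ Tuple.sort f, (Tuple.sort f)⁻¹)) ?_ ?_ ?_ ?_ ?_
  · intro p hp
    simp only [Finset.mem_product, Finset.mem_filter, Fintype.mem_piFinset] at hp ⊢
    have hm : StrictMono p.1 := fun r t h => hp.1.2 r t h
    exact ⟨fun r => hp.1.1 _, hm.injective.comp p.2.injective⟩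
  · intro f hf
    simp only [Finset.mem_product, Finset.mem_filter, Fintype.mem_piFinset] at hf ⊢
    have hm : StrictMono (f ∘ Tuple.sort f) :=
      (Tuple.monotone_sort f).strictMono_of_injective (hf.2.comp (Tuple.sort f).injective)
    exact ⟨⟨fun r => hf.1 _, fun r t h => hm h⟩, Finset.mem_univ _⟩
  · intro p hp
    simp only [Finset.mem_product, Finset.mem_filter, Fintype.mem_piFinset] at hp
    have hm : StrictMono p.1 := fun r t h => hp.1.2 r t h
    have hs : Tuple.sort (p.1 ∘ p.2) = p.2⁻¹ := by
      symm
      rw [Tuple.eq_sort_iff]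
      refine ⟨?_, fun i j hij h => ?_⟩
      · have : (p.1 ∘ p.2) ∘ ⇑p.2⁻¹ = p.1 := by ext; simp
        rw [this]
        exact hm.monotone
      · exact absurd (p.2⁻¹.injective (p.2.injective (hm.injective h))) hij.ne
    ext1
    · ext; simp [hs]
    · simp [hs]
  · intro f hf
    ext; simp
  · intro p hp
    rfl

lemma LinkPattern.mem_Icc_a {N : ℕ} (β : LinkPattern N) (r : Fin N) :
    1 ≤ β.a r ∧ β.a r ≤ 2 * N := (β.cover _).mp ⟨(r, false), by simp⟩

lemma LinkPattern.mem_Icc_b {N : ℕ} (β : LinkPattern N) (r : Fin N) :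
    1 ≤ β.b r ∧ β.b r ≤ 2 * N := (β.cover _).mp ⟨(r, true), by simp⟩

lemma LinkPattern.a_injective {N : ℕ} (β : LinkPattern N) : Function.Injective β.a :=
  β.a_mono.injective

lemma LinkPattern.b_injective {N : ℕ} (β : LinkPattern N) : Function.Injective β.b := by
  intro r s h
  have := @β.inj (r, true) (s, true) (by simpa using h)
  simpa using this

lemma LinkPattern.a_ne_b {N : ℕ} (β : LinkPattern N) (r s : Fin N) : β.a r ≠ β.b s := by
  intro h
  have := @β.inj (r, false) (s, true) (by simpa using h)
  simp at this

/-- The endpoints of a link have opposite parities. -/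
lemma LinkPattern.parity {N : ℕ} (β : LinkPattern N) (r : Fin N) :
    (-1 : ℤ) ^ β.b r = -(-1) ^ β.a r := by
  classical
  set S := Finset.univ.filter fun s => β.a r < β.a s ∧ β.a s < β.b r with hS
  have hunion : Finset.Ioo (β.a r) (β.b r) = S.image β.a ∪ S.image β.b := by
    ext m
    simp only [Finset.mem_Ioo, Finset.mem_union, Finset.mem_image, hS, Finset.mem_filter,
      Finset.mem_univ, true_and]
    constructor
    · intro hm
      have h1 := β.mem_Icc_a r
      have h2 := β.mem_Icc_b r
      obtain ⟨⟨s, c⟩, hs⟩ := (β.cover m).mpr ⟨by omega, by omega⟩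
      cases c
      · simp only [Bool.false_eq_true, if_false] at hs
        exact Or.inl ⟨s, by omega, hs⟩
      · simp only [if_true] at hs
        refine Or.inr ⟨s, ?_, hs⟩
        have h3 := β.noncross s r
        have h4 := β.a_lt_b s
        have h5 : β.a s ≠ β.a r := by
          intro h
          have := β.a_injective h
          subst this
          omega
        omega
    · rintro (⟨s, hs, rfl⟩ | ⟨s, hs, rfl⟩)
      · exact hs
      · have h3 := β.noncross r s
        have h4 := β.a_lt_b s
        have h5 : β.b s ≠ β.b r := by
          intro h
          have := β.b_injective h
          subst this
          omega
        omega
  have hdisj : Disjoint (S.image β.a) (S.image β.b) := by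
    rw [Finset.disjoint_left]
    intro m h1 h2
    obtain ⟨s, -, hs⟩ := Finset.mem_image.mp h1
    obtain ⟨t, -, ht⟩ := Finset.mem_image.mp h2
    exact β.a_ne_b s t (hs.trans ht.symm)
  have hcard := congrArg Finset.card hunion
  rw [Finset.card_union_of_disjoint hdisj, Finset.card_image_of_injective _ β.a_injective,
    Finset.card_image_of_injective _ β.b_injective, Nat.card_Ioo] at hcard
  have hlt := β.a_lt_b r
  have : β.b r = β.a r + 1 + 2 * S.card := by omega
  rw [this, pow_add, pow_succ, pow_mul]
  simp

lemma sum_alternating_Icc (m : ℕ) :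
    ∑ i ∈ Finset.Icc 1 m, (-1 : ℤ) ^ (i + 1) = if Odd m then 1 else 0 := by
  induction m with
  | zero => simp
  | succ m ih =>
    rw [Finset.sum_Icc_succ_top (by omega), ih]
    rcases Nat.even_or_odd m with h | h
    · rw [if_neg (Nat.not_odd_iff_even.mpr h), if_pos h.add_one, pow_succ, pow_succ, h.neg_one_pow]
      norm_num
    · rw [if_pos h, if_neg (Nat.not_odd_iff_even.mpr h.add_one), pow_succ, pow_succ,
        h.neg_one_pow]
      norm_num

/-- Summed with alternating signs, the links of a pattern cover exactly the odd intervals. -/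
lemma LinkPattern.sum_signed_cover {N : ℕ} (β : LinkPattern N) {κ : ℕ} (hκ : κ ≤ 2 * N) :
    ∑ r, (if β.a r ≤ κ ∧ κ < β.b r then (-1 : ℤ) ^ (β.a r + 1) else 0) =
      if Odd κ then 1 else 0 := by
  classical
  rw [← sum_alternating_Icc]
  have h1 : Finset.Icc 1 κ = (Finset.univ.image
      (fun p : Fin N × Bool => if p.2 then β.b p.1 else β.a p.1)).filter (· ≤ κ) := by
    ext m
    have h := β.cover m
    simp only [Finset.mem_filter, Finset.mem_image, Finset.mem_univ, true_and, h, Finset.mem_Icc]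
    omega
  rw [h1, Finset.sum_filter, Finset.sum_image fun _ _ _ _ h => β.inj h, Fintype.sum_prod_type]
  refine Finset.sum_congr rfl fun r _ => ?_
  have hlt := β.a_lt_b r
  have hp := β.parity r
  simp only [Fintype.sum_bool, if_true, Bool.false_eq_true, if_false, pow_succ, hp]
  split_ifs <;> omega

/-- The phase with which the `κ`-th interval contributes to the `r`-th link. -/
noncomputable def linkPhase {N : ℕ} (β : LinkPattern N) (r : Fin N) (κ : ℕ) : ℂ :=
  if β.a r ≤ κ ∧ κ < β.b r then Complex.I ^ ((κ : ℤ) - β.a r) else 0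

lemma linkCoeff_eq {N : ℕ} (β : LinkPattern N) (k : Fin N → ℕ) : linkCoeff N β k =
    ∑ σ : Equiv.Perm (Fin N), ((Equiv.Perm.sign σ : ℤ) : ℂ) * ∏ r, linkPhase β r (k (σ r)) := by
  have hz : ∀ (s : Finset (Fin N)) (f : Fin N → ℤ),
      Complex.I ^ (∑ r ∈ s, f r) = ∏ r ∈ s, Complex.I ^ f r := by
    intro s f
    induction s using Finset.cons_induction with
    | empty => simp
    | cons r s hr ih => rw [Finset.sum_cons, Finset.prod_cons, zpow_add₀ Complex.I_ne_zero, ih]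
  rw [linkCoeff, Finset.mul_sum]
  refine Finset.sum_congr rfl fun σ _ => ?_
  rw [← Equiv.sum_comp σ fun r => (k r : ℤ), ← Finset.sum_sub_distrib, hz, mul_left_comm,
    ← Finset.prod_mul_distrib]
  congr 1
  refine Finset.prod_congr rfl fun r _ => ?_
  rw [linkPhase]
  split_ifs <;> simp

/-- The determinant of the periods of the functions `g j` over the intervals `k r`. -/
noncomputable def periodDet {N : ℕ} (x : ℕ → ℝ) (k : Fin N → ℕ) (g : Fin N → ℝ → ℝ) : ℝ :=
  (Matrix.of fun r j => period N x (k r) (g j)).det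

/-- The period of `g` along the link `r` of `β`. -/
noncomputable def linkPeriod {N : ℕ} (β : LinkPattern N) (x : ℕ → ℝ) (r : Fin N)
    (g : ℝ → ℝ) : ℂ :=
  ∑ κ ∈ Finset.Icc 1 (2 * N - 1), linkPhase β r κ * (period N x κ g : ℂ)

lemma sum_linkCoeff_periodDet {N : ℕ} (β : LinkPattern N) (x : ℕ → ℝ) (g : Fin N → ℝ → ℝ) :
    ∑ k ∈ (Fintype.piFinset fun _ : Fin N => Finset.Icc 1 (2 * N - 1)).filter
      (fun k => ∀ r s : Fin N, r < s → k r < k s), linkCoeff N β k * (periodDet x k g : ℂ) =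
    (Matrix.of fun r j => linkPeriod β x r (g j)).det := by
  rw [show (Matrix.of fun r j => linkPeriod β x r (g j)) = Matrix.of fun r j =>
    ∑ κ ∈ Finset.Icc 1 (2 * N - 1), linkPhase β r κ * (period N x κ (g j) : ℂ) from rfl,
    cauchy_binet]
  refine Finset.sum_congr rfl fun k _ => ?_
  rw [linkCoeff_eq, periodDet]
  congr 1
  exact (Complex.ofRealHom.map_det _)

lemma sum_signed_linkPeriod {N : ℕ} (β : LinkPattern N) (x : ℕ → ℝ) (g : ℝ → ℝ) :
    ∑ r, ((-1) ^ (β.a r + 1) * Complex.I ^ β.a r) * linkPeriod β x r g =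
      Complex.I * (oddPeriod N x g : ℂ) := by
  have h1 : ∑ r, ((-1) ^ (β.a r + 1) * Complex.I ^ β.a r) * linkPeriod β x r g =
      ∑ κ ∈ Finset.Icc 1 (2 * N - 1),
        if Odd κ then Complex.I ^ κ * (period N x κ g : ℂ) else 0 := by
    simp only [linkPeriod, Finset.mul_sum]
    rw [Finset.sum_comm]
    refine Finset.sum_congr rfl fun κ hκ => ?_
    have hκ' := Finset.mem_Icc.mp hκ
    have hc := congrArg (Int.cast : ℤ → ℂ) (β.sum_signed_cover (κ := κ) (by omega))
    have : ∀ r, ((-1) ^ (β.a r + 1) * Complex.I ^ β.a r) *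
        (linkPhase β r κ * (period N x κ g : ℂ)) =
        (((if β.a r ≤ κ ∧ κ < β.b r then (-1 : ℤ) ^ (β.a r + 1) else 0 : ℤ)) : ℂ) *
          (Complex.I ^ κ * (period N x κ g : ℂ)) := by
      intro r
      rw [linkPhase]
      split_ifs with h
      · have e : Complex.I ^ β.a r * Complex.I ^ ((κ : ℤ) - β.a r) = Complex.I ^ κ := by
          rw [← zpow_natCast, ← zpow_add₀ Complex.I_ne_zero, add_sub_cancel, zpow_natCast]
        rw [← e]
        push_cast
        ring
      · simp
    rw [Finset.sum_congr rfl fun r _ => this r, ← Finset.sum_mul, ← Int.cast_sum, hc]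
    split_ifs <;> simp
  rw [h1, ← Finset.sum_filter, oddPeriod]
  push_cast
  rw [Finset.mul_sum]
  symm
  refine Finset.sum_bij (fun j _ => 2 * j + 1) ?_ ?_ ?_ ?_
  · intro j hj
    have := Finset.mem_range.mp hj
    simp only [Finset.mem_filter, Finset.mem_Icc]
    exact ⟨by omega, ⟨j, rfl⟩⟩
  · intro i _ j _ h
    omega
  · intro κ hκ
    simp only [Finset.mem_filter, Finset.mem_Icc] at hκ
    obtain ⟨h, j, rfl⟩ := hκ
    exact ⟨j, Finset.mem_range.mpr (by omega), rfl⟩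
  · intro j _
    rw [pow_succ, pow_mul, Complex.I_sq]
    ring

/-- Andréief's identity for the periods. -/
lemma periodDet_eq_integral {N : ℕ} {x : ℕ → ℝ} (hx : IsChamber N x) {k : Fin N → ℕ}
    (hk : ∀ r, k r ∈ Finset.Icc 1 (2 * N - 1)) {g : Fin N → ℝ → ℝ}
    (hg : ∀ j, ContinuousOn (g j) (Set.Icc (x 1) (x (2 * N)))) :
    periodDet x k g = ∫ u : Fin N → ℝ in Set.univ.pi fun r => Set.Ioo (x (k r)) (x (k r + 1)),
      (Matrix.of fun r j => g j (u r)).det * ∏ r, sqrtWeight N x (u r) := by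
  have hgw : ∀ r j, IntegrableOn (fun t => g j t * sqrtWeight N x t)
      (Set.Ioo (x (k r)) (x (k r + 1))) := by
    intro r j
    have h := Finset.mem_Icc.mp (hk r)
    exact period_integrableOn hx h.1 (by omega) ((hg j).mono
      (Set.Icc_subset_Icc (hx.le le_rfl h.1 (by omega)) (hx.le (by omega) (by omega) le_rfl)))
  have hpt : ∀ u : Fin N → ℝ, (Matrix.of fun r j => g j (u r)).det *
      ∏ r, sqrtWeight N x (u r) = ∑ σ : Equiv.Perm (Fin N), ((Equiv.Perm.sign σ : ℤ) : ℝ) *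
        ∏ r, (g (σ r) (u r) * sqrtWeight N x (u r)) := by
    intro u
    rw [← Matrix.det_transpose, Matrix.det_apply', Finset.sum_mul]
    refine Finset.sum_congr rfl fun σ _ => ?_
    rw [Finset.prod_mul_distrib, ← mul_assoc]
    rfl
  simp only [hpt]
  rw [volume_pi, Measure.restrict_pi_pi, integral_finsetSum]
  · rw [periodDet, ← Matrix.det_transpose, Matrix.det_apply']
    refine Finset.sum_congr rfl fun σ _ => ?_
    rw [integral_const_mul, integral_fintype_prod_eq_prod
      (f := fun r t => g (σ r) t * sqrtWeight N x t)]
    rfl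
  · intro σ _
    exact (Integrable.fintype_prod (f := fun r t => g (σ r) t * sqrtWeight N x t)
      fun r => hgw r (σ r)).const_mul _

lemma periodDet_eq_const_mul {N : ℕ} {x : ℕ → ℝ} (hx : IsChamber N x) {k : Fin N → ℕ}
    (hk : ∀ r, k r ∈ Finset.Icc 1 (2 * N - 1)) {g h : Fin N → ℝ → ℝ}
    (hg : ∀ j, ContinuousOn (g j) (Set.Icc (x 1) (x (2 * N))))
    (hh : ∀ j, ContinuousOn (h j) (Set.Icc (x 1) (x (2 * N)))) {C : ℝ}
    (hgh : ∀ u : Fin N → ℝ, (∀ r, u r ∈ Set.Icc (x 1) (x (2 * N))) →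
      (Matrix.of fun r j => g j (u r)).det = C * (Matrix.of fun r j => h j (u r)).det) :
    periodDet x k g = C * periodDet x k h := by
  rw [periodDet_eq_integral hx hk hg, periodDet_eq_integral hx hk hh, ← integral_const_mul]
  refine setIntegral_congr_fun (MeasurableSet.univ_pi fun r => measurableSet_Ioo) fun u hu => ?_
  rw [hgh u, mul_assoc]
  intro r
  have h1 := Finset.mem_Icc.mp (hk r)
  have h2 := hu r (Set.mem_univ r)
  exact ⟨(hx.le le_rfl h1.1 (by omega)).trans h2.1.le,
    h2.2.le.trans (hx.le (by omega) (by omega) le_rfl)⟩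

/-- Two matrices whose columns agree up to a cyclic shift except for one, and which have a
common row relation on the shared columns, have proportional determinants. -/
lemma det_eq_of_shifted_columns {K : Type*} [Field K] {n : ℕ}
    {A B : Matrix (Fin (n + 1)) (Fin (n + 1)) K} {e : Fin (n + 1) → K} (he : e ≠ 0) {μ : K}
    (hAB : ∀ r (j : Fin n), A r j.succ = B r j.castSucc)
    (hB : ∀ j : Fin n, ∑ r, e r * B r j.castSucc = 0)
    (hμ : ∑ r, e r * A r 0 = μ * ∑ r, e r * B r (Fin.last n)) :
    A.det = μ * ((-1) ^ n * B.det) := by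
  set C := B.submatrix id (finRotate (n + 1)).symm with hC
  have hC0 : ∀ r, C r 0 = B r (Fin.last n) := by
    intro r
    rw [hC, Matrix.submatrix_apply, (Equiv.symm_apply_eq _).mpr finRotate_last.symm, id]
  have hCs : ∀ r (j : Fin n), C r j.succ = B r j.castSucc := by
    intro r j
    have : finRotate (n + 1) j.castSucc = j.succ := by
      rw [finRotate_apply, Fin.coeSucc_eq_succ]
    rw [hC, Matrix.submatrix_apply, (Equiv.symm_apply_eq _).mpr this.symm, id]
  have hdetC : C.det = (-1) ^ n * B.det := by
    rw [hC, Matrix.det_permute', Equiv.Perm.sign_symm, sign_finRotate]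
    simp
  have hA : A = C.updateCol 0 ((fun r => A r 0 - μ * C r 0) + μ • fun r => C r 0) := by
    ext r j
    refine Fin.cases ?_ (fun j => ?_) j
    · simp
    · rw [Matrix.updateCol_ne (Fin.succ_ne_zero j), hCs, hAB]
  have hzero : (C.updateCol 0 fun r => A r 0 - μ * C r 0).det = 0 := by
    rw [← Matrix.exists_vecMul_eq_zero_iff]
    refine ⟨e, he, ?_⟩
    ext j
    rw [Matrix.vecMul, dotProduct]
    refine Fin.cases ?_ (fun j => ?_) j
    · simp only [Matrix.updateCol_self, mul_sub, Finset.sum_sub_distrib, hμ, hC0, Finset.mul_sum,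
        Pi.zero_apply]
      rw [sub_eq_zero]
      exact Finset.sum_congr rfl fun r _ => by ring
    · simp only [Matrix.updateCol_ne (Fin.succ_ne_zero j), hCs, hB, Pi.zero_apply]
  rw [hA, Matrix.det_updateCol_add, Matrix.det_updateCol_smul, hzero, zero_add, ← hdetC,
    Matrix.updateCol_eq_self]

lemma linkPeriod_congr {N : ℕ} (β : LinkPattern N) {x : ℕ → ℝ} (hx : IsChamber N x)
    (r : Fin N) {g h : ℝ → ℝ} (hgh : ∀ u ∈ Set.Icc (x 1) (x (2 * N)), g u = h u) :
    linkPeriod β x r g = linkPeriod β x r h := by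
  refine Finset.sum_congr rfl fun κ hκ => ?_
  have h1 := Finset.mem_Icc.mp hκ
  rw [period_congr fun u hu => hgh u ⟨(hx.le le_rfl h1.1 (by omega)).trans hu.1.le,
    hu.2.le.trans (hx.le (by omega) (by omega) le_rfl)⟩]

lemma det_linkPeriod_eq_const_mul {N : ℕ} (β : LinkPattern N) {x : ℕ → ℝ} (hx : IsChamber N x)
    {g h : Fin N → ℝ → ℝ}
    (hg : ∀ j, ContinuousOn (g j) (Set.Icc (x 1) (x (2 * N))))
    (hh : ∀ j, ContinuousOn (h j) (Set.Icc (x 1) (x (2 * N)))) {C : ℝ}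
    (hgh : ∀ u : Fin N → ℝ, (∀ r, u r ∈ Set.Icc (x 1) (x (2 * N))) →
      (Matrix.of fun r j => g j (u r)).det = C * (Matrix.of fun r j => h j (u r)).det) :
    (Matrix.of fun r j => linkPeriod β x r (g j)).det =
      C * (Matrix.of fun r j => linkPeriod β x r (h j)).det := by
  rw [← sum_linkCoeff_periodDet, ← sum_linkCoeff_periodDet, Finset.mul_sum]
  refine Finset.sum_congr rfl fun k hk => ?_
  rw [periodDet_eq_const_mul hx (Fintype.mem_piFinset.mp (Finset.mem_filter.mp hk).1) hg hh hgh]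
  push_cast
  ring

lemma det_pow_affine {N : ℕ} (c d : ℝ) (u : Fin N → ℝ) :
    (Matrix.of fun r j : Fin N => (c * u r + d) ^ (j : ℕ)).det =
      (∏ i : Fin N, ∏ _j ∈ Finset.Ioi i, c) *
        (Matrix.of fun r j : Fin N => u r ^ (j : ℕ)).det := by
  have h1 := Matrix.det_vandermonde fun r => c * u r + d
  have h2 := Matrix.det_vandermonde u
  refine h1.trans ?_
  refine Eq.trans ?_ (congrArg _ h2.symm)
  rw [← Finset.prod_mul_distrib]
  refine Finset.prod_congr rfl fun i _ => ?_
  rw [← Finset.prod_mul_distrib]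
  exact Finset.prod_congr rfl fun j _ => by ring

lemma det_linkPeriod_shift {n : ℕ} (β : LinkPattern (n + 1)) {x : ℕ → ℝ}
    (hx : IsChamber (n + 1) x) {c d : ℝ}
    (h1 : 0 < c * x 1 + d) (h2 : 0 < c * x (2 * n + 2) + d) :
    (Matrix.of fun r (j : Fin (n + 1)) =>
        linkPeriod β x r fun v => 1 / (c * v + d) * (c * v + d) ^ (j : ℕ)).det =
      ((∏ i ∈ Finset.Icc 1 (2 * (n + 1)), absInvSqrt (c * x i + d) : ℝ) : ℂ) *
        (Matrix.of fun r (j : Fin (n + 1)) => linkPeriod β x r fun v => (c * v + d) ^ (j : ℕ)).det := by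
  set e : Fin (n + 1) → ℂ := fun r => (-1) ^ (β.a r + 1) * Complex.I ^ β.a r with he
  have he0 : e ≠ 0 := by
    intro h
    have h0 := congrFun h 0
    simp [he, Complex.I_ne_zero] at h0
  have hsum := fun g => sum_signed_linkPeriod β x g
  set P := ∏ i ∈ Finset.Icc 1 (2 * (n + 1)), absInvSqrt (c * x i + d) with hP
  have hpow := oddPeriod_pow_affine n hx c d
  rw [det_eq_of_shifted_columns (μ := (-1) ^ n * (P : ℂ)) he0
    (B := Matrix.of fun r (j : Fin (n + 1)) => linkPeriod β x r fun v => (c * v + d) ^ (j : ℕ))]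
  · have hs : ((-1 : ℂ) ^ n) * (-1) ^ n = 1 := by rw [← mul_pow]; simp
    linear_combination ((P : ℂ) * (Matrix.of fun r (j : Fin (n + 1)) =>
      linkPeriod β x r fun v => (c * v + d) ^ (j : ℕ)).det) * hs
  · intro r j
    refine linkPeriod_congr β hx r fun u hu => ?_
    have hL := affine_pos h1 h2 hu
    rw [Fin.val_succ, Fin.val_castSucc, pow_succ]
    field_simp
  · intro j
    refine (hsum _).trans ?_
    rw [Fin.val_castSucc, hpow j j.isLt.le, if_neg j.isLt.ne]
    simp
  · refine (hsum _).trans (Eq.trans ?_ (congrArg _ (hsum _).symm))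
    rw [Fin.val_last, hpow n le_rfl, if_pos rfl]
    have := oddPeriod_inv_affine n hx h1 h2
    simp only [Fin.val_zero, pow_zero, mul_one, this]
    rw [← hP, neg_pow]
    push_cast
    have hs : ((-1 : ℂ) ^ n) * (-1) ^ n = 1 := by rw [← mul_pow]; simp
    linear_combination -(P : ℂ) * Complex.I * Real.pi * c ^ n * hs

lemma det_linkPeriod_div_affine {n : ℕ} (β : LinkPattern (n + 1)) {x : ℕ → ℝ}
    (hx : IsChamber (n + 1) x) {c d : ℝ}
    (h1 : 0 < c * x 1 + d) (h2 : 0 < c * x (2 * n + 2) + d) :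
    (Matrix.of fun r (j : Fin (n + 1)) =>
        linkPeriod β x r fun v => 1 / (c * v + d) * v ^ (j : ℕ)).det =
      ((∏ i ∈ Finset.Icc 1 (2 * (n + 1)), absInvSqrt (c * x i + d) : ℝ) : ℂ) *
        (Matrix.of fun r (j : Fin (n + 1)) => linkPeriod β x r fun v => v ^ (j : ℕ)).det := by
  have hinv : ContinuousOn (fun v => 1 / (c * v + d)) (Set.Icc (x 1) (x (2 * (n + 1)))) :=
    ContinuousOn.div (by fun_prop) (by fun_prop) fun v hv => (affine_pos h1 h2 hv).ne'
  have hfac : ∀ (u : Fin (n + 1) → ℝ) (f : ℝ → ℝ),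
      (Matrix.of fun r (j : Fin (n + 1)) => 1 / (c * u r + d) * f (u r) ^ (j : ℕ)).det =
        (∏ r, 1 / (c * u r + d)) * (Matrix.of fun r j : Fin (n + 1) => f (u r) ^ (j : ℕ)).det :=
    fun u f => Matrix.det_mul_column (fun r => 1 / (c * u r + d))
      (Matrix.of fun r j : Fin (n + 1) => f (u r) ^ (j : ℕ))
  by_cases hc : c = 0
  · subst hc
    have hd : 0 < d := by simpa using h1
    refine det_linkPeriod_eq_const_mul β hx (g := fun j v => 1 / (0 * v + d) * v ^ (j : ℕ))
      (h := fun j v => v ^ (j : ℕ)) (fun j => hinv.mul (by fun_prop))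
      (fun j => by fun_prop) fun u _ => ?_
    refine (hfac u id).trans ?_
    have hsq : absInvSqrt d ^ 2 = 1 / d := by
      rw [absInvSqrt_eq, abs_of_pos hd, div_pow, Real.sq_sqrt hd.le, one_pow]
    simp only [zero_mul, zero_add, Finset.prod_const, Nat.card_Icc, Finset.card_univ,
      Fintype.card_fin, Nat.add_sub_cancel, pow_mul, hsq, id]
  · set C : ℝ := ∏ i : Fin (n + 1), ∏ _j ∈ Finset.Ioi i, c with hC
    have hC0 : (C : ℂ) ≠ 0 := by
      rw [Complex.ofReal_ne_zero, hC]
      exact Finset.prod_ne_zero_iff.mpr fun i _ => Finset.prod_ne_zero_iff.mpr fun j _ => hc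
    have hs := det_linkPeriod_shift β hx h1 h2
    rw [det_linkPeriod_eq_const_mul β hx (C := C)
        (g := fun j v => 1 / (c * v + d) * (c * v + d) ^ (j : ℕ))
        (h := fun j v => 1 / (c * v + d) * v ^ (j : ℕ))
        (fun j => hinv.mul (by fun_prop)) (fun j => hinv.mul (by fun_prop)),
      det_linkPeriod_eq_const_mul β hx (C := C) (g := fun j v => (c * v + d) ^ (j : ℕ))
        (h := fun j v => v ^ (j : ℕ))
        (fun j => by fun_prop) (fun j => by fun_prop) (fun u _ => det_pow_affine c d u)] at hs
    · refine mul_left_cancel₀ hC0 (hs.trans ?_)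
      ring
    · intro u _
      refine (hfac u fun v => c * v + d).trans (Eq.trans ?_ (congrArg _ (hfac u id).symm))
      rw [det_pow_affine]
      simp only [id]
      ring

/-- The prefactor `∏_{i<j} (x j - x i)^{1/4}`. -/
noncomputable def pairProd (N : ℕ) (x : ℕ → ℝ) : ℝ :=
  ∏ p ∈ (Finset.Icc 1 (2 * N) ×ˢ Finset.Icc 1 (2 * N)).filter fun p => p.1 < p.2,
    (x p.2 - x p.1) ^ ((4 : ℝ)⁻¹)

lemma prod_filter_lt_sub {N : ℕ} (u : Fin N → ℝ) :
    ∏ p ∈ (Finset.univ ×ˢ Finset.univ : Finset (Fin N × Fin N)).filter (fun p => p.1 < p.2),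
      (u p.2 - u p.1) = (Matrix.of fun r j : Fin N => u r ^ (j : ℕ)).det := by
  refine Eq.trans ?_ (Matrix.det_vandermonde u).symm
  rw [Finset.prod_filter, Finset.prod_product]
  refine Finset.prod_congr rfl fun i _ => ?_
  rw [← Finset.prod_filter]
  refine Finset.prod_congr ?_ fun _ _ => rfl
  ext j
  simp

lemma rho_eq {N : ℕ} {x : ℕ → ℝ} (hx : IsChamber N x) {k : Fin N → ℕ}
    (hk : ∀ r, k r ∈ Finset.Icc 1 (2 * N - 1)) :
    rho N k x = pairProd N x * periodDet x k fun j v => v ^ (j : ℕ) := by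
  rw [periodDet_eq_integral hx hk fun j => by fun_prop, rho, pairProd]
  congr 2
  ext u
  rw [prod_filter_lt_sub]
  rfl

lemma coulomb_eq {N : ℕ} (β : LinkPattern N) {x : ℕ → ℝ} (hx : IsChamber N x) :
    coulomb N β x = pairProd N x *
      (Matrix.of fun r (j : Fin N) => linkPeriod β x r fun v => v ^ (j : ℕ)).det := by
  rw [← sum_linkCoeff_periodDet, coulomb, Finset.mul_sum]
  refine Finset.sum_congr rfl fun k hk => ?_
  rw [rho_eq hx (Fintype.mem_piFinset.mp (Finset.mem_filter.mp hk).1)]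
  push_cast
  ring

lemma prod_filter_lt_mul {R α : Type*} [CommMonoid R] [LinearOrder α] (s : Finset α)
    (h : α → R) : ∏ p ∈ (s ×ˢ s).filter (fun p => p.1 < p.2), h p.1 * h p.2 =
      (∏ i ∈ s, h i) ^ (s.card - 1) := by
  have h1 : ∏ p ∈ (s ×ˢ s).filter (fun p => p.1 < p.2), h p.2 =
      ∏ i ∈ s, ∏ j ∈ s, if j < i then h i else 1 := by
    rw [Finset.prod_filter, Finset.prod_product_right]
  have h2 : ∏ p ∈ (s ×ˢ s).filter (fun p => p.1 < p.2), h p.1 =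
      ∏ i ∈ s, ∏ j ∈ s, if i < j then h i else 1 := by
    rw [Finset.prod_filter, Finset.prod_product]
  rw [Finset.prod_mul_distrib, h1, h2, ← Finset.prod_mul_distrib, ← Finset.prod_pow]
  refine Finset.prod_congr rfl fun i hi => ?_
  rw [← Finset.prod_mul_distrib, ← Finset.card_erase_of_mem hi, ← Finset.prod_const,
    ← Finset.mul_prod_erase _ _ hi]
  simp only [lt_irrefl, if_false, one_mul]
  refine Finset.prod_congr rfl fun j hj => ?_
  rcases lt_or_gt_of_ne (Finset.ne_of_mem_erase hj) with hlt | hlt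
  · rw [if_neg hlt.not_gt, if_pos hlt, one_mul]
  · rw [if_pos hlt, if_neg hlt.not_gt, mul_one]

lemma mobius_sub {a b c d s t : ℝ} (hD : a * d - b * c = 1) (hs : c * s + d ≠ 0)
    (ht : c * t + d ≠ 0) : (a * s + b) / (c * s + d) - (a * t + b) / (c * t + d) =
      (s - t) / ((c * s + d) * (c * t + d)) := by
  rw [div_sub_div _ _ hs ht]
  congr 1
  linear_combination (s - t) * hD

section Mobius

variable {N : ℕ} {x : ℕ → ℝ} {a b c d : ℝ}

lemma IsChamber.affine_pos (hx : IsChamber N x) (h1 : 0 < c * x 1 + d)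
    (h2 : 0 < c * x (2 * N) + d) {i : ℕ} (hi : i ∈ Finset.Icc 1 (2 * N)) :
    0 < c * x i + d := by
  have hi' := Finset.mem_Icc.mp hi
  exact _root_.affine_pos h1 h2 ⟨hx.le le_rfl hi'.1 hi'.2, hx.le hi'.1 hi'.2 le_rfl⟩

lemma IsChamber.mobius (hx : IsChamber N x) (hD : a * d - b * c = 1) (h1 : 0 < c * x 1 + d)
    (h2 : 0 < c * x (2 * N) + d) :
    IsChamber N fun i => (a * x i + b) / (c * x i + d) := by
  intro i k hi hik hk
  have hLi := hx.affine_pos h1 h2 (i := i) (Finset.mem_Icc.mpr ⟨hi, by omega⟩)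
  have hLk := hx.affine_pos h1 h2 (i := k) (Finset.mem_Icc.mpr ⟨by omega, hk⟩)
  rw [← sub_pos, mobius_sub hD hLk.ne' hLi.ne']
  exact div_pos (sub_pos.mpr (hx i k hi hik hk)) (mul_pos hLk hLi)

lemma pairProd_mobius (hx : IsChamber N x) (hD : a * d - b * c = 1) (h1 : 0 < c * x 1 + d)
    (h2 : 0 < c * x (2 * N) + d) :
    pairProd N (fun i => (a * x i + b) / (c * x i + d)) *
      (∏ i ∈ Finset.Icc 1 (2 * N), (c * x i + d) ^ ((4 : ℝ)⁻¹)) ^ (2 * N - 1) =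
      pairProd N x := by
  have h := prod_filter_lt_mul (Finset.Icc 1 (2 * N)) fun i => (c * x i + d) ^ ((4 : ℝ)⁻¹)
  rw [Nat.card_Icc, Nat.add_sub_cancel] at h
  rw [← h, pairProd, pairProd, ← Finset.prod_mul_distrib]
  refine Finset.prod_congr rfl fun p hp => ?_
  simp only [Finset.mem_filter, Finset.mem_product] at hp
  have hL1 := hx.affine_pos h1 h2 hp.1.1
  have hL2 := hx.affine_pos h1 h2 hp.1.2
  have hpos : 0 < x p.2 - x p.1 := sub_pos.mpr
    (hx _ _ (Finset.mem_Icc.mp hp.1.1).1 hp.2 (Finset.mem_Icc.mp hp.1.2).2)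
  rw [mobius_sub hD hL2.ne' hL1.ne', ← Real.mul_rpow hL1.le hL2.le,
    ← Real.mul_rpow (by positivity) (by positivity), mul_comm (c * x p.1 + d),
    div_mul_cancel₀ _ (mul_pos hL2 hL1).ne']

lemma sqrtWeight_mobius (hx : IsChamber N x) (hD : a * d - b * c = 1) (h1 : 0 < c * x 1 + d)
    (h2 : 0 < c * x (2 * N) + d) {v : ℝ} (hv : 0 < c * v + d) :
    (∏ i ∈ Finset.Icc 1 (2 * N), absInvSqrt (c * x i + d)) *
      sqrtWeight N (fun i => (a * x i + b) / (c * x i + d)) ((a * v + b) / (c * v + d)) =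
      (c * v + d) ^ N * sqrtWeight N x v := by
  have hsq : absInvSqrt (c * v + d) ^ 2 = (c * v + d)⁻¹ := by
    rw [absInvSqrt_eq, abs_of_pos hv, div_pow, Real.sq_sqrt hv.le, one_pow, one_div]
  have hw : sqrtWeight N x v = (c * v + d)⁻¹ ^ N *
      ((∏ i ∈ Finset.Icc 1 (2 * N), absInvSqrt (c * x i + d)) *
      sqrtWeight N (fun i => (a * x i + b) / (c * x i + d)) ((a * v + b) / (c * v + d))) := by
    have hc : (c * v + d)⁻¹ ^ N = ∏ _i ∈ Finset.Icc 1 (2 * N), absInvSqrt (c * v + d) := by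
      rw [Finset.prod_const, Nat.card_Icc, Nat.add_sub_cancel, pow_mul, hsq]
    rw [hc, sqrtWeight, sqrtWeight, ← Finset.prod_mul_distrib, ← Finset.prod_mul_distrib]
    refine Finset.prod_congr rfl fun i hi => ?_
    have hLi := hx.affine_pos h1 h2 hi
    rw [mobius_sub hD hv.ne' hLi.ne', ← absInvSqrt_mul, ← absInvSqrt_mul, ← mul_assoc,
      mul_div_cancel₀ _ (mul_pos hv hLi).ne']
  rw [hw, ← mul_assoc ((c * v + d) ^ N), ← mul_pow, mul_inv_cancel₀ hv.ne', one_pow, one_mul]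

lemma period_mobius (hx : IsChamber N x) (hD : a * d - b * c = 1) (h1 : 0 < c * x 1 + d)
    (h2 : 0 < c * x (2 * N) + d) {k : ℕ} (hk : k ∈ Finset.Icc 1 (2 * N - 1)) (g : ℝ → ℝ) :
    (∏ i ∈ Finset.Icc 1 (2 * N), absInvSqrt (c * x i + d)) *
      period N (fun i => (a * x i + b) / (c * x i + d)) k g =
      period N x k fun v =>
        1 / (c * v + d) ^ 2 * (c * v + d) ^ N * g ((a * v + b) / (c * v + d)) := by
  have hk' := Finset.mem_Icc.mp hk
  have hlt := hx k (k + 1) hk'.1 (by omega) (by omega)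
  have hLk := hx.affine_pos h1 h2 (i := k) (Finset.mem_Icc.mpr ⟨hk'.1, by omega⟩)
  have hLk' := hx.affine_pos h1 h2 (i := k + 1) (Finset.mem_Icc.mpr ⟨by omega, by omega⟩)
  have hL : ∀ v ∈ Set.Icc (x k) (x (k + 1)), 0 < c * v + d :=
    fun v hv => _root_.affine_pos hLk hLk' hv
  have hmono : StrictMonoOn (fun v => (a * v + b) / (c * v + d)) (Set.Icc (x k) (x (k + 1))) := by
    intro s hs t ht hst
    have := hL s hs
    have := hL t ht
    rw [← sub_pos, mobius_sub hD (hL t ht).ne' (hL s hs).ne']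
    exact div_pos (sub_pos.mpr hst) (by positivity)
  have hcont : ContinuousOn (fun v => (a * v + b) / (c * v + d)) (Set.Icc (x k) (x (k + 1))) :=
    ContinuousOn.div (by fun_prop) (by fun_prop) fun v hv => (hL v hv).ne'
  have himg : (fun v => (a * v + b) / (c * v + d)) '' Set.Ioo (x k) (x (k + 1)) =
      Set.Ioo ((a * x k + b) / (c * x k + d)) ((a * x (k + 1) + b) / (c * x (k + 1) + d)) := by
    refine Set.Subset.antisymm ?_ (intermediate_value_Ioo hlt.le hcont)
    rintro _ ⟨v, hv, rfl⟩
    exact ⟨hmono (Set.left_mem_Icc.mpr hlt.le) ⟨hv.1.le, hv.2.le⟩ hv.1,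
      hmono ⟨hv.1.le, hv.2.le⟩ (Set.right_mem_Icc.mpr hlt.le) hv.2⟩
  rw [period, period, ← himg, integral_image_eq_integral_abs_deriv_smul measurableSet_Ioo
    (f' := fun v => 1 / (c * v + d) ^ 2) _ (hmono.injOn.mono Set.Ioo_subset_Icc_self),
    ← integral_const_mul]
  · refine setIntegral_congr_fun measurableSet_Ioo fun v hv => ?_
    have hv' := hL v ⟨hv.1.le, hv.2.le⟩
    have h := sqrtWeight_mobius hx hD h1 h2 hv'
    simp only [smul_eq_mul]
    rw [abs_of_pos (by positivity)]
    linear_combination (1 / (c * v + d) ^ 2 * g ((a * v + b) / (c * v + d))) * h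
  · intro v hv
    have hv' := hL v ⟨hv.1.le, hv.2.le⟩
    have ha : HasDerivAt (fun t => a * t + b) (a * 1) v :=
      ((hasDerivAt_id v).const_mul a).add_const b
    have hb : HasDerivAt (fun t => c * t + d) (c * 1) v :=
      ((hasDerivAt_id v).const_mul c).add_const d
    refine ((ha.div hb hv'.ne').congr_deriv ?_).hasDerivWithinAt
    congr 1
    linear_combination hD

end Mobius

lemma det_mobius_vandermonde {n : ℕ} {a b c d : ℝ} (hD : a * d - b * c = 1)
    (u : Fin (n + 1) → ℝ) :
    (Matrix.of fun r j : Fin (n + 1) =>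
      (a * u r + b) ^ (j : ℕ) * (c * u r + d) ^ (n - (j : ℕ))).det =
      (Matrix.of fun r j : Fin (n + 1) => u r ^ (j : ℕ)).det := by
  have h1 := Matrix.det_projVandermonde (fun r => a * u r + b) fun r => c * u r + d
  have h2 := Matrix.det_vandermonde u
  refine Eq.trans ?_ (h1.trans (Eq.trans ?_ h2.symm))
  · congr 1
    ext r j
    rw [Matrix.projVandermonde_apply, Matrix.of_apply, Fin.val_rev]
    congr 2
    omega
  · refine Finset.prod_congr rfl fun i _ => Finset.prod_congr rfl fun j _ => ?_
    linear_combination (u j - u i) * hD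

lemma periodDet_mobius {n : ℕ} {x : ℕ → ℝ} {a b c d : ℝ} (hx : IsChamber (n + 1) x)
    (hD : a * d - b * c = 1) (h1 : 0 < c * x 1 + d) (h2 : 0 < c * x (2 * n + 2) + d)
    {k : Fin (n + 1) → ℕ} (hk : ∀ r, k r ∈ Finset.Icc 1 (2 * (n + 1) - 1)) :
    (∏ i ∈ Finset.Icc 1 (2 * (n + 1)), absInvSqrt (c * x i + d)) ^ (n + 1) *
      periodDet (fun i => (a * x i + b) / (c * x i + d)) k (fun j v => v ^ (j : ℕ)) =
      periodDet x k fun j v => 1 / (c * v + d) * v ^ (j : ℕ) := by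
  set P := ∏ i ∈ Finset.Icc 1 (2 * (n + 1)), absInvSqrt (c * x i + d) with hP
  have hinv : ContinuousOn (fun v => 1 / (c * v + d)) (Set.Icc (x 1) (x (2 * (n + 1)))) :=
    ContinuousOn.div (by fun_prop) (by fun_prop) fun v hv => (affine_pos h1 h2 hv).ne'
  have hper : ∀ r (j : Fin (n + 1)),
      P * period (n + 1) (fun i => (a * x i + b) / (c * x i + d)) (k r) (fun v => v ^ (j : ℕ)) =
        period (n + 1) x (k r) fun v =>
          1 / (c * v + d) * ((a * v + b) ^ (j : ℕ) * (c * v + d) ^ (n - (j : ℕ))) := by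
    intro r j
    have hkr := Finset.mem_Icc.mp (hk r)
    rw [hP, period_mobius hx hD h1 h2 (hk r)]
    refine period_congr fun v hv => ?_
    have hv' := affine_pos h1 h2 (v := v) ⟨(hx.le le_rfl hkr.1 (by omega)).trans hv.1.le,
      hv.2.le.trans (hx.le (by omega) (by omega) le_rfl)⟩
    have hj : (c * v + d) ^ (n + 1) =
        (c * v + d) * ((c * v + d) ^ (j : ℕ) * (c * v + d) ^ (n - (j : ℕ))) := by
      rw [← pow_add, ← pow_succ']
      congr 1
      have := j.isLt
      omega
    rw [hj, div_pow]
    field_simp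
  have hdet := Matrix.det_mul_column (fun _ => P) (Matrix.of fun r (j : Fin (n + 1)) =>
    period (n + 1) (fun i => (a * x i + b) / (c * x i + d)) (k r) fun v => v ^ (j : ℕ))
  rw [Finset.prod_const, Finset.card_univ, Fintype.card_fin] at hdet
  refine hdet.symm.trans ?_
  simp only [Matrix.of_apply, hper]
  refine (periodDet_eq_const_mul hx hk (C := 1)
    (g := fun j v => 1 / (c * v + d) * ((a * v + b) ^ (j : ℕ) * (c * v + d) ^ (n - (j : ℕ))))
    (h := fun j v => 1 / (c * v + d) * v ^ (j : ℕ))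
    (fun j => hinv.mul (by fun_prop)) (fun j => hinv.mul (by fun_prop)) fun u _ => ?_).trans
    (one_mul _)
  have e1 := Matrix.det_mul_column (fun r => 1 / (c * u r + d)) (Matrix.of fun r j : Fin (n + 1) =>
    (a * u r + b) ^ (j : ℕ) * (c * u r + d) ^ (n - (j : ℕ)))
  have e2 := Matrix.det_mul_column (fun r => 1 / (c * u r + d))
    (Matrix.of fun r j : Fin (n + 1) => u r ^ (j : ℕ))
  rw [one_mul]
  exact e1.trans (Eq.trans (congrArg _ (det_mobius_vandermonde hD u)) e2.symm)

/-- Möbius covariance for a matrix of determinant one whose pole lies outside `[x 1, x (2N)]`. -/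
theorem coulomb_mobius_of_det_eq_one {n : ℕ} (β : LinkPattern (n + 1)) {x : ℕ → ℝ}
    (hx : IsChamber (n + 1) x) {a b c d : ℝ} (hD : a * d - b * c = 1) (h1 : 0 < c * x 1 + d)
    (h2 : 0 < c * x (2 * n + 2) + d) :
    coulomb (n + 1) β x =
      ((∏ i ∈ Finset.Icc 1 (2 * (n + 1)),
          (1 / (c * x i + d) ^ 2) ^ (-(8 : ℝ)⁻¹) : ℝ) : ℂ) *
        coulomb (n + 1) β (fun i => (a * x i + b) / (c * x i + d)) := by
  have hy := hx.mobius hD h1 h2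
  set y : ℕ → ℝ := fun i => (a * x i + b) / (c * x i + d) with hy_def
  set P := ∏ i ∈ Finset.Icc 1 (2 * (n + 1)), absInvSqrt (c * x i + d) with hP
  set Q := ∏ i ∈ Finset.Icc 1 (2 * (n + 1)), (c * x i + d) ^ ((4 : ℝ)⁻¹) with hQ
  have hφ : ∏ i ∈ Finset.Icc 1 (2 * (n + 1)), (1 / (c * x i + d) ^ 2) ^ (-(8 : ℝ)⁻¹) = Q := by
    refine Finset.prod_congr rfl fun i hi => ?_
    have hL := hx.affine_pos h1 h2 hi
    rw [one_div, Real.inv_rpow (by positivity), Real.rpow_neg (by positivity), inv_inv,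
      ← Real.rpow_natCast, ← Real.rpow_mul hL.le]
    norm_num
  have hPQ : Q ^ 2 * P = 1 := by
    rw [hP, hQ, ← Finset.prod_pow, ← Finset.prod_mul_distrib]
    refine Finset.prod_eq_one fun i hi => ?_
    have hL := hx.affine_pos h1 h2 hi
    rw [absInvSqrt, abs_of_pos hL, ← Real.rpow_natCast, ← Real.rpow_mul hL.le,
      ← Real.rpow_add hL]
    norm_num
  have hP0 : (P : ℂ) ≠ 0 := by
    intro h
    rw [Complex.ofReal_eq_zero.mp h, mul_zero] at hPQ
    exact zero_ne_one hPQ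
  have hpair : pairProd (n + 1) y * Q ^ (2 * n + 1) = pairProd (n + 1) x :=
    pairProd_mobius hx hD h1 h2
  have hdet : (P : ℂ) ^ n *
      (Matrix.of fun r (j : Fin (n + 1)) => linkPeriod β y r fun v => v ^ (j : ℕ)).det =
      (Matrix.of fun r (j : Fin (n + 1)) => linkPeriod β x r fun v => v ^ (j : ℕ)).det := by
    refine mul_left_cancel₀ hP0 ?_
    rw [hP, ← det_linkPeriod_div_affine β hx h1 h2, ← hP, ← mul_assoc, ← pow_succ',
      ← sum_linkCoeff_periodDet β y fun j v => v ^ (j : ℕ),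
      ← sum_linkCoeff_periodDet β x fun j v => 1 / (c * v + d) * v ^ (j : ℕ), Finset.mul_sum]
    refine Finset.sum_congr rfl fun k hk => ?_
    have hk' : P ^ (n + 1) * periodDet y k (fun j v => v ^ (j : ℕ)) = _ :=
      periodDet_mobius hx hD h1 h2 (Fintype.mem_piFinset.mp (Finset.mem_filter.mp hk).1)
    rw [← hk', Complex.ofReal_mul, Complex.ofReal_pow]
    ring
  rw [hφ, coulomb_eq β hx, coulomb_eq β hy, ← hdet, ← hpair]
  have hPQ' : ((Q : ℂ) ^ 2 * P) ^ n = 1 := by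
    rw [← Complex.ofReal_pow, ← Complex.ofReal_mul, hPQ, Complex.ofReal_one, one_pow]
  rw [mul_pow, ← pow_mul] at hPQ'
  push_cast
  rw [pow_succ]
  linear_combination ((pairProd (n + 1) y : ℂ) * Q *
    (Matrix.of fun r (j : Fin (n + 1)) => linkPeriod β y r fun v => v ^ (j : ℕ)).det) * hPQ'

/-- **Möbius covariance of the Coulomb gas integrals.** -/
theorem coulomb_mobius_covariance (N : ℕ) (hN : 1 ≤ N) (β : LinkPattern N) (x : ℕ → ℝ)
    (hx : IsChamber N x) (a b c d : ℝ) (hdet : 0 < a * d - b * c)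
    (hden : ∀ i : ℕ, 1 ≤ i → i ≤ 2 * N → c * x i + d ≠ 0)
    (hord : ∀ i k : ℕ, 1 ≤ i → i < k → k ≤ 2 * N →
      (a * x i + b) / (c * x i + d) < (a * x k + b) / (c * x k + d)) :
    coulomb N β x =
      ((∏ i ∈ Finset.Icc 1 (2 * N),
          ((a * d - b * c) / (c * x i + d) ^ 2) ^ (-(8 : ℝ)⁻¹) : ℝ) : ℂ) *
        coulomb N β (fun i => (a * x i + b) / (c * x i + d)) := by
  obtain ⟨n, rfl⟩ : ∃ n, N = n + 1 := ⟨N - 1, by omega⟩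
  have hx1 := hx 1 (2 * n + 2) (by omega) (by omega) (by omega)
  have hy1 := hord 1 (2 * n + 2) (by omega) (by omega) (by omega)
  have hL1 := hden 1 (by omega) (by omega)
  have hL2 := hden (2 * n + 2) (by omega) (by omega)
  have hLL : 0 < (c * x 1 + d) * (c * x (2 * n + 2) + d) := by
    rw [← sub_pos, div_sub_div _ _ hL2 hL1,
      show (a * x (2 * n + 2) + b) * (c * x 1 + d) - (c * x (2 * n + 2) + d) * (a * x 1 + b) =
        (a * d - b * c) * (x (2 * n + 2) - x 1) by ring] at hy1
    have h := (div_pos_iff_of_pos_left (mul_pos hdet (sub_pos.mpr hx1))).mp hy1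
    linarith
  obtain ⟨t, ht, h1, h2⟩ : ∃ t : ℝ, t ^ 2 * (a * d - b * c) = 1 ∧ 0 < t * (c * x 1 + d) ∧
      0 < t * (c * x (2 * n + 2) + d) := by
    have hs : 0 < √(a * d - b * c) := Real.sqrt_pos.mpr hdet
    have hsq : (√(a * d - b * c))⁻¹ ^ 2 * (a * d - b * c) = 1 := by
      rw [inv_pow, Real.sq_sqrt hdet.le, inv_mul_cancel₀ hdet.ne']
    rcases pos_and_pos_or_neg_and_neg_of_mul_pos hLL with ⟨p1, p2⟩ | ⟨p1, p2⟩
    · exact ⟨(√(a * d - b * c))⁻¹, hsq, mul_pos (inv_pos.mpr hs) p1, mul_pos (inv_pos.mpr hs) p2⟩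
    · have hneg : -(√(a * d - b * c))⁻¹ < 0 := neg_neg_of_pos (inv_pos.mpr hs)
      exact ⟨-(√(a * d - b * c))⁻¹, by rw [neg_sq]; exact hsq, mul_pos_of_neg_of_neg hneg p1,
        mul_pos_of_neg_of_neg hneg p2⟩
  have ht0 : t ≠ 0 := by
    rintro rfl
    simp at ht
  have hscale : ∀ p q s : ℝ, t * p * s + t * q = t * (p * s + q) := fun p q s => by ring
  have h := coulomb_mobius_of_det_eq_one β hx (a := t * a) (b := t * b) (c := t * c) (d := t * d)
    (by linear_combination ht) (by rwa [hscale]) (by rwa [hscale])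
  simp only [hscale, mul_div_mul_left _ _ ht0] at h
  rw [h]
  congr 2
  refine Finset.prod_congr rfl fun i hi => ?_
  have hLi := hden i (Finset.mem_Icc.mp hi).1 (Finset.mem_Icc.mp hi).2
  congr 1
  field_simp
  linear_combination -ht
end
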